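/- In the killed Wright–Fisher setting, assume ρ_1 < ρ_0 < ρ_α, where ρ_0 = −r(0), ρ_1 = −r(1) and ρ_α is the extinction rate of the unique QSD α on (0,1) for τ_{0,1,∂}. Then δ_1 is the only stable quasi-stationary distribution for the killing time τ_∂, with convergence rate ρ_0 − ρ_1: for all n ≥ 1 and ξ > 0 there exists C_{n,ξ} > 0 such that for every μ ∈ 𝓜^0_{n,ξ}, ‖μA_t − δ_1‖_{TV} ≤ C_{n,ξ} e^{−(ρ_0 − ρ_1) t}. -/

import Mathlib

open MeasureTheory ProbabilityTheory Filter Set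
open scoped ENNReal NNReal Topology

noncomputable section

/-- The Wright–Fisher generator with selection `s` and diffusion parameter `σ`:
`𝓛_WF f(x) = -s x (1-x) f'(x) + (σ²/2) x (1-x) f''(x)`. -/
def LWF (s σ : ℝ) (f : ℝ → ℝ) : ℝ → ℝ := fun x =>
  -s * x * (1 - x) * deriv f x + σ ^ 2 / 2 * (x * (1 - x)) * deriv (deriv f) x

/-- A (weak) solution of the Wright–Fisher SDE with selection
`dX_t = -s X_t (1-X_t) dt + σ √(X_t(1-X_t)) dB_t`, `X_0 ∼ μ₀`, characterized through
the associated martingale problem for the generator `LWF s σ`, enriched with an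
independent standard exponential random variable `Tkill` used for the soft killing at
rate `-r ≥ 0`:  `τ_∂ = inf{t ≥ 0 : ∫₀ᵗ (-r(X_u)) du ≥ Tkill}`. -/
structure WFKilled (s σ : ℝ) (r : ℝ → ℝ) (μ₀ : Measure ℝ) where
  (Ω : Type)
  [mΩ : MeasurableSpace Ω]
  (P : Measure Ω)
  (probP : IsProbabilityMeasure P)
  (X : ℝ → Ω → ℝ)
  (measX : ∀ t, Measurable (X t))
  (contX : ∀ ω, Continuous fun t => X t ω)
  (preZero : ∀ t ≤ (0:ℝ), X t = X 0)
  (range01 : ∀ t ω, X t ω ∈ Icc (0:ℝ) 1)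
  (initLaw : P.map (X 0) = μ₀)
  (ℱ : Filtration ℝ mΩ)
  (adaptedX : Adapted ℱ X)
  (martProblem : ∀ f : ℝ → ℝ, ContDiff ℝ 2 f →
    Martingale (fun t ω => f (X t ω) - ∫ u in Ioc (0:ℝ) t, LWF s σ f (X u ω)) ℱ P)
  (Tkill : Ω → ℝ)
  (measT : Measurable Tkill)
  (expLaw : ∀ t : ℝ, 0 ≤ t → P {ω | t < Tkill ω} = ENNReal.ofReal (Real.exp (-t)))
  (indepT : IndepFun (fun ω t => X t ω) Tkill P)

attribute [instance] WFKilled.mΩ WFKilled.probP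

variable {s σ : ℝ} {r : ℝ → ℝ} {μ₀ : Measure ℝ}

/-- The survival event `{t < τ_∂}` for the soft killing at rate `-r`. -/
def WFKilled.aliveSoft (W : WFKilled s σ r μ₀) (t : ℝ) : Set W.Ω :=
  {ω | ∫ u in Ioc (0:ℝ) t, (-(r (W.X u ω))) < W.Tkill ω}

/-- The event `{t < τ_0}`: the boundary point `0` has not been hit by time `t`. -/
def WFKilled.noHit0 (W : WFKilled s σ r μ₀) (t : ℝ) : Set W.Ω :=
  {ω | ∀ u ∈ Icc (0:ℝ) t, W.X u ω ≠ 0}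

/-- The event `{t < τ_1}`: the boundary point `1` has not been hit by time `t`. -/
def WFKilled.noHit1 (W : WFKilled s σ r μ₀) (t : ℝ) : Set W.Ω :=
  {ω | ∀ u ∈ Icc (0:ℝ) t, W.X u ω ≠ 1}

/-- The event `{t < τ_{0,1,∂}}`. -/
def WFKilled.aliveAll (W : WFKilled s σ r μ₀) (t : ℝ) : Set W.Ω :=
  W.aliveSoft t ∩ W.noHit0 t ∩ W.noHit1 t

/-- The law of `X_t` conditioned on an event `E` (e.g. survival up to time `t`). -/
def WFKilled.condLaw (W : WFKilled s σ r μ₀) (E : Set W.Ω) (t : ℝ) : Measure ℝ :=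
  (W.P E)⁻¹ • (W.P.restrict E).map (W.X t)

/-- The hitting time of `0`, as an element of `ℝ≥0∞`. -/
def WFKilled.hit0 (W : WFKilled s σ r μ₀) (ω : W.Ω) : ℝ≥0∞ :=
  sInf {t : ℝ≥0∞ | ∃ u : ℝ, 0 ≤ u ∧ t = ENNReal.ofReal u ∧ W.X u ω = 0}

/-- The hitting time of `1`, as an element of `ℝ≥0∞`. -/
def WFKilled.hit1 (W : WFKilled s σ r μ₀) (ω : W.Ω) : ℝ≥0∞ :=
  sInf {t : ℝ≥0∞ | ∃ u : ℝ, 0 ≤ u ∧ t = ENNReal.ofReal u ∧ W.X u ω = 1}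

/-- The soft killing time `τ_∂`, as an element of `ℝ≥0∞`. -/
def WFKilled.killT (W : WFKilled s σ r μ₀) (ω : W.Ω) : ℝ≥0∞ :=
  sInf {t : ℝ≥0∞ | ∃ u : ℝ, 0 ≤ u ∧ t = ENNReal.ofReal u ∧
    W.Tkill ω ≤ ∫ v in Ioc (0:ℝ) u, (-(r (W.X v ω)))}

/-- Quasi-stationary distribution on `(0,1)` for the extinction time `τ_{0,1,∂}`,
with extinction rate `ρ`: under any realization of the killed Wright–Fisher diffusion
started from `α`, one has `ℙ_α(X_t ∈ A ; t < τ_{0,1,∂}) = e^{-ρ t} α(A)`. -/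
def IsQSD (s σ : ℝ) (r : ℝ → ℝ) (α : Measure ℝ) (ρ : ℝ) : Prop :=
  IsProbabilityMeasure α ∧ α (Ioo (0:ℝ) 1)ᶜ = 0 ∧
  ∀ W : WFKilled s σ r α, ∀ t : ℝ, 0 < t → ∀ A : Set ℝ, MeasurableSet A →
    W.P ({ω | W.X t ω ∈ A} ∩ W.aliveAll t) = ENNReal.ofReal (Real.exp (-(ρ * t))) * α A

/-- Quasi-stationary distribution on `[0,1]` for the soft killing time `τ_∂` alone,
with extinction rate `ρ`. -/
def IsQSDsoft (s σ : ℝ) (r : ℝ → ℝ) (α : Measure ℝ) (ρ : ℝ) : Prop :=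
  IsProbabilityMeasure α ∧ α (Icc (0:ℝ) 1)ᶜ = 0 ∧
  ∀ W : WFKilled s σ r α, ∀ t : ℝ, 0 < t → ∀ A : Set ℝ, MeasurableSet A →
    W.P ({ω | W.X t ω ∈ A} ∩ W.aliveSoft t) = ENNReal.ofReal (Real.exp (-(ρ * t))) * α A

/-- Survival capacity `η` with extinction rate `ρ`:
`η(x) = e^{ρ t} 𝔼_x[η(X_t) ; t < τ_{0,1,∂}]`. -/
def IsSurvCap (s σ : ℝ) (r : ℝ → ℝ) (ρ : ℝ) (η : ℝ → ℝ) : Prop :=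
  Measurable η ∧ ∀ x ∈ Icc (0:ℝ) 1, ∀ W : WFKilled s σ r (Measure.dirac x), ∀ t : ℝ, 0 < t →
    η x = Real.exp (ρ * t) * ∫ ω in W.aliveAll t, η (W.X t ω) ∂W.P

/-- Total variation distance between two (finite) measures on `ℝ`. -/
def tvDist (μ ν : Measure ℝ) : ℝ :=
  ⨆ A : Set ℝ, |(μ A).toReal - (ν A).toReal|

/-- Existence of realizations of the killed Wright–Fisher diffusion from any initial law
on `[0,1]` (granted by the classical well-posedness of the Wright–Fisher SDE). -/
def WFExists (s σ : ℝ) (r : ℝ → ℝ) : Prop :=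
  ∀ μ : Measure ℝ, IsProbabilityMeasure μ → μ (Icc (0:ℝ) 1)ᶜ = 0 →
    Nonempty (WFKilled s σ r μ)


lemma wf_meas_uncurry {Ω : Type*} {m : MeasurableSpace Ω} (Y : ℝ → Ω → ℝ)
    (hY : ∀ u, Measurable (Y u)) (hc : ∀ ω, Continuous fun u => Y u ω) :
    Measurable (Function.uncurry Y) :=
  measurable_uncurry_of_continuous_of_measurable hc hY

lemma wf_meas_pathint {Ω : Type*} {m : MeasurableSpace Ω} (Y : ℝ → Ω → ℝ)
    (hY : ∀ u, Measurable (Y u)) (hc : ∀ ω, Continuous fun u => Y u ω)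
    (k : ℝ → ℝ) (hk : Measurable k) (a b : ℝ) :
    Measurable fun ω => ∫ u in Ioc a b, k (Y u ω) := by
  have h1 : Measurable (fun p : ℝ × Ω => k (Y p.1 p.2)) := hk.comp (wf_meas_uncurry Y hY hc)
  exact (StronglyMeasurable.integral_prod_left (μ := volume.restrict (Ioc a b))
    h1.stronglyMeasurable).measurable

section path
variable (k : ℝ → ℝ) (M : ℝ) (T : ℝ)

lemma wf_ii (hk : Measurable k) (hM : ∀ t, |k t| ≤ M) (a b : ℝ) :
    IntervalIntegrable k volume a b := by
  refine (intervalIntegrable_const (c := M)).mono_fun hk.aestronglyMeasurable ?_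
  refine Eventually.of_forall fun t => ?_
  simpa [Real.norm_eq_abs] using (hM t).trans (le_abs_self M)

lemma wf_I_lip (hk : Measurable k) (hM : ∀ t, |k t| ≤ M) (a b : ℝ) :
    |(∫ u in (0:ℝ)..b, k u) - ∫ u in (0:ℝ)..a, k u| ≤ M * |b - a| := by
  rw [intervalIntegral.integral_interval_sub_left (wf_ii k M hk hM _ _) (wf_ii k M hk hM _ _)]
  exact intervalIntegral.norm_integral_le_of_norm_le_const (f := k) (C := M) (fun t _ => hM t)

lemma wf_V_AC (hk : Measurable k) (hM : ∀ t, |k t| ≤ M) (hT : 0 ≤ T) :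
    AbsolutelyContinuousOnInterval (fun t => Real.exp (∫ u in (0:ℝ)..t, k u)) 0 T := by
  have hM0 : 0 ≤ M := (abs_nonneg _).trans (hM 0)
  have hIc : ∀ t ∈ uIcc 0 T, (∫ u in (0:ℝ)..t, k u) ∈ Icc (-(M*T)) (M*T) := by
    intro t ht
    rw [uIcc_of_le hT] at ht
    have := wf_I_lip k M hk hM 0 t
    simp only [intervalIntegral.integral_same, sub_zero] at this
    rw [abs_of_nonneg ht.1] at this
    exact abs_le.1 (this.trans (mul_le_mul_of_nonneg_left ht.2 hM0))
  obtain ⟨K, hK⟩ := (Real.contDiff_exp (n := 1)).contDiffOn.exists_lipschitzOnWith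
    (s := Icc (-(M*T)) (M*T)) (by decide) (convex_Icc _ _) isCompact_Icc
  have hI : LipschitzOnWith ⟨M, hM0⟩ (fun t => ∫ u in (0:ℝ)..t, k u) (uIcc 0 T) := by
    apply LipschitzOnWith.of_dist_le_mul
    intro x _ y _
    rw [Real.dist_eq, Real.dist_eq]
    exact wf_I_lip k M hk hM y x
  exact (hK.comp hI hIc).absolutelyContinuousOnInterval

lemma wf_V_deriv (hk : Measurable k) (hM : ∀ t, |k t| ≤ M) :
    ∀ᵐ t, t ∈ uIcc 0 T → deriv (fun t => Real.exp (∫ u in (0:ℝ)..t, k u)) t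
      = Real.exp (∫ u in (0:ℝ)..t, k u) * k t := by
  filter_upwards [(wf_ii k M hk hM 0 T).ae_hasDerivAt_integral] with t ht htm
  exact (ht htm 0 (by simp)).exp.deriv

lemma wf_path1 (hk : Measurable k) (hM : ∀ t, |k t| ≤ M) (hT : 0 ≤ T) :
    ∫ t in (0:ℝ)..T, Real.exp (∫ u in (0:ℝ)..t, k u) * k t
      = Real.exp (∫ u in (0:ℝ)..T, k u) - 1 := by
  have := (wf_V_AC k M T hk hM hT).integral_deriv_eq_sub
  rw [intervalIntegral.integral_same, Real.exp_zero] at this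
  rw [← this]
  apply intervalIntegral.integral_congr_ae
  filter_upwards [wf_V_deriv k M T hk hM] with t ht htm
  rw [ht (uIoc_subset_uIcc htm)]

lemma wf_path2 (hk : Measurable k) (hM : ∀ t, |k t| ≤ M) (hT : 0 ≤ T)
    (l : ℝ → ℝ) (hl : Continuous l) :
    ∫ t in (0:ℝ)..T, (∫ u in (0:ℝ)..t, l u) * (Real.exp (∫ u in (0:ℝ)..t, k u) * k t)
      = (∫ u in (0:ℝ)..T, l u) * Real.exp (∫ u in (0:ℝ)..T, k u)
        - ∫ t in (0:ℝ)..T, l t * Real.exp (∫ u in (0:ℝ)..t, k u) := by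
  have hA : AbsolutelyContinuousOnInterval (fun t => ∫ u in (0:ℝ)..t, l u) 0 T :=
    (hl.intervalIntegrable 0 T).absolutelyContinuousOnInterval_intervalIntegral (by simp)
  have := hA.integral_mul_deriv_eq_deriv_mul (wf_V_AC k M T hk hM hT)
  simp only [intervalIntegral.integral_same, zero_mul, sub_zero] at this
  have e1 : ∀ t, deriv (fun t => ∫ u in (0:ℝ)..t, l u) t = l t := fun t =>
    hl.deriv_integral l 0 t
  simp only [e1] at this
  rw [← this]
  apply intervalIntegral.integral_congr_ae
  filter_upwards [wf_V_deriv k M T hk hM] with t ht htm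
  rw [ht (uIoc_subset_uIcc htm)]
end path

/-- multiplicative functional -/
def wfV (W : WFKilled s σ r μ₀) (k : ℝ → ℝ) (t : ℝ) (ω : W.Ω) : ℝ :=
  Real.exp (∫ u in Ioc (0:ℝ) t, k (W.X u ω))

lemma wfV_pos (W : WFKilled s σ r μ₀) (k : ℝ → ℝ) (t : ℝ) (ω : W.Ω) : 0 < wfV W k t ω :=
  Real.exp_pos _

lemma wfV_meas_gen (W : WFKilled s σ r μ₀) {k : ℝ → ℝ} (hk : Measurable k) (t : ℝ)
    (m : MeasurableSpace W.Ω) (hm : ∀ u ≤ t, Measurable[m] (W.X u)) :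
    Measurable[m] (fun ω => ∫ u in Ioc (0:ℝ) t, k (W.X u ω)) := by
  have h := wf_meas_pathint (m := m) (fun u ω => W.X (min u t) ω)
    (fun u => hm _ (min_le_right _ _))
    (fun ω => (W.contX ω).comp (continuous_id.min continuous_const)) k hk 0 t
  convert h using 2 with ω
  apply setIntegral_congr_fun measurableSet_Ioc
  intro u hu
  simp [min_eq_left hu.2]

lemma wfV_adapted (W : WFKilled s σ r μ₀) {k : ℝ → ℝ} (hk : Measurable k) (t : ℝ) :
    Measurable[W.ℱ t] (wfV W k t) :=
  Real.measurable_exp.comp (wfV_meas_gen W hk t _ fun u hu =>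
    (W.adaptedX u).mono (W.ℱ.mono hu) le_rfl)

lemma wfV_meas (W : WFKilled s σ r μ₀) {k : ℝ → ℝ} (hk : Measurable k) (t : ℝ) :
    Measurable (wfV W k t) :=
  Real.measurable_exp.comp (wfV_meas_gen W hk t _ fun u _ => W.measX u)

lemma wfX_unc (W : WFKilled s σ r μ₀) : Measurable (fun p : ℝ × W.Ω => W.X p.1 p.2) :=
  wf_meas_uncurry W.X W.measX W.contX

lemma wfV_eq (W : WFKilled s σ r μ₀) (k : ℝ → ℝ) {t : ℝ} (ht : 0 ≤ t) (ω : W.Ω) :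
    wfV W k t ω = Real.exp (∫ u in (0:ℝ)..t, k (W.X u ω)) := by
  rw [wfV, intervalIntegral.integral_of_le ht]

lemma wfV_bound (W : WFKilled s σ r μ₀) {k : ℝ → ℝ} {M : ℝ} (hk : Measurable k)
    (hM : ∀ x ∈ Icc (0:ℝ) 1, |k x| ≤ M) {t : ℝ} (ht : 0 ≤ t) (ω : W.Ω) :
    |∫ u in Ioc (0:ℝ) t, k (W.X u ω)| ≤ M * t := by
  have := wf_I_lip (fun u => k (W.X u ω)) M (hk.comp (W.contX ω).measurable)
    (fun u => hM _ (W.range01 u ω)) 0 t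
  simpa [intervalIntegral.integral_of_le ht, abs_of_nonneg ht] using this

lemma wfV_le (W : WFKilled s σ r μ₀) {k : ℝ → ℝ} {M : ℝ} (hk : Measurable k)
    (hM : ∀ x ∈ Icc (0:ℝ) 1, |k x| ≤ M) {t : ℝ} (ht : 0 ≤ t) (ω : W.Ω) :
    |wfV W k t ω| ≤ Real.exp (M * t) := by
  rw [abs_of_pos (wfV_pos _ _ _ _)]
  exact Real.exp_le_exp.2 ((le_abs_self _).trans (wfV_bound W hk hM ht ω))

lemma wfV_le' (W : WFKilled s σ r μ₀) {k : ℝ → ℝ} {M : ℝ} (hk : Measurable k)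
    (hM : ∀ x ∈ Icc (0:ℝ) 1, |k x| ≤ M) {t T : ℝ} (ht : 0 ≤ t) (htT : t ≤ T) (ω : W.Ω) :
    |wfV W k t ω| ≤ Real.exp (M * T) := by
  have hM0 : 0 ≤ M := (abs_nonneg _).trans (hM 0 (by simp))
  exact (wfV_le W hk hM ht ω).trans (Real.exp_le_exp.2 (mul_le_mul_of_nonneg_left htT hM0))

lemma wfV_unc (W : WFKilled s σ r μ₀) {k : ℝ → ℝ} {M : ℝ} (hk : Measurable k)
    (hM : ∀ x ∈ Icc (0:ℝ) 1, |k x| ≤ M) :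
    Measurable (fun p : ℝ × W.Ω => wfV W k p.1 p.2) := by
  have h := wf_meas_uncurry (fun t ω => wfV W k (max t 0) ω) (fun t => wfV_meas W hk _) (by
    intro ω
    have e : (fun t => wfV W k (max t 0) ω) = fun t =>
        Real.exp (∫ u in (0:ℝ)..(max t 0), k (W.X u ω)) := by
      ext t; exact wfV_eq W k (le_max_right _ _) ω
    rw [e]
    have hM0 : 0 ≤ M := (abs_nonneg _).trans (hM 0 (by simp))
    have hI : LipschitzWith ⟨M, hM0⟩ (fun t => ∫ u in (0:ℝ)..t, k (W.X u ω)) := by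
      apply LipschitzWith.of_dist_le_mul
      intro x y
      rw [Real.dist_eq, Real.dist_eq]
      exact wf_I_lip (fun u => k (W.X u ω)) M (hk.comp (W.contX ω).measurable)
        (fun u => hM _ (W.range01 u ω)) y x
    exact Real.continuous_exp.comp (hI.continuous.comp (continuous_id.max continuous_const)))
  convert h using 1
  ext ⟨t, ω⟩
  simp only [Function.uncurry, wfV]
  congr 2
  rcases le_total t 0 with h0 | h0
  · rw [max_eq_right h0, Ioc_eq_empty (by simpa using h0)]; simp
  · rw [max_eq_left h0]

lemma wf_int_prod (W : WFKilled s σ r μ₀) (T C : ℝ) (F : ℝ × W.Ω → ℝ) (hF : Measurable F)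
    (hb : ∀ t ω, 0 < t → t ≤ T → |F (t, ω)| ≤ C) :
    Integrable F ((volume.restrict (Ioc 0 T)).prod W.P) := by
  refine Integrable.of_bound hF.aestronglyMeasurable C ?_
  rw [← Measure.restrict_univ (μ := W.P), Measure.prod_restrict]
  refine (ae_restrict_iff' (measurableSet_Ioc.prod MeasurableSet.univ)).2 ?_
  exact Eventually.of_forall fun p hp => hb p.1 p.2 hp.1.1 hp.1.2

lemma wf_int_bdd (W : WFKilled s σ r μ₀) (C : ℝ) (F : W.Ω → ℝ) (hF : Measurable F)
    (hb : ∀ ω, |F ω| ≤ C) : Integrable F W.P :=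
  Integrable.of_bound hF.aestronglyMeasurable C (Eventually.of_forall hb)

lemma LWF_cont (s σ : ℝ) {f : ℝ → ℝ} (hf : ContDiff ℝ 2 f) : Continuous (LWF s σ f) := by
  have h1 : Continuous (deriv f) := hf.continuous_deriv (by norm_num)
  have h2 : Continuous (deriv (deriv f)) := by
    have := hf.continuous_iteratedDeriv 2 (by norm_num)
    simpa [iteratedDeriv_succ, iteratedDeriv_zero] using this
  unfold LWF
  fun_prop

lemma wf_bdd {f : ℝ → ℝ} (hf : Continuous f) : ∃ C, 0 ≤ C ∧ ∀ x ∈ Icc (0:ℝ) 1, |f x| ≤ C := by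
  obtain ⟨C, hC⟩ := isCompact_Icc.exists_bound_of_continuousOn (s := Icc (0:ℝ) 1) hf.continuousOn
  exact ⟨C, (norm_nonneg _).trans (hC 0 (by simp)), hC⟩

lemma wf_mart_mul {Ω : Type*} {m0 : MeasurableSpace Ω} {P : Measure Ω} [IsProbabilityMeasure P]
    {ℱ : Filtration ℝ m0} {M : ℝ → Ω → ℝ} (hM : Martingale M ℱ P) {t T : ℝ} (htT : t ≤ T)
    {N : Ω → ℝ} (hN : Measurable[ℱ t] N) (C : ℝ) (hb : ∀ ω, |N ω| ≤ C) :
    ∫ ω, N ω * M T ω ∂P = ∫ ω, N ω * M t ω ∂P := by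
  have h1 := condExp_stronglyMeasurable_mul_of_bound (μ := P) (ℱ.le t) (f := N) (g := M T)
    hN.stronglyMeasurable (hM.integrable T) C (Eventually.of_forall hb)
  have h2 := integral_condExp (μ := P) (ℱ.le t) (f := N * M T)
  calc ∫ ω, N ω * M T ω ∂P = ∫ ω, (N * M T) ω ∂P := rfl
    _ = ∫ ω, (P[N * M T | ℱ t]) ω ∂P := h2.symm
    _ = ∫ ω, N ω * M t ω ∂P := by
      apply integral_congr_ae
      filter_upwards [h1, hM.2 t T htT] with ω h3 h4
      rw [h3]; simp [h4]

theorem wf_ito (W : WFKilled s σ r μ₀) {k : ℝ → ℝ} {M : ℝ} (hk : Measurable k)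
    (hM : ∀ x ∈ Icc (0:ℝ) 1, |k x| ≤ M) {f : ℝ → ℝ} (hf : ContDiff ℝ 2 f) {T : ℝ} (hT : 0 ≤ T) :
    ∫ ω, wfV W k T ω * f (W.X T ω) ∂W.P - ∫ ω, f (W.X 0 ω) ∂W.P
      = ∫ t in Ioc 0 T, ∫ ω, wfV W k t ω * (LWF s σ f (W.X t ω) + k (W.X t ω) * f (W.X t ω)) ∂W.P := by
  have hM0 : 0 ≤ M := (abs_nonneg _).trans (hM 0 (by simp))
  obtain ⟨Cf, hCf0, hCf⟩ := wf_bdd hf.continuous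
  have hLc := LWF_cont s σ hf
  obtain ⟨Cl, hCl0, hCl⟩ := wf_bdd hLc
  have hMart := W.martProblem f hf
  set E := Real.exp (M * T) with hE
  have hE0 : 0 < E := Real.exp_pos _
  have hXm := wfX_unc W
  have hVm := wfV_unc W hk hM
  have hfm : Measurable f := hf.continuous.measurable
  have hLm := hLc.measurable
  set Mt : ℝ → W.Ω → ℝ := fun t ω => f (W.X t ω) - ∫ u in Ioc (0:ℝ) t, LWF s σ f (W.X u ω) with hMt
  have hJb : ∀ t ω, 0 ≤ t → |∫ u in Ioc (0:ℝ) t, LWF s σ f (W.X u ω)| ≤ Cl * t :=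
    fun t ω ht => wfV_bound W hLm hCl ht ω
  have hMtb : ∀ t ω, 0 ≤ t → t ≤ T → |Mt t ω| ≤ Cf + Cl * T := by
    intro t ω h0 h1
    refine (abs_sub _ _).trans (add_le_add (hCf _ (W.range01 _ _)) ((hJb t ω h0).trans ?_))
    exact mul_le_mul_of_nonneg_left h1 hCl0
  have hMtm : ∀ t, Measurable (Mt t) := fun t =>
    (hfm.comp (W.measX t)).sub (wfV_meas_gen W hLm t _ fun u _ => W.measX u)
  -- joint measurability of M
  have hMtc : ∀ ω, Continuous fun t => Mt (max t 0) ω := by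
    intro ω
    have e : (fun t => Mt (max t 0) ω) = fun t => f (W.X (max t 0) ω) -
        ∫ u in (0:ℝ)..(max t 0), LWF s σ f (W.X u ω) := by
      ext t; simp only [hMt]; rw [intervalIntegral.integral_of_le (le_max_right _ _)]
    rw [e]
    have c1 : Continuous fun t => LWF s σ f (W.X t ω) := hLc.comp (W.contX ω)
    have c2 : Continuous fun b => ∫ u in (0:ℝ)..b, LWF s σ f (W.X u ω) :=
      intervalIntegral.continuous_primitive (fun a b => c1.intervalIntegrable a b) 0
    have c3 : Continuous fun t : ℝ => max t 0 := continuous_id.max continuous_const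
    exact (hf.continuous.comp ((W.contX ω).comp c3)).sub (c2.comp c3)
  have hMtu : Measurable fun p : ℝ × W.Ω => Mt (max p.1 0) p.2 :=
    wf_meas_uncurry (fun t ω => Mt (max t 0) ω) (fun t => hMtm _) hMtc
  set N : ℝ → W.Ω → ℝ := fun t ω => wfV W k t ω * k (W.X t ω) with hN
  have hNu : Measurable fun p : ℝ × W.Ω => N p.1 p.2 := hVm.mul (hk.comp hXm)
  have hNb : ∀ t ω, 0 ≤ t → t ≤ T → |N t ω| ≤ E * M := by
    intro t ω h0 h1
    rw [hN, abs_mul]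
    exact mul_le_mul (wfV_le' W hk hM h0 h1 ω) (hM _ (W.range01 _ _)) (abs_nonneg _) hE0.le
  have key : ∀ t ∈ Ioc 0 T, ∫ ω, N t ω * Mt T ω ∂W.P = ∫ ω, N t ω * Mt (max t 0) ω ∂W.P := by
    intro t ht
    rw [max_eq_left ht.1.le]
    refine wf_mart_mul hMart ht.2 ?_ (E * M) (fun ω => hNb t ω ht.1.le ht.2)
    exact (wfV_adapted W hk t).mul (hk.comp (W.adaptedX t))
  have keyI : ∫ t in Ioc 0 T, ∫ ω, N t ω * Mt T ω ∂W.P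
      = ∫ t in Ioc 0 T, ∫ ω, N t ω * Mt (max t 0) ω ∂W.P :=
    setIntegral_congr_fun measurableSet_Ioc key
  have i1 : Integrable (fun p : ℝ × W.Ω => N p.1 p.2 * Mt T p.2)
      ((volume.restrict (Ioc 0 T)).prod W.P) := by
    refine wf_int_prod W T ((E * M) * (Cf + Cl * T)) _
      (hNu.mul ((hMtm T).comp measurable_snd)) ?_
    intro t ω h0 h1
    rw [abs_mul]
    exact mul_le_mul (hNb t ω h0.le h1) (hMtb T ω hT le_rfl) (abs_nonneg _) (by positivity)
  have i2 : Integrable (fun p : ℝ × W.Ω => N p.1 p.2 * Mt (max p.1 0) p.2)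
      ((volume.restrict (Ioc 0 T)).prod W.P) := by
    refine wf_int_prod W T ((E * M) * (Cf + Cl * T)) _ (hNu.mul hMtu) ?_
    intro t ω h0 h1
    rw [abs_mul]
    refine mul_le_mul (hNb t ω h0.le h1) (hMtb _ ω (le_max_right _ _) ?_) (abs_nonneg _)
      (by positivity)
    simp [h1, hT]
  have i3 : Integrable (fun p : ℝ × W.Ω => wfV W k p.1 p.2 *
      (LWF s σ f (W.X p.1 p.2) + k (W.X p.1 p.2) * f (W.X p.1 p.2)))
      ((volume.restrict (Ioc 0 T)).prod W.P) := by
    refine wf_int_prod W T (E * (Cl + M * Cf)) _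
      (hVm.mul ((hLm.comp hXm).add ((hk.comp hXm).mul (hfm.comp hXm)))) ?_
    intro t ω h0 h1
    rw [abs_mul]
    refine mul_le_mul (wfV_le' W hk hM h0.le h1 ω) ?_ (abs_nonneg _) hE0.le
    refine (abs_add_le _ _).trans (add_le_add (hCl _ (W.range01 _ _)) ?_)
    rw [abs_mul]
    exact mul_le_mul (hM _ (W.range01 _ _)) (hCf _ (W.range01 _ _)) (abs_nonneg _) hM0
  rw [integral_integral_swap (f := fun t ω => N t ω * Mt T ω) i1,
    integral_integral_swap (f := fun t ω => N t ω * Mt (max t 0) ω) i2] at keyI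
  rw [integral_integral_swap (f := fun t ω => wfV W k t ω *
      (LWF s σ f (W.X t ω) + k (W.X t ω) * f (W.X t ω))) i3]
  -- pathwise identity
  have path : ∀ ω, (∫ t in Ioc 0 T, N t ω * Mt (max t 0) ω) - (∫ t in Ioc 0 T, N t ω * Mt T ω)
      = (∫ t in Ioc 0 T, wfV W k t ω * (LWF s σ f (W.X t ω) + k (W.X t ω) * f (W.X t ω)))
        - wfV W k T ω * f (W.X T ω) + Mt T ω := by
    intro ω
    have hkp : Measurable fun t => k (W.X t ω) := hk.comp (W.contX ω).measurable
    have hkb : ∀ t, |k (W.X t ω)| ≤ M := fun t => hM _ (W.range01 t ω)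
    have cl : Continuous fun t => LWF s σ f (W.X t ω) := hLc.comp (W.contX ω)
    have cf : Continuous fun t => f (W.X t ω) := hf.continuous.comp (W.contX ω)
    have p1 := wf_path1 _ M T hkp hkb hT
    have p2 := wf_path2 _ M T hkp hkb hT _ cl
    have hVc : ContinuousOn (fun t => Real.exp (∫ u in (0:ℝ)..t, k (W.X u ω))) (uIcc 0 T) :=
      (wf_V_AC _ M T hkp hkb hT).continuousOn
    simp only [← intervalIntegral.integral_of_le hT]
    have e1 : ∫ t in (0:ℝ)..T, N t ω * Mt T ω = (wfV W k T ω - 1) * Mt T ω := by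
      rw [intervalIntegral.integral_mul_const, wfV_eq W k hT, ← p1]
      congr 1
      apply intervalIntegral.integral_congr
      intro t ht
      rw [uIcc_of_le hT] at ht
      simp only [hN, wfV_eq W k ht.1]
    set V := fun t => Real.exp (∫ u in (0:ℝ)..t, k (W.X u ω)) with hV
    have iVk : IntervalIntegrable (fun t => V t * k (W.X t ω)) volume 0 T :=
      (wf_ii _ M hkp hkb 0 T).continuousOn_mul hVc
    have iA : IntervalIntegrable (fun t => f (W.X t ω) * (V t * k (W.X t ω))) volume 0 T :=
      iVk.continuousOn_mul cf.continuousOn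
    have iB : IntervalIntegrable (fun t => (∫ u in (0:ℝ)..t, LWF s σ f (W.X u ω)) *
        (V t * k (W.X t ω))) volume 0 T :=
      iVk.continuousOn_mul (intervalIntegral.continuous_primitive
        (fun a b => cl.intervalIntegrable a b) 0).continuousOn
    have iC : IntervalIntegrable (fun t => LWF s σ f (W.X t ω) * V t) volume 0 T :=
      (cl.continuousOn.mul hVc).intervalIntegrable
    have e2 : ∫ t in (0:ℝ)..T, N t ω * Mt (max t 0) ω =
        (∫ t in (0:ℝ)..T, f (W.X t ω) * (V t * k (W.X t ω))) -
        ∫ t in (0:ℝ)..T, (∫ u in (0:ℝ)..t, LWF s σ f (W.X u ω)) * (V t * k (W.X t ω)) := by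
      rw [← intervalIntegral.integral_sub iA iB]
      apply intervalIntegral.integral_congr
      intro t ht
      rw [uIcc_of_le hT] at ht
      simp only [hN, wfV_eq W k ht.1, hMt, max_eq_left ht.1, ← intervalIntegral.integral_of_le ht.1,
        hV]
      ring
    have e3 : (∫ t in (0:ℝ)..T, wfV W k t ω *
          (LWF s σ f (W.X t ω) + k (W.X t ω) * f (W.X t ω)))
        = (∫ t in (0:ℝ)..T, LWF s σ f (W.X t ω) * V t) +
          ∫ t in (0:ℝ)..T, f (W.X t ω) * (V t * k (W.X t ω)) := by
      rw [← intervalIntegral.integral_add iC iA]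
      apply intervalIntegral.integral_congr
      intro t ht
      rw [uIcc_of_le hT] at ht
      simp only [wfV_eq W k ht.1, hV]
      ring
    rw [e1, e2, e3, p2, wfV_eq W k hT]
    simp only [hMt, ← intervalIntegral.integral_of_le hT, hV]
    ring
  have j1 : Integrable (fun ω => ∫ t in Ioc 0 T, N t ω * Mt (max t 0) ω) W.P := i2.integral_prod_right
  have j2 : Integrable (fun ω => ∫ t in Ioc 0 T, N t ω * Mt T ω) W.P := i1.integral_prod_right
  have j3 : Integrable (fun ω => ∫ t in Ioc 0 T, wfV W k t ω *
    (LWF s σ f (W.X t ω) + k (W.X t ω) * f (W.X t ω))) W.P := i3.integral_prod_right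
  have j4 : Integrable (fun ω => wfV W k T ω * f (W.X T ω)) W.P := by
    refine wf_int_bdd W (E * Cf) _ ((wfV_meas W hk T).mul (hfm.comp (W.measX T))) ?_
    intro ω
    rw [abs_mul]
    exact mul_le_mul (wfV_le W hk hM hT ω) (hCf _ (W.range01 _ _)) (abs_nonneg _) hE0.le
  have j5 : Integrable (Mt T) W.P := hMart.integrable T
  have j34 : Integrable (fun ω => (∫ t in Ioc 0 T, wfV W k t ω *
    (LWF s σ f (W.X t ω) + k (W.X t ω) * f (W.X t ω))) - wfV W k T ω * f (W.X T ω)) W.P :=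
    j3.sub j4
  have fin := integral_congr_ae (μ := W.P) (Eventually.of_forall path)
  rw [integral_sub j1 j2, integral_add j34 j5, integral_sub j3 j4, ← keyI, sub_self] at fin
  have m0 : ∫ ω, Mt T ω ∂W.P = ∫ ω, f (W.X 0 ω) ∂W.P := by
    have := wf_mart_mul hMart hT (N := fun _ => 1) measurable_const 1 (by simp)
    simp only [one_mul] at this
    rw [this]
    simp [hMt]
  rw [m0] at fin
  linarith

def wfc (s σ : ℝ) : ℝ := 2 * s / σ ^ 2
def wfS (s σ x : ℝ) : ℝ := ∫ z in (0:ℝ)..x, Real.exp (wfc s σ * z)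
def wfm (s σ y : ℝ) : ℝ := 2 / σ ^ 2 * Real.exp (-(wfc s σ * y))
def wfg (s σ x y : ℝ) : ℝ :=
  wfS s σ (min x y) * (wfS s σ 1 - wfS s σ (max x y)) / wfS s σ 1

section scale
variable (s σ)

lemma wfS_deriv (x : ℝ) : HasDerivAt (wfS s σ) (Real.exp (wfc s σ * x)) x := by
  have hc : Continuous fun z : ℝ => Real.exp (wfc s σ * z) := by fun_prop
  exact intervalIntegral.integral_hasDerivAt_right (hc.intervalIntegrable _ _)
    (hc.stronglyMeasurableAtFilter _ _) hc.continuousAt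

lemma wfS_zero : wfS s σ 0 = 0 := by simp [wfS]

lemma wfS_cont : Continuous (wfS s σ) :=
  continuous_iff_continuousAt.2 fun x => (wfS_deriv s σ x).continuousAt

lemma wfS_strictMono : StrictMono (wfS s σ) := by
  apply strictMono_of_deriv_pos
  intro x
  rw [(wfS_deriv s σ x).deriv]
  exact Real.exp_pos _

lemma wfS_one_pos : 0 < wfS s σ 1 := by
  have := wfS_strictMono s σ (zero_lt_one (α := ℝ))
  rwa [wfS_zero] at this

lemma wfc_nonneg (hs : 0 ≤ s) : 0 ≤ wfc s σ := by unfold wfc; positivity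

lemma wfS_sub (x y : ℝ) : wfS s σ y - wfS s σ x = ∫ z in x..y, Real.exp (wfc s σ * z) := by
  have hc : Continuous fun z : ℝ => Real.exp (wfc s σ * z) := by fun_prop
  rw [wfS, wfS, intervalIntegral.integral_interval_sub_left (hc.intervalIntegrable _ _)
    (hc.intervalIntegrable _ _)]

lemma wfS_lower (hs : 0 ≤ s) {x y : ℝ} (hx : 0 ≤ x) (hxy : x ≤ y) :
    y - x ≤ wfS s σ y - wfS s σ x := by
  have hc : Continuous fun z : ℝ => Real.exp (wfc s σ * z) := by fun_prop
  rw [wfS_sub]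
  have := intervalIntegral.integral_mono_on (f := fun _ => (1:ℝ)) (μ := volume) hxy
    intervalIntegrable_const (hc.intervalIntegrable _ _) (fun z hz => by
      have : 0 ≤ wfc s σ * z := mul_nonneg (wfc_nonneg s σ hs) (hx.trans hz.1)
      exact Real.one_le_exp this)
  simpa using this

lemma wfS_upper (hs : 0 ≤ s) {x y : ℝ} (hxy : x ≤ y) (hy : y ≤ 1) :
    wfS s σ y - wfS s σ x ≤ Real.exp (wfc s σ) * (y - x) := by
  have hc : Continuous fun z : ℝ => Real.exp (wfc s σ * z) := by fun_prop
  rw [wfS_sub]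
  have := intervalIntegral.integral_mono_on (g := fun _ => Real.exp (wfc s σ)) (μ := volume) hxy
    (hc.intervalIntegrable _ _) intervalIntegrable_const (fun z hz => by
      refine Real.exp_le_exp.2 ?_
      have := mul_le_mul_of_nonneg_left (hz.2.trans hy) (wfc_nonneg s σ hs)
      simpa using this)
  refine this.trans (le_of_eq ?_)
  simp [mul_comm]

lemma wfS_one_ge (hs : 0 ≤ s) : 1 ≤ wfS s σ 1 := by
  have := wfS_lower s σ hs le_rfl (zero_le_one (α := ℝ))
  rw [wfS_zero] at this; linarith

lemma wfg_cont : Continuous (fun p : ℝ × ℝ => wfg s σ p.1 p.2) := by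
  unfold wfg
  have := wfS_cont s σ
  refine Continuous.div_const (Continuous.mul (this.comp (continuous_fst.min continuous_snd)) ?_) _
  exact continuous_const.sub (this.comp (continuous_fst.max continuous_snd))

lemma wfg_symm (x y : ℝ) : wfg s σ x y = wfg s σ y x := by
  unfold wfg; rw [min_comm, max_comm]

lemma wfg_nonneg {x y : ℝ} (hx : x ∈ Icc (0:ℝ) 1) (hy : y ∈ Icc (0:ℝ) 1) : 0 ≤ wfg s σ x y := by
  unfold wfg
  have hm := (wfS_strictMono s σ).monotone
  have h1 : 0 ≤ wfS s σ (min x y) := by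
    rw [← wfS_zero s σ]; exact hm (le_min hx.1 hy.1)
  have h2 : wfS s σ (max x y) ≤ wfS s σ 1 := hm (max_le hx.2 hy.2)
  exact div_nonneg (mul_nonneg h1 (by linarith)) (wfS_one_pos s σ).le

lemma wfg_le (hs : 0 ≤ s) {x y : ℝ} (hx : x ∈ Icc (0:ℝ) 1) (hy : y ∈ Icc (0:ℝ) 1) :
    wfg s σ x y ≤ Real.exp (wfc s σ) ^ 2 * (y * (1 - y)) := by
  unfold wfg
  have hm := (wfS_strictMono s σ).monotone
  have h1 : 0 ≤ wfS s σ (min x y) := by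
    rw [← wfS_zero s σ]; exact hm (le_min hx.1 hy.1)
  have h2 : wfS s σ (max x y) ≤ wfS s σ 1 := hm (max_le hx.2 hy.2)
  have h3 : wfS s σ (min x y) ≤ Real.exp (wfc s σ) * y := by
    have := wfS_upper s σ hs hy.1 hy.2
    rw [wfS_zero] at this
    linarith [hm (min_le_right x y)]
  have h4 : wfS s σ 1 - wfS s σ (max x y) ≤ Real.exp (wfc s σ) * (1 - y) := by
    have := wfS_upper s σ hs hy.2 le_rfl
    linarith [hm (le_max_right x y)]
  have h5 := mul_le_mul h3 h4 (by linarith) (mul_nonneg (Real.exp_pos _).le hy.1)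
  refine (div_le_self (mul_nonneg h1 (by linarith)) (wfS_one_ge s σ hs)).trans (h5.trans ?_)
  exact le_of_eq (by ring)

lemma wfm_cont : Continuous (wfm s σ) := by unfold wfm; fun_prop

lemma wfm_pos (hσ : 0 < σ) (y : ℝ) : 0 < wfm s σ y := by
  unfold wfm; have := Real.exp_pos (-(wfc s σ * y)); positivity

lemma wfm_le (hs : 0 ≤ s) {y : ℝ} (hy : 0 ≤ y) : wfm s σ y ≤ 2 / σ ^ 2 := by
  unfold wfm
  have : Real.exp (-(wfc s σ * y)) ≤ 1 := Real.exp_le_one_iff.2 (by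
    have := mul_nonneg (wfc_nonneg s σ hs) hy; linarith)
  exact mul_le_of_le_one_right (by positivity) this

lemma wfg_zero {y : ℝ} (hy : y ∈ Icc (0:ℝ) 1) : wfg s σ 0 y = 0 := by
  unfold wfg; rw [min_eq_left hy.1, wfS_zero]; simp

lemma wfg_one {y : ℝ} (hy : y ∈ Icc (0:ℝ) 1) : wfg s σ 1 y = 0 := by
  unfold wfg; rw [max_eq_left hy.2]; simp

lemma wf_contDiff2 {f f' f'' : ℝ → ℝ} (h1 : ∀ x, HasDerivAt f (f' x) x)
    (h2 : ∀ x, HasDerivAt f' (f'' x) x) (hc : Continuous f'') : ContDiff ℝ 2 f := by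
  have e1 : deriv f = f' := funext fun x => (h1 x).deriv
  have e2 : deriv f' = f'' := funext fun x => (h2 x).deriv
  rw [show (2 : WithTop ℕ∞) = 1 + 1 by norm_num, contDiff_succ_iff_deriv]
  refine ⟨fun x => (h1 x).differentiableAt, by simp, ?_⟩
  rw [e1, contDiff_one_iff_deriv]
  exact ⟨fun x => (h2 x).differentiableAt, by rw [e2]; exact hc⟩

lemma wf_LWF_of {f f' f'' : ℝ → ℝ} (h1 : ∀ x, HasDerivAt f (f' x) x)
    (h2 : ∀ x, HasDerivAt f' (f'' x) x) (x : ℝ) :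
    LWF s σ f x = -s * x * (1 - x) * f' x + σ ^ 2 / 2 * (x * (1 - x)) * f'' x := by
  have e1 : deriv f = f' := funext fun x => (h1 x).deriv
  have e2 : deriv f' = f'' := funext fun x => (h2 x).deriv
  rw [LWF, e1, e2]

lemma wf_green (hσ : 0 < σ) (v : ℝ → ℝ) (hv : Continuous v) :
    ∃ f : ℝ → ℝ, ContDiff ℝ 2 f ∧ (∀ x, LWF s σ f x = -(x * (1 - x) * v x)) ∧
      ∀ x ∈ Icc (0:ℝ) 1, f x = ∫ y in Ioc (0:ℝ) 1, wfg s σ x y * wfm s σ y * v y := by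
  set S := wfS s σ with hS
  set m := wfm s σ with hm
  set c := wfc s σ with hc
  have cS : Continuous S := wfS_cont s σ
  have cm : Continuous m := wfm_cont s σ
  have S1 : S 1 ≠ 0 := (wfS_one_pos s σ).ne'
  set F : ℝ → ℝ := fun x => ∫ y in (0:ℝ)..x, m y * v y with hF
  set H : ℝ → ℝ := fun x => ∫ y in (0:ℝ)..x, S y * (m y * v y) with hH
  have cF : Continuous fun y => m y * v y := by fun_prop
  have cH : Continuous fun y => S y * (m y * v y) := by fun_prop
  have dF : ∀ x, HasDerivAt F (m x * v x) x := fun x =>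
    intervalIntegral.integral_hasDerivAt_right (cF.intervalIntegrable _ _)
      (cF.stronglyMeasurableAtFilter _ _) cF.continuousAt
  have dH : ∀ x, HasDerivAt H (S x * (m x * v x)) x := fun x =>
    intervalIntegral.integral_hasDerivAt_right (cH.intervalIntegrable _ _)
      (cH.stronglyMeasurableAtFilter _ _) cH.continuousAt
  have dS : ∀ x, HasDerivAt S (Real.exp (c * x)) x := wfS_deriv s σ
  have dE : ∀ x, HasDerivAt (fun x => Real.exp (c * x)) (c * Real.exp (c * x)) x := by
    intro x
    have := ((hasDerivAt_id x).const_mul c).exp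
    simpa [mul_comm] using this
  set A : ℝ := F 1 - H 1 / S 1 with hA
  set f : ℝ → ℝ := fun x => A * S x - S x * F x + H x with hf
  set f' : ℝ → ℝ := fun x => Real.exp (c * x) * (A - F x) with hf'
  set f'' : ℝ → ℝ := fun x => c * Real.exp (c * x) * (A - F x) - Real.exp (c * x) * (m x * v x)
    with hf''
  have d1 : ∀ x, HasDerivAt f (f' x) x := by
    intro x
    have := (((dS x).const_mul A).sub ((dS x).mul (dF x))).add (dH x)
    convert! this using 1
    simp only [hf']; ring
  have d2 : ∀ x, HasDerivAt f' (f'' x) x := by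
    intro x
    have := (dE x).mul ((dF x).const_sub A)
    convert! this using 1
    simp only [hf'']; ring
  have contF : Continuous F := continuous_iff_continuousAt.2 fun x => (dF x).continuousAt
  refine ⟨f, wf_contDiff2 d1 d2 (by simp only [hf'']; fun_prop), ?_, ?_⟩
  · intro x
    rw [wf_LWF_of s σ d1 d2]
    simp only [hf', hf'', hm, wfm, ← hc, Real.exp_neg]
    have := (Real.exp_pos (c * x)).ne'
    have hcs : s = σ ^ 2 / 2 * c := by rw [hc, wfc]; field_simp
    have hσ' := hσ.ne'
    rw [hcs]
    field_simp
    ring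
  · intro x hx
    have ig : ∀ a b, IntervalIntegrable (fun y => wfg s σ x y * m y * v y) volume a b := by
      intro a b
      have : Continuous fun y => wfg s σ x y := (wfg_cont s σ).comp (Continuous.prodMk_right x)
      exact Continuous.intervalIntegrable (by fun_prop) _ _
    rw [← intervalIntegral.integral_of_le zero_le_one,
      ← intervalIntegral.integral_add_adjacent_intervals (ig 0 x) (ig x 1)]
    have e1 : ∫ y in (0:ℝ)..x, wfg s σ x y * m y * v y = (S 1 - S x) / S 1 * H x := by
      rw [hH]
      simp only
      rw [← intervalIntegral.integral_const_mul]
      apply intervalIntegral.integral_congr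
      intro y hy
      rw [uIcc_of_le hx.1] at hy
      simp only [wfg, min_eq_right hy.2, max_eq_left hy.2]
      ring
    have e2 : ∫ y in x..1, wfg s σ x y * m y * v y =
        S x * (F 1 - F x) - S x / S 1 * (H 1 - H x) := by
      rw [hH, hF]
      simp only
      rw [intervalIntegral.integral_interval_sub_left (cF.intervalIntegrable _ _)
        (cF.intervalIntegrable _ _), intervalIntegral.integral_interval_sub_left
        (cH.intervalIntegrable _ _) (cH.intervalIntegrable _ _),
        ← intervalIntegral.integral_const_mul, ← intervalIntegral.integral_const_mul,
        ← intervalIntegral.integral_sub (Continuous.intervalIntegrable (by fun_prop) _ _)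
        (Continuous.intervalIntegrable (by fun_prop) _ _)]
      apply intervalIntegral.integral_congr
      intro y hy
      rw [uIcc_of_le hx.2] at hy
      simp only [wfg, min_eq_left hy.1, max_eq_right hy.1, ← hS]
      field_simp
    rw [e1, e2]
    simp only [hf, hA]
    field_simp
    ring

def wfh (x : ℝ) : ℝ := wfS s σ x / wfS s σ 1

lemma wfh_spec (hσ : 0 < σ) : ContDiff ℝ 2 (wfh s σ) ∧ ∀ x, LWF s σ (wfh s σ) x = 0 := by
  have d1 : ∀ x, HasDerivAt (wfh s σ) (Real.exp (wfc s σ * x) / wfS s σ 1) x :=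
    fun x => (wfS_deriv s σ x).div_const _
  have d2 : ∀ x, HasDerivAt (fun x => Real.exp (wfc s σ * x) / wfS s σ 1)
      (wfc s σ * Real.exp (wfc s σ * x) / wfS s σ 1) x := by
    intro x
    have := ((hasDerivAt_id x).const_mul (wfc s σ)).exp.div_const (wfS s σ 1)
    simpa [mul_comm] using this
  refine ⟨wf_contDiff2 d1 d2 (by fun_prop), fun x => ?_⟩
  rw [wf_LWF_of s σ d1 d2]
  have hcs : s = σ ^ 2 / 2 * wfc s σ := by rw [wfc]; field_simp
  nth_rewrite 1 [hcs]
  ring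

lemma wfh_zero : wfh s σ 0 = 0 := by simp [wfh, wfS_zero]
lemma wfh_one : wfh s σ 1 = 1 := div_self (wfS_one_pos s σ).ne'
lemma wfh_strictMono : StrictMono (wfh s σ) := fun _ _ h =>
  div_lt_div_of_pos_right (wfS_strictMono s σ h) (wfS_one_pos s σ)
lemma wfh_mem {x : ℝ} (hx : x ∈ Icc (0:ℝ) 1) : wfh s σ x ∈ Icc (0:ℝ) 1 := by
  have := (wfh_strictMono s σ).monotone
  constructor
  · rw [← wfh_zero s σ]; exact this hx.1
  · rw [← wfh_one s σ]; exact this hx.2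
end scale

lemma wf_wd_int {μ : Measure ℝ} {d : ℝ → ℝ} (hd : Measurable d) (h0 : ∀ᵐ x ∂μ, 0 ≤ d x)
    (q : ℝ → ℝ) :
    ∫ x, q x ∂(μ.withDensity fun x => ENNReal.ofReal (d x)) = ∫ x, d x * q x ∂μ := by
  rw [integral_withDensity_eq_integral_toReal_smul (by fun_prop)
    (Eventually.of_forall fun x => ENNReal.ofReal_lt_top)]
  apply integral_congr_ae
  filter_upwards [h0] with x hx
  simp [ENNReal.toReal_ofReal hx]

lemma wf_wd_integrable {μ : Measure ℝ} {d : ℝ → ℝ} (hd : Measurable d) (h0 : ∀ᵐ x ∂μ, 0 ≤ d x)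
    (q : ℝ → ℝ) :
    Integrable q (μ.withDensity fun x => ENNReal.ofReal (d x)) ↔
      Integrable (fun x => d x * q x) μ := by
  rw [integrable_withDensity_iff_integrable_smul' (by fun_prop)
    (Eventually.of_forall fun x => ENNReal.ofReal_lt_top)]
  apply integrable_congr
  filter_upwards [h0] with x hx
  simp [ENNReal.toReal_ofReal hx]

def wfGq (s σ : ℝ) (q : ℝ → ℝ) (x : ℝ) : ℝ :=
  ∫ y in Ioc (0:ℝ) 1, wfg s σ x y * wfm s σ y * q y

def wfPi (s σ : ℝ) (κ : Measure ℝ) (y : ℝ) : ℝ := ∫ x, wfg s σ x y ∂κ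

section ext
variable (s σ)

lemma wf_ae_mem {κ : Measure ℝ} (hκ : κ.restrict (Icc 0 1) = κ) : ∀ᵐ x ∂κ, x ∈ Icc (0:ℝ) 1 := by
  rw [← hκ]; exact ae_restrict_mem measurableSet_Icc

lemma wf_g_bd (hs : 0 ≤ s) {x y : ℝ} (hx : x ∈ Icc (0:ℝ) 1) (hy : y ∈ Icc (0:ℝ) 1) :
    |wfg s σ x y| ≤ Real.exp (wfc s σ) ^ 2 := by
  rw [abs_of_nonneg (wfg_nonneg s σ hx hy)]
  refine (wfg_le s σ hs hx hy).trans (mul_le_of_le_one_right (by positivity) ?_)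
  nlinarith [hy.1, hy.2]

lemma wf_gm_bd (hs : 0 ≤ s) (hσ : 0 < σ) {x y : ℝ} (hx : x ∈ Icc (0:ℝ) 1) (hy : y ∈ Icc (0:ℝ) 1) :
    |wfg s σ x y * wfm s σ y| ≤ Real.exp (wfc s σ) ^ 2 * (2 / σ ^ 2) := by
  rw [abs_mul, abs_of_pos (wfm_pos s σ hσ y)]
  exact mul_le_mul (wf_g_bd s σ hs hx hy) (wfm_le s σ hs hy.1) (wfm_pos s σ hσ y).le (by positivity)

lemma wf_g_int (hs : 0 ≤ s) {κ : Measure ℝ} [IsFiniteMeasure κ] (hκ : κ.restrict (Icc 0 1) = κ)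
    {y : ℝ} (hy : y ∈ Icc (0:ℝ) 1) : Integrable (fun x => wfg s σ x y) κ := by
  have hc : Continuous fun x => wfg s σ x y := (wfg_cont s σ).comp (Continuous.prodMk_left y)
  refine Integrable.of_bound hc.aestronglyMeasurable (Real.exp (wfc s σ) ^ 2) ?_
  filter_upwards [wf_ae_mem hκ] with x hx using wf_g_bd s σ hs hx hy

lemma wf_fub_int (hs : 0 ≤ s) (hσ : 0 < σ) {κ : Measure ℝ} [IsFiniteMeasure κ]
    (hκ : κ.restrict (Icc 0 1) = κ) {q : ℝ → ℝ} (hqm : Measurable q)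
    (hq : IntegrableOn (fun y => y * (1 - y) * q y) (Ioc 0 1)) :
    Integrable (fun p : ℝ × ℝ => wfg s σ p.2 p.1 * wfm s σ p.1 * q p.1)
      ((volume.restrict (Ioc 0 1)).prod κ) := by
  have h1 : Integrable (fun p : ℝ × ℝ => p.1 * (1 - p.1) * q p.1)
      ((volume.restrict (Ioc 0 1)).prod κ) :=
    Integrable.comp_fst hq κ
  refine Integrable.mono' (h1.norm.const_mul (Real.exp (wfc s σ) ^ 2 * (2 / σ ^ 2))) ?_ ?_
  · refine Measurable.aestronglyMeasurable (Measurable.mul (Continuous.measurable ?_)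
      (hqm.comp measurable_fst))
    exact ((wfg_cont s σ).comp continuous_swap).mul ((wfm_cont s σ).comp continuous_fst)
  · rw [← hκ, Measure.prod_restrict]
    refine (ae_restrict_iff' (measurableSet_Ioc.prod measurableSet_Icc)).2 ?_
    refine Eventually.of_forall fun p hp => ?_
    have hy : p.1 ∈ Icc (0:ℝ) 1 := ⟨hp.1.1.le, hp.1.2⟩
    have hy1 : 0 ≤ 1 - p.1 := by linarith [hy.2]
    have g0 := wfg_nonneg s σ hp.2 hy
    have g1 := wfg_le s σ hs hp.2 hy
    have m0 := (wfm_pos s σ hσ p.1).le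
    have m1 := wfm_le s σ hs hy.1
    simp only [norm_mul, Real.norm_eq_abs, abs_of_nonneg g0, abs_of_nonneg m0,
      abs_of_nonneg hy.1, abs_of_nonneg hy1]
    have : wfg s σ p.2 p.1 * wfm s σ p.1 ≤
      Real.exp (wfc s σ) ^ 2 * (p.1 * (1 - p.1)) * (2 / σ ^ 2) :=
      mul_le_mul g1 m1 m0 (mul_nonneg (by positivity) (mul_nonneg hy.1 hy1))
    calc _ ≤ Real.exp (wfc s σ) ^ 2 * (p.1 * (1 - p.1)) * (2 / σ ^ 2) * |q p.1| :=
          mul_le_mul_of_nonneg_right this (abs_nonneg _)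
      _ = _ := by ring

lemma wf_fub (hs : 0 ≤ s) (hσ : 0 < σ) {κ : Measure ℝ} [IsFiniteMeasure κ]
    (hκ : κ.restrict (Icc 0 1) = κ) {q : ℝ → ℝ} (hqm : Measurable q)
    (hq : IntegrableOn (fun y => y * (1 - y) * q y) (Ioc 0 1)) :
    ∫ y in Ioc (0:ℝ) 1, (wfm s σ y * wfPi s σ κ y) * q y = ∫ x, wfGq s σ q x ∂κ := by
  have := integral_integral_swap (f := fun y x => wfg s σ x y * wfm s σ y * q y)
    (wf_fub_int s σ hs hσ hκ hqm hq)
  unfold wfGq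
  rw [← this]
  congr 1
  ext y
  simp only [mul_assoc]
  rw [integral_mul_const, wfPi]
  ring

lemma wfPi_meas (κ : Measure ℝ) [IsFiniteMeasure κ] : Measurable (wfPi s σ κ) := by
  unfold wfPi
  exact (StronglyMeasurable.integral_prod_left (μ := κ) (f := fun x y => wfg s σ x y)
    (wfg_cont s σ).stronglyMeasurable).measurable

lemma wfPi_nonneg {κ : Measure ℝ} (hκ : κ.restrict (Icc 0 1) = κ) {y : ℝ}
    (hy : y ∈ Icc (0:ℝ) 1) : 0 ≤ wfPi s σ κ y := by
  apply integral_nonneg_of_ae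
  filter_upwards [wf_ae_mem hκ] with x hx using wfg_nonneg s σ hx hy

lemma wfPi_le (hs : 0 ≤ s) {κ : Measure ℝ} [IsFiniteMeasure κ] (hκ : κ.restrict (Icc 0 1) = κ)
    {y : ℝ} (hy : y ∈ Icc (0:ℝ) 1) :
    wfPi s σ κ y ≤ (Real.exp (wfc s σ) ^ 2 * κ.real univ) * (y * (1 - y)) := by
  have := integral_mono_ae (wf_g_int s σ hs hκ hy)
    (integrable_const (Real.exp (wfc s σ) ^ 2 * (y * (1 - y)))) (by
      filter_upwards [wf_ae_mem hκ] with x hx using wfg_le s σ hs hx hy)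
  refine this.trans (le_of_eq ?_)
  simp; ring

lemma wf_mPi_int (hs : 0 ≤ s) (hσ : 0 < σ) {κ : Measure ℝ} [IsFiniteMeasure κ]
    (hκ : κ.restrict (Icc 0 1) = κ) {q : ℝ → ℝ} (hqm : Measurable q)
    (hq : IntegrableOn (fun y => y * (1 - y) * q y) (Ioc 0 1)) :
    IntegrableOn (fun y => (wfm s σ y * wfPi s σ κ y) * q y) (Ioc 0 1) := by
  have := (wf_fub_int s σ hs hσ hκ hqm hq).integral_prod_left
  refine this.congr (Eventually.of_forall fun y => ?_)
  simp only [mul_assoc]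
  rw [integral_mul_const, wfPi]
  ring

variable {ν κ₁ κ₂ : Measure ℝ} [IsFiniteMeasure ν] [IsFiniteMeasure κ₁] [IsFiniteMeasure κ₂]

lemma wf_dens (hs : 0 ≤ s) (hσ : 0 < σ) (hν : ν.restrict (Icc 0 1) = ν)
    (h₁ : κ₁.restrict (Icc 0 1) = κ₁) (h₂ : κ₂.restrict (Icc 0 1) = κ₂)
    (H : ∀ v : ℝ → ℝ, Continuous v → ∫ x, x * (1 - x) * v x ∂ν
      = ∫ x, wfGq s σ v x ∂κ₁ - ∫ x, wfGq s σ v x ∂κ₂) :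
    (ν.withDensity fun x => ENNReal.ofReal (x * (1 - x)))
      + (volume.restrict (Ioc 0 1)).withDensity
          (fun y => ENNReal.ofReal (wfm s σ y * wfPi s σ κ₂ y))
      = (volume.restrict (Ioc 0 1)).withDensity
          (fun y => ENNReal.ofReal (wfm s σ y * wfPi s σ κ₁ y)) := by
  have hw : Measurable fun x : ℝ => x * (1 - x) := by fun_prop
  have hw0 : ∀ᵐ x ∂ν, 0 ≤ x * (1 - x) := by
    filter_upwards [wf_ae_mem hν] with x hx
    exact mul_nonneg hx.1 (by linarith [hx.2])
  have hd : ∀ (κ : Measure ℝ) [IsFiniteMeasure κ], Measurable fun y => wfm s σ y * wfPi s σ κ y :=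
    fun κ _ => (wfm_cont s σ).measurable.mul (wfPi_meas s σ κ)
  have hd0 : ∀ (κ : Measure ℝ), κ.restrict (Icc 0 1) = κ →
      ∀ᵐ y ∂(volume.restrict (Ioc (0:ℝ) 1)), 0 ≤ wfm s σ y * wfPi s σ κ y := by
    intro κ hκ
    filter_upwards [ae_restrict_mem measurableSet_Ioc] with y hy
    exact mul_nonneg (wfm_pos s σ hσ y).le (wfPi_nonneg s σ hκ ⟨hy.1.le, hy.2⟩)
  have hwi : Integrable (fun x : ℝ => x * (1 - x)) ν := by
    refine Integrable.of_bound hw.aestronglyMeasurable 1 ?_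
    filter_upwards [wf_ae_mem hν] with x hx
    rw [Real.norm_eq_abs, abs_le]
    constructor <;> nlinarith [hx.1, hx.2]
  have h1i : IntegrableOn (fun y : ℝ => y * (1 - y) * (1:ℝ)) (Ioc (0:ℝ) 1) :=
    (Continuous.integrableOn_Icc (a := (0:ℝ)) (b := 1) (by fun_prop)).mono_set Ioc_subset_Icc_self
  have : IsFiniteMeasure (ν.withDensity fun x => ENNReal.ofReal (x * (1 - x))) :=
    isFiniteMeasure_withDensity_ofReal hwi.2
  have : IsFiniteMeasure ((volume.restrict (Ioc (0:ℝ) 1)).withDensity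
          (fun y => ENNReal.ofReal (wfm s σ y * wfPi s σ κ₂ y))) :=
    isFiniteMeasure_withDensity_ofReal (by simpa using (wf_mPi_int s σ hs hσ h₂ measurable_const h1i).2)
  have : IsFiniteMeasure ((volume.restrict (Ioc (0:ℝ) 1)).withDensity
          (fun y => ENNReal.ofReal (wfm s σ y * wfPi s σ κ₁ y))) :=
    isFiniteMeasure_withDensity_ofReal (by simpa using (wf_mPi_int s σ hs hσ h₁ measurable_const h1i).2)
  apply ext_of_forall_integral_eq_of_IsFiniteMeasure
  intro f
  have hfi : IntegrableOn (fun y => y * (1 - y) * f y) (Ioc (0:ℝ) 1) :=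
    (Continuous.integrableOn_Icc (by fun_prop) (a := (0:ℝ)) (b := 1)).mono_set Ioc_subset_Icc_self
  rw [integral_add_measure (f.integrable _) (f.integrable _), wf_wd_int hw hw0,
    wf_wd_int (hd κ₂) (hd0 κ₂ h₂), wf_wd_int (hd κ₁) (hd0 κ₁ h₁), H f f.continuous,
    wf_fub s σ hs hσ h₁ f.continuous.measurable hfi, wf_fub s σ hs hσ h₂ f.continuous.measurable hfi]
  ring

lemma wf_ext (hs : 0 ≤ s) (hσ : 0 < σ) (hν : ν.restrict (Icc 0 1) = ν)
    (h₁ : κ₁.restrict (Icc 0 1) = κ₁) (h₂ : κ₂.restrict (Icc 0 1) = κ₂)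
    (H : ∀ v : ℝ → ℝ, Continuous v → ∫ x, x * (1 - x) * v x ∂ν
      = ∫ x, wfGq s σ v x ∂κ₁ - ∫ x, wfGq s σ v x ∂κ₂)
    {q : ℝ → ℝ} (hqm : Measurable q)
    (hq : IntegrableOn (fun y => y * (1 - y) * q y) (Ioc 0 1)) :
    Integrable (fun x => x * (1 - x) * q x) ν ∧
    ∫ x, x * (1 - x) * q x ∂ν = ∫ x, wfGq s σ q x ∂κ₁ - ∫ x, wfGq s σ q x ∂κ₂ := by
  have hw : Measurable fun x : ℝ => x * (1 - x) := by fun_prop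
  have hw0 : ∀ᵐ x ∂ν, 0 ≤ x * (1 - x) := by
    filter_upwards [wf_ae_mem hν] with x hx
    exact mul_nonneg hx.1 (by linarith [hx.2])
  have hd : ∀ (κ : Measure ℝ) [IsFiniteMeasure κ], Measurable fun y => wfm s σ y * wfPi s σ κ y :=
    fun κ _ => (wfm_cont s σ).measurable.mul (wfPi_meas s σ κ)
  have hd0 : ∀ (κ : Measure ℝ), κ.restrict (Icc 0 1) = κ →
      ∀ᵐ y ∂(volume.restrict (Ioc (0:ℝ) 1)), 0 ≤ wfm s σ y * wfPi s σ κ y := by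
    intro κ hκ
    filter_upwards [ae_restrict_mem measurableSet_Ioc] with y hy
    exact mul_nonneg (wfm_pos s σ hσ y).le (wfPi_nonneg s σ hκ ⟨hy.1.le, hy.2⟩)
  have D := wf_dens s σ hs hσ hν h₁ h₂ H
  have i1 := (wf_wd_integrable (hd κ₁) (hd0 κ₁ h₁) q).2 (wf_mPi_int s σ hs hσ h₁ hqm hq)
  have i2 := i1
  rw [← D, integrable_add_measure] at i2
  have e := congrArg (fun μ => ∫ x, q x ∂μ) D
  beta_reduce at e
  rw [integral_add_measure i2.1 i2.2, wf_wd_int hw hw0, wf_wd_int (hd κ₂) (hd0 κ₂ h₂),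
    wf_wd_int (hd κ₁) (hd0 κ₁ h₁), wf_fub s σ hs hσ h₁ hqm hq, wf_fub s σ hs hσ h₂ hqm hq] at e
  exact ⟨(wf_wd_integrable hw hw0 q).1 i2.1, by linarith⟩
end ext

lemma wf_kill_indep (W : WFKilled s σ r μ₀) (hr : Measurable r) (t : ℝ) :
    IndepFun (fun ω => ((∫ u in Ioc (0:ℝ) t, -r (W.X u ω), W.X t ω) : ℝ × ℝ)) W.Tkill W.P := by
  have hX : ∀ u, Measurable[MeasurableSpace.comap (fun ω t => W.X t ω) inferInstance] (W.X u) := by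
    intro u
    have h : Measurable[MeasurableSpace.comap (fun ω t => W.X t ω) inferInstance]
      (fun ω t => W.X t ω) := comap_measurable _
    exact (measurable_pi_apply u).comp h
  have hIm := wfV_meas_gen W (k := fun x => -r x) hr.neg t
    (MeasurableSpace.comap (fun ω t => W.X t ω) inferInstance) fun u _ => hX u
  have h := W.indepT
  rw [IndepFun_iff_Indep] at h ⊢
  exact indep_of_indep_of_le_left h (measurable_iff_comap_le.1 (hIm.prodMk (hX t)))

lemma wf_kill (W : WFKilled s σ r μ₀) (hr : Measurable r)
    (hneg : ∀ x ∈ Icc (0:ℝ) 1, r x ≤ 0) (t : ℝ) {A : Set ℝ} (hA : MeasurableSet A) :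
    W.P ({ω | W.X t ω ∈ A} ∩ W.aliveSoft t)
      = ∫⁻ ω in {ω | W.X t ω ∈ A}, ENNReal.ofReal (wfV W r t ω) ∂W.P := by
  set I : W.Ω → ℝ := fun ω => ∫ u in Ioc (0:ℝ) t, -r (W.X u ω) with hI
  have hI' : Measurable I := wfV_meas_gen W (k := fun x => -r x) hr.neg t _ fun u _ => W.measX u
  have hI0 : ∀ ω, 0 ≤ I ω := fun ω => integral_nonneg fun u => by
    have := hneg _ (W.range01 u ω); simp only [Pi.zero_apply]; linarith
  set Z : W.Ω → ℝ × ℝ := fun ω => (I ω, W.X t ω) with hZ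
  have hZ' : Measurable Z := hI'.prodMk (W.measX t)
  have hind : IndepFun Z W.Tkill W.P := wf_kill_indep W hr t
  have hprod := (indepFun_iff_map_prod_eq_prod_map_map hZ'.aemeasurable W.measT.aemeasurable).1 hind
  set B : Set ((ℝ × ℝ) × ℝ) := {p | p.1.2 ∈ A ∧ p.1.1 < p.2} with hB
  have hBm : MeasurableSet B :=
    ((measurable_snd.comp measurable_fst) hA).inter
      (measurableSet_lt (measurable_fst.comp measurable_fst) measurable_snd)
  have e1 : W.P ({ω | W.X t ω ∈ A} ∩ W.aliveSoft t)
      = (W.P.map fun ω => (Z ω, W.Tkill ω)) B := by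
    rw [Measure.map_apply (hZ'.prodMk W.measT) hBm]; rfl
  rw [e1, hprod, Measure.prod_apply hBm, lintegral_map (measurable_measure_prodMk_left hBm) hZ',
    ← lintegral_indicator (s := {ω | W.X t ω ∈ A}) (W.measX t hA)]
  congr 1
  ext ω
  rw [Measure.map_apply W.measT (measurable_prodMk_left hBm)]
  by_cases h : W.X t ω ∈ A
  · have : W.Tkill ⁻¹' (Prod.mk (Z ω) ⁻¹' B) = {ω' | I ω < W.Tkill ω'} := by
      ext ω'; simp [hB, hZ, h]
    rw [this, W.expLaw _ (hI0 ω), indicator_of_mem (by exact h), wfV, hI]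
    simp only [integral_neg, neg_neg]
  · have : W.Tkill ⁻¹' (Prod.mk (Z ω) ⁻¹' B) = ∅ := by
      ext ω'; simp [hB, hZ, h]
    rw [this, indicator_of_notMem (by exact h)]; simp

/-- real version -/
lemma wf_kill_real (W : WFKilled s σ r μ₀) (hr : Measurable r)
    (hneg : ∀ x ∈ Icc (0:ℝ) 1, r x ≤ 0) (t : ℝ) {A : Set ℝ} (hA : MeasurableSet A) :
    (W.P ({ω | W.X t ω ∈ A} ∩ W.aliveSoft t)).toReal
      = ∫ ω, wfV W r t ω * A.indicator 1 (W.X t ω) ∂W.P := by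
  rw [wf_kill W hr hneg t hA, ← integral_toReal (by
    exact (wfV_meas W hr t).ennreal_ofReal.aemeasurable) (by simp),
    ← integral_indicator (s := {ω | W.X t ω ∈ A}) (W.measX t hA)]
  congr 1
  ext ω
  by_cases h : W.X t ω ∈ A
  · rw [indicator_of_mem (by exact h), indicator_of_mem h,
      ENNReal.toReal_ofReal (wfV_pos W r t ω).le]; simp
  · rw [indicator_of_notMem (by exact h), indicator_of_notMem h]; simp

lemma wf_max_aux {Ω : Type*} {m0 : MeasurableSpace Ω} {P : Measure Ω} [IsProbabilityMeasure P]
    {ℱ : Filtration ℝ m0} {Y : ℝ → Ω → ℝ} (hY : Martingale Y ℱ P)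
    (h01 : ∀ t ω, Y t ω ∈ Icc (0:ℝ) 1) {T : ℝ} (hT : 0 ≤ T) {ε : ℝ} (hε : 0 < ε) (hε1 : ε < 1)
    (n : ℕ) (hn : 0 < n) :
    ∃ B : Set Ω, MeasurableSet B ∧ (∀ ω, ∀ k ≤ n, Y (T * (k / n)) ω ≤ ε → ω ∈ B) ∧
      ∫⁻ ω in B, ENNReal.ofReal (Y T ω) ∂P ≤ ENNReal.ofReal ε := by
  have hmono : Monotone fun k : ℕ => T * ((k:ℝ) / n) := by
    intro a b hab
    have : (a:ℝ) ≤ b := by exact_mod_cast hab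
    beta_reduce
    gcongr
  let 𝒢 : Filtration ℕ m0 := ⟨fun k => ℱ (T * (k / n)), fun a b hab => ℱ.mono (hmono hab),
    fun k => ℱ.le _⟩
  let f : ℕ → Ω → ℝ := fun k ω => 1 - Y (T * (k / n)) ω
  have hint : ∀ t, Integrable (Y t) P := hY.integrable
  have hmY : ∀ t, Measurable (Y t) := fun t => ((hY.1 t).mono (ℱ.le t)).measurable
  have h1 : Martingale (fun k => Y (T * ((k:ℕ) / n))) 𝒢 P :=
    ⟨fun k => hY.1 _, fun i j hij => hY.2 _ _ (hmono hij)⟩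
  have hf : Martingale f 𝒢 P := (martingale_const 𝒢 P (1:ℝ)).sub h1
  have hnn : 0 ≤ f := fun k ω => by
    have := (h01 (T * (k / n)) ω).2
    simp only [f, Pi.zero_apply]; linarith
  have hmax := maximal_ineq hf.submartingale hnn (ε := (1 - ε).toNNReal) n
  have he : (((1 - ε).toNNReal : ℝ≥0) : ℝ) = 1 - ε := Real.coe_toNNReal _ (by linarith)
  set B : Set Ω := {ω | (((1 - ε).toNNReal : ℝ≥0) : ℝ) ≤
    (Finset.range (n + 1)).sup' Finset.nonempty_range_add_one fun k => f k ω} with hB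
  have hBm : MeasurableSet B := by
    apply measurableSet_le measurable_const
    exact Finset.measurable_range_sup'' fun k _ => measurable_const.sub (hmY _)
  refine ⟨B, hBm, ?_, ?_⟩
  · intro ω k hk hle
    simp only [hB, mem_ofPred_eq, Finset.le_sup'_iff, he]
    exact ⟨k, by simp; omega, by simp only [f]; linarith⟩
  · have hfn : ∀ ω, f n ω = 1 - Y T ω := by
      intro ω; simp only [f]; rw [div_self (by exact_mod_cast hn.ne'), mul_one]
    have e1 : ∫ ω in B, f n ω ∂P = P.real B - ∫ ω in B, Y T ω ∂P := by
      simp only [hfn]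
      rw [integral_sub (integrable_const _) (hint T).restrict]; simp
    have e2 : (1 - ε) * P.real B ≤ P.real B - ∫ ω in B, Y T ω ∂P := by
      rw [← e1]
      have := ENNReal.toReal_mono ENNReal.ofReal_ne_top hmax
      rw [ENNReal.toReal_mul, ENNReal.toReal_ofReal
        (setIntegral_nonneg hBm fun ω _ => hnn n ω)] at this
      simpa [he, Measure.real] using this
    have e3 : P.real B ≤ 1 := measureReal_le_one
    rw [← ofReal_integral_eq_lintegral_ofReal (hint T).restrict
      (Eventually.of_forall fun ω => (h01 T ω).1)]
    apply ENNReal.ofReal_le_ofReal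
    nlinarith

lemma wf_abs_aux {Ω : Type*} {m0 : MeasurableSpace Ω} {P : Measure Ω} [IsProbabilityMeasure P]
    {ℱ : Filtration ℝ m0} {Y : ℝ → Ω → ℝ} (hY : Martingale Y ℱ P)
    (h01 : ∀ t ω, Y t ω ∈ Icc (0:ℝ) 1) (hc : ∀ ω, Continuous fun t => Y t ω)
    {T : ℝ} (hT : 0 ≤ T) :
    ∀ᵐ ω ∂P, ∀ u ∈ Icc (0:ℝ) T, Y u ω = 0 → Y T ω = 0 := by
  rcases hT.eq_or_lt with h0 | hTpos
  · refine Eventually.of_forall fun ω u hu h => ?_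
    have : u = T := by rw [← h0] at hu ⊢; exact le_antisymm hu.2 hu.1
    rw [← this]; exact h
  have hmY : ∀ t, Measurable (Y t) := fun t => ((hY.1 t).mono (ℱ.le t)).measurable
  have key : ∀ j n : ℕ, ∃ B : Set Ω, MeasurableSet B ∧
      (∀ ω, ∀ k ≤ n + 1, Y (T * (k / ((n + 1 : ℕ) : ℝ))) ω ≤ 1 / ((j:ℝ) + 2) → ω ∈ B) ∧
      ∫⁻ ω in B, ENNReal.ofReal (Y T ω) ∂P ≤ ENNReal.ofReal (1 / ((j:ℝ) + 2)) := by
    intro j n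
    refine wf_max_aux hY h01 hT (by positivity) ?_ (n + 1) (by omega)
    rw [div_lt_one (by positivity)]
    have : (0:ℝ) ≤ j := by positivity
    linarith
  choose B hBm hB hBi using key
  set G : ℕ → Ω → ℝ≥0∞ := fun j ω =>
    liminf (fun n => (B j n).indicator (fun ω => ENNReal.ofReal (Y T ω)) ω) atTop with hG
  have hBI : ∀ j n, Measurable ((B j n).indicator (fun ω => ENNReal.ofReal (Y T ω))) :=
    fun j n => (hmY T).ennreal_ofReal.indicator (hBm j n)
  have hGi : ∀ j, ∫⁻ ω, G j ω ∂P ≤ ENNReal.ofReal (1 / ((j:ℝ) + 2)) := by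
    intro j
    refine (lintegral_liminf_le (hBI j)).trans ?_
    refine liminf_le_of_frequently_le' (Frequently.of_forall fun n => ?_)
    rw [lintegral_indicator (hBm j n)]
    exact hBi j n
  have hGm : ∀ j, Measurable (G j) := fun j => Measurable.liminf (hBI j)
  have hz : ∫⁻ ω, (⨅ j, G j ω) ∂P = 0 := by
    refine le_antisymm ?_ bot_le
    have hlim : Tendsto (fun j : ℕ => ENNReal.ofReal (1 / ((j:ℝ) + 2))) atTop (𝓝 0) := by
      rw [← ENNReal.ofReal_zero]
      refine ENNReal.tendsto_ofReal ?_
      exact tendsto_const_nhds.div_atTop (tendsto_atTop_add_const_right _ _ tendsto_natCast_atTop_atTop)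
    refine ge_of_tendsto' hlim fun j => ?_
    exact (lintegral_mono fun ω => iInf_le _ j).trans (hGi j)
  rw [lintegral_eq_zero_iff (Measurable.iInf hGm)] at hz
  filter_upwards [hz] with ω hω u hu hYu
  have hge : ENNReal.ofReal (Y T ω) ≤ ⨅ j, G j ω := by
    refine le_iInf fun j => ?_
    refine le_liminf_of_le (by isBoundedDefault) ?_
    have hl : Tendsto (fun n : ℕ => Y (T * (((⌊u / T * ((n + 1 : ℕ) : ℝ)⌋₊ : ℕ) : ℝ) / ((n + 1 : ℕ) : ℝ))) ω)
        atTop (𝓝 (Y u ω)) := by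
      have h1 : Tendsto (fun x : ℝ => ((⌊u / T * x⌋₊ : ℕ) : ℝ) / x) atTop (𝓝 (u / T)) :=
        tendsto_nat_floor_mul_div_atTop (div_nonneg hu.1 hT)
      have h2 := h1.comp (tendsto_natCast_atTop_atTop.comp (tendsto_add_atTop_nat 1))
      have h3 := h2.const_mul T
      rw [mul_div_cancel₀ _ hTpos.ne'] at h3
      exact ((hc ω).tendsto u).comp h3
    rw [hYu] at hl
    have hpos : (0:ℝ) < 1 / ((j:ℝ) + 2) := by positivity
    filter_upwards [hl.eventually (Iio_mem_nhds hpos)] with n hn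
    rw [indicator_of_mem]
    refine hB j n ω _ ?_ (le_of_lt hn)
    have : u / T * ((n + 1 : ℕ) : ℝ) ≤ ((n + 1 : ℕ) : ℝ) :=
      mul_le_of_le_one_left (by positivity) ((div_le_one hTpos).2 hu.2)
    exact Nat.floor_le_of_le this
  have : ENNReal.ofReal (Y T ω) ≤ 0 := hge.trans (le_of_eq hω)
  exact le_antisymm (by simpa using this) (h01 T ω).1

lemma wfh_mart (W : WFKilled s σ r μ₀) (hσ : 0 < σ) :
    Martingale (fun t ω => wfh s σ (W.X t ω)) W.ℱ W.P := by
  have := W.martProblem _ (wfh_spec s σ hσ).1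
  simpa [(wfh_spec s σ hσ).2] using this

lemma wf_abs (W : WFKilled s σ r μ₀) (hσ : 0 < σ) {T : ℝ} (hT : 0 ≤ T) :
    ∀ᵐ ω ∂W.P, ∀ u ∈ Icc (0:ℝ) T, (W.X u ω = 0 → W.X T ω = 0) ∧ (W.X u ω = 1 → W.X T ω = 1) := by
  have hc : Continuous (wfh s σ) := (wfh_spec s σ hσ).1.continuous
  have hi := (wfh_strictMono s σ).injective
  have m1 := wfh_mart W hσ
  have m2 : Martingale (fun t ω => 1 - wfh s σ (W.X t ω)) W.ℱ W.P :=
    (martingale_const W.ℱ W.P (1:ℝ)).sub m1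
  have a1 := wf_abs_aux m1 (fun t ω => wfh_mem s σ (W.range01 t ω))
    (fun ω => hc.comp (W.contX ω)) hT
  have a2 := wf_abs_aux m2 (fun t ω => by
      have := wfh_mem s σ (W.range01 t ω); constructor <;> linarith [this.1, this.2])
    (fun ω => continuous_const.sub (hc.comp (W.contX ω))) hT
  filter_upwards [a1, a2] with ω h1 h2 u hu
  constructor
  · intro h
    have := h1 u hu (by rw [h, wfh_zero])
    exact hi (by rw [this, wfh_zero])
  · intro h
    have := h2 u hu (by rw [h, wfh_one]; ring)
    exact hi (by rw [wfh_one]; linarith)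

lemma wf_abs_all (W : WFKilled s σ r μ₀) (hσ : 0 < σ) :
    ∀ᵐ ω ∂W.P, ∀ u t : ℝ, 0 ≤ u → u ≤ t →
      (W.X u ω = 0 → W.X t ω = 0) ∧ (W.X u ω = 1 → W.X t ω = 1) := by
  have h : ∀ᵐ ω ∂W.P, ∀ q : ℚ, 0 ≤ (q:ℝ) → ∀ u ∈ Icc (0:ℝ) q,
      (W.X u ω = 0 → W.X q ω = 0) ∧ (W.X u ω = 1 → W.X q ω = 1) := by
    rw [ae_all_iff]
    intro q
    by_cases hq : 0 ≤ (q:ℝ)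
    · filter_upwards [wf_abs W hσ hq] with ω hω _ using hω
    · exact Eventually.of_forall fun ω h => absurd h hq
  filter_upwards [h] with ω hω u t hu hut
  have main : ∀ z : ℝ, (∀ q : ℚ, 0 ≤ (q:ℝ) → u ≤ q → W.X q ω = z) → W.X u ω = z → W.X t ω = z := by
    intro z hz huz
    rcases hut.eq_or_lt with rfl | hlt
    · exact huz
    by_contra hne
    have hop : IsOpen ((fun t => W.X t ω) ⁻¹' {z}ᶜ ∩ Ioi u) :=
      (isOpen_compl_singleton.preimage (W.contX ω)).inter isOpen_Ioi
    obtain ⟨x, hx, q, rfl⟩ := Rat.denseRange_cast.inter_open_nonempty _ hop ⟨t, hne, hlt⟩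
    exact hx.1 (hz q (hu.trans (le_of_lt hx.2)) (le_of_lt hx.2))
  exact ⟨fun h => main 0 (fun q hq hq' => (hω q hq u ⟨hu, hq'⟩).1 h) h,
    fun h => main 1 (fun q hq hq' => (hω q hq u ⟨hu, hq'⟩).2 h) h⟩

section gq
variable (s σ)
lemma wfGq_meas {q : ℝ → ℝ} (hqm : Measurable q) : Measurable (wfGq s σ q) := by
  unfold wfGq
  refine (StronglyMeasurable.integral_prod_right
    (f := fun x y => wfg s σ x y * wfm s σ y * q y) ?_).measurable
  refine Measurable.stronglyMeasurable ?_
  exact ((wfg_cont s σ).measurable.mul ((wfm_cont s σ).measurable.comp measurable_snd)).mul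
    (hqm.comp measurable_snd)

lemma wfGq_bd_aux (hs : 0 ≤ s) (hσ : 0 < σ) (q : ℝ → ℝ) {x y : ℝ} (hx : x ∈ Icc (0:ℝ) 1)
    (hy : y ∈ Icc (0:ℝ) 1) :
    |wfg s σ x y * wfm s σ y * q y|
      ≤ Real.exp (wfc s σ) ^ 2 * (2 / σ ^ 2) * |y * (1 - y) * q y| := by
  have hy1 : 0 ≤ 1 - y := by linarith [hy.2]
  have g0 := wfg_nonneg s σ hx hy
  have g1 := wfg_le s σ hs hx hy
  have m0 := (wfm_pos s σ hσ y).le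
  have m1 := wfm_le s σ hs hy.1
  simp only [abs_mul, abs_of_nonneg g0, abs_of_nonneg m0, abs_of_nonneg hy.1, abs_of_nonneg hy1]
  have : wfg s σ x y * wfm s σ y ≤
    Real.exp (wfc s σ) ^ 2 * (y * (1 - y)) * (2 / σ ^ 2) :=
    mul_le_mul g1 m1 m0 (mul_nonneg (by positivity) (mul_nonneg hy.1 hy1))
  calc _ ≤ Real.exp (wfc s σ) ^ 2 * (y * (1 - y)) * (2 / σ ^ 2) * |q y| :=
        mul_le_mul_of_nonneg_right this (abs_nonneg _)
    _ = _ := by ring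

lemma wfGq_contOn (hs : 0 ≤ s) (hσ : 0 < σ) {q : ℝ → ℝ} (hqm : Measurable q)
    (hq : IntegrableOn (fun y => y * (1 - y) * q y) (Ioc 0 1)) :
    ContinuousOn (wfGq s σ q) (Icc 0 1) := by
  refine continuousOn_of_dominated (bound := fun y =>
    Real.exp (wfc s σ) ^ 2 * (2 / σ ^ 2) * |y * (1 - y) * q y|) ?_ ?_ (hq.norm.const_mul _) ?_
  · intro x _
    have hc : Continuous fun y => wfg s σ x y := (wfg_cont s σ).comp (Continuous.prodMk_right x)
    exact ((hc.mul (wfm_cont s σ)).measurable.mul hqm).aestronglyMeasurable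
  · intro x hx
    filter_upwards [ae_restrict_mem measurableSet_Ioc] with y hy
    exact wfGq_bd_aux s σ hs hσ q hx ⟨hy.1.le, hy.2⟩
  · refine Eventually.of_forall fun y => ?_
    have hc : Continuous fun x => wfg s σ x y := (wfg_cont s σ).comp (Continuous.prodMk_left y)
    exact ((hc.mul continuous_const).mul continuous_const).continuousOn

lemma wfGq_zero (q : ℝ → ℝ) : wfGq s σ q 0 = 0 := by
  unfold wfGq
  refine setIntegral_eq_zero_of_forall_eq_zero fun y hy => ?_
  rw [wfg_zero s σ ⟨hy.1.le, hy.2⟩]; ring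

lemma wfGq_one (q : ℝ → ℝ) : wfGq s σ q 1 = 0 := by
  unfold wfGq
  refine setIntegral_eq_zero_of_forall_eq_zero fun y hy => ?_
  rw [wfg_one s σ ⟨hy.1.le, hy.2⟩]; ring

lemma wf_bddOn {f : ℝ → ℝ} (hf : ContinuousOn f (Icc 0 1)) :
    ∃ C, 0 ≤ C ∧ ∀ x ∈ Icc (0:ℝ) 1, |f x| ≤ C := by
  obtain ⟨C, hC⟩ := isCompact_Icc.exists_bound_of_continuousOn (s := Icc (0:ℝ) 1) hf
  exact ⟨C, (norm_nonneg _).trans (hC 0 (by simp)), hC⟩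
end gq

def wfLam (W : WFKilled s σ r μ₀) (k : ℝ → ℝ) (t : ℝ) : Measure ℝ :=
  (W.P.withDensity fun ω => ENNReal.ofReal (wfV W k t ω)).map (W.X t)

def wfNu (W : WFKilled s σ r μ₀) (k : ℝ → ℝ) (T : ℝ) : Measure ℝ :=
  ((((volume.restrict (Ioc 0 T)).prod W.P).withDensity
    fun p => ENNReal.ofReal (wfV W k p.1 p.2)).map fun p => W.X p.1 p.2).restrict (Ioo 0 1)

section occ
variable (W : WFKilled s σ r μ₀) {k : ℝ → ℝ} {M : ℝ}

lemma wfLam_integral (hk : Measurable k) (t : ℝ) {F : ℝ → ℝ} (hF : Measurable F) :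
    ∫ x, F x ∂(wfLam W k t) = ∫ ω, wfV W k t ω * F (W.X t ω) ∂W.P := by
  rw [wfLam, integral_map (W.measX t).aemeasurable hF.aestronglyMeasurable,
    integral_withDensity_eq_integral_toReal_smul (wfV_meas W hk t).ennreal_ofReal
    (Eventually.of_forall fun x => ENNReal.ofReal_lt_top)]
  simp only [ENNReal.toReal_ofReal (wfV_pos W k t _).le, smul_eq_mul]

lemma wfLam_fin (hk : Measurable k) (hM : ∀ x ∈ Icc (0:ℝ) 1, |k x| ≤ M) {t : ℝ} (ht : 0 ≤ t) :
    IsFiniteMeasure (wfLam W k t) := by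
  have : IsFiniteMeasure (W.P.withDensity fun ω => ENNReal.ofReal (wfV W k t ω)) :=
    isFiniteMeasure_withDensity_ofReal
      (wf_int_bdd W _ _ (wfV_meas W hk t) (fun ω => wfV_le W hk hM ht ω)).2
  unfold wfLam; infer_instance

lemma wfLam_supp (k : ℝ → ℝ) (t : ℝ) : (wfLam W k t).restrict (Icc 0 1) = wfLam W k t := by
  apply Measure.restrict_eq_self_of_ae_mem
  rw [wfLam, ae_map_iff (W.measX t).aemeasurable (p := fun x => x ∈ Icc (0:ℝ) 1) measurableSet_Icc]
  exact Eventually.of_forall fun ω => W.range01 t ω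

lemma wfNu_fin (hk : Measurable k) (hM : ∀ x ∈ Icc (0:ℝ) 1, |k x| ≤ M) (T : ℝ) :
    IsFiniteMeasure (wfNu W k T) := by
  have : IsFiniteMeasure (((volume.restrict (Ioc 0 T)).prod W.P).withDensity
      fun p => ENNReal.ofReal (wfV W k p.1 p.2)) :=
    isFiniteMeasure_withDensity_ofReal
      (wf_int_prod W T _ _ (wfV_unc W hk hM) (fun t ω h0 hT => wfV_le' W hk hM h0.le hT ω)).2
  unfold wfNu; infer_instance

lemma wfNu_supp (k : ℝ → ℝ) (T : ℝ) : (wfNu W k T).restrict (Icc 0 1) = wfNu W k T := by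
  unfold wfNu
  rw [Measure.restrict_restrict measurableSet_Icc, inter_eq_self_of_subset_right Ioo_subset_Icc_self]

lemma wfNu_integral (hk : Measurable k) (hM : ∀ x ∈ Icc (0:ℝ) 1, |k x| ≤ M) (T : ℝ)
    {F : ℝ → ℝ} (hF : Measurable F) {C : ℝ} (hC : ∀ x ∈ Icc (0:ℝ) 1, |F x| ≤ C) :
    ∫ x, F x ∂(wfNu W k T)
      = ∫ t in Ioc 0 T, ∫ ω, wfV W k t ω * (Ioo 0 1).indicator F (W.X t ω) ∂W.P := by
  have hFi : Measurable ((Ioo (0:ℝ) 1).indicator F) := hF.indicator measurableSet_Ioo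
  rw [wfNu, ← integral_indicator measurableSet_Ioo, integral_map (wfX_unc W).aemeasurable
    hFi.aestronglyMeasurable,
    integral_withDensity_eq_integral_toReal_smul (wfV_unc W hk hM).ennreal_ofReal
    (Eventually.of_forall fun x => ENNReal.ofReal_lt_top)]
  simp only [ENNReal.toReal_ofReal (wfV_pos W k _ _).le, smul_eq_mul]
  rw [integral_prod]
  refine wf_int_prod W T (Real.exp (M * T) * C) _ ((wfV_unc W hk hM).mul (hFi.comp (wfX_unc W))) ?_
  intro t ω h0 hT
  rw [abs_mul]
  refine mul_le_mul (wfV_le' W hk hM h0.le hT ω) ?_ (abs_nonneg _) (Real.exp_pos _).le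
  refine le_trans ?_ (hC _ (W.range01 t ω))
  by_cases h : W.X t ω ∈ Ioo (0:ℝ) 1
  · simp [indicator_of_mem h]
  · simp [indicator_of_notMem h]

lemma wfNu_integral' (hk : Measurable k) (hM : ∀ x ∈ Icc (0:ℝ) 1, |k x| ≤ M) (T : ℝ)
    {F : ℝ → ℝ} (hF : Measurable F) {C : ℝ} (hC : ∀ x ∈ Icc (0:ℝ) 1, |F x| ≤ C)
    (h0 : F 0 = 0) (h1 : F 1 = 0) :
    ∫ x, F x ∂(wfNu W k T) = ∫ t in Ioc 0 T, ∫ ω, wfV W k t ω * F (W.X t ω) ∂W.P := by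
  rw [wfNu_integral W hk hM T hF hC]
  congr 1; ext t; congr 1; ext ω; congr 1
  by_cases h : W.X t ω ∈ Ioo (0:ℝ) 1
  · rw [indicator_of_mem h]
  · rw [indicator_of_notMem h]
    have hx := W.range01 t ω
    rcases hx.1.eq_or_lt with e | h0'
    · rw [← e, h0]
    · rcases hx.2.eq_or_lt with e | h1'
      · rw [e, h1]
      · exact absurd ⟨h0', h1'⟩ h

lemma wf_intble {μ : Measure ℝ} [IsFiniteMeasure μ] (hμ : μ.restrict (Icc 0 1) = μ)
    {F : ℝ → ℝ} (hF : Measurable F) {C : ℝ} (hC : ∀ x ∈ Icc (0:ℝ) 1, |F x| ≤ C) :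
    Integrable F μ := by
  refine Integrable.of_bound hF.aestronglyMeasurable C ?_
  filter_upwards [wf_ae_mem hμ] with x hx using hC x hx

lemma wf_occ_id (hs : 0 ≤ s) (hσ : 0 < σ) (hk : Measurable k)
    (hM : ∀ x ∈ Icc (0:ℝ) 1, |k x| ≤ M) {T : ℝ} (hT : 0 ≤ T)
    (v : ℝ → ℝ) (hv : Continuous v) :
    ∫ x, x * (1 - x) * v x ∂(wfNu W k T)
      = ∫ x, wfGq s σ v x ∂(wfLam W k 0) - ∫ x, wfGq s σ v x ∂(wfLam W k T)
        + ∫ x, k x * wfGq s σ v x ∂(wfNu W k T) := by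
  obtain ⟨f, hf, hL, hG⟩ := wf_green s σ hσ v hv
  have e := wf_ito W hk hM hf hT
  have hfm : Measurable f := hf.continuous.measurable
  obtain ⟨Cf, hCf0, hCf⟩ := wf_bdd hf.continuous
  obtain ⟨Cv, hCv0, hCv⟩ := wf_bdd (f := fun x => x * (1 - x) * v x) (by fun_prop)
  have f0 : f 0 = 0 := by rw [hG 0 (by simp)]; exact wfGq_zero s σ v
  have f1 : f 1 = 0 := by rw [hG 1 (by simp)]; exact wfGq_one s σ v
  have hM0 : 0 ≤ M := (abs_nonneg _).trans (hM 0 (by simp))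
  have fin := wfNu_fin W hk hM T
  have hkf : ∀ x ∈ Icc (0:ℝ) 1, |k x * f x| ≤ M * Cf := fun x hx => by
    rw [abs_mul]; exact mul_le_mul (hM x hx) (hCf x hx) (abs_nonneg _) hM0
  have ae_eq : ∀ (μ : Measure ℝ), μ.restrict (Icc 0 1) = μ → ∀ᵐ x ∂μ, wfGq s σ v x = f x := by
    intro μ hμ
    filter_upwards [wf_ae_mem hμ] with x hx using (hG x hx).symm
  rw [integral_congr_ae (ae_eq _ (wfLam_supp W k 0)), integral_congr_ae (ae_eq _ (wfLam_supp W k T)),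
    integral_congr_ae (f := fun x => k x * wfGq s σ v x) (g := fun x => k x * f x) (by
      filter_upwards [ae_eq _ (wfNu_supp W k T)] with x hx; rw [hx]),
    wfLam_integral W hk 0 hfm, wfLam_integral W hk T hfm]
  have e2 := wfNu_integral' W hk hM T (F := fun x => LWF s σ f x + k x * f x)
    ((LWF_cont s σ hf).measurable.add (hk.mul hfm)) (C := Cv + M * Cf) (fun x hx => by
      refine (abs_add_le _ _).trans (add_le_add ?_ (hkf x hx))
      rw [hL, abs_neg]; exact hCv x hx) (by simp [hL, f0]) (by simp [hL, f1])
  rw [← e2, integral_add] at e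
  · simp only [hL, integral_neg] at e
    have : ∀ ω, wfV W k 0 ω = 1 := fun ω => by simp [wfV]
    simp only [this, one_mul]
    linarith
  · have : LWF s σ f = fun x => -(x * (1 - x) * v x) := funext hL
    rw [this]
    exact (wf_intble (wfNu_supp W k T) (by fun_prop) hCv).neg
  · exact wf_intble (wfNu_supp W k T) (hk.mul hfm) hkf

lemma wf_occ_ext (hs : 0 ≤ s) (hσ : 0 < σ) (hk : Measurable k)
    (hM : ∀ x ∈ Icc (0:ℝ) 1, |k x| ≤ M) {T : ℝ} (hT : 0 ≤ T)
    {q : ℝ → ℝ} (hqm : Measurable q) (hq : IntegrableOn (fun y => y * (1 - y) * q y) (Ioc 0 1)) :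
    Integrable (fun x => x * (1 - x) * q x) (wfNu W k T) ∧
    ∫ x, x * (1 - x) * q x ∂(wfNu W k T)
      = ∫ x, wfGq s σ q x ∂(wfLam W k 0) - ∫ x, wfGq s σ q x ∂(wfLam W k T)
        + ∫ x, k x * wfGq s σ q x ∂(wfNu W k T) := by
  have fin := wfNu_fin W hk hM T
  have fin0 := wfLam_fin W hk hM le_rfl
  have finT := wfLam_fin W hk hM hT
  have hM0 : 0 ≤ M := (abs_nonneg _).trans (hM 0 (by simp))
  have hkp : Measurable fun x => max (k x) 0 := hk.max measurable_const
  have hkn : Measurable fun x => max (-k x) 0 := hk.neg.max measurable_const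
  have bp : ∀ x ∈ Icc (0:ℝ) 1, |max (k x) 0| ≤ M := fun x hx => by
    rw [abs_of_nonneg (le_max_right _ _)]; exact max_le ((le_abs_self _).trans (hM x hx)) hM0
  have bn : ∀ x ∈ Icc (0:ℝ) 1, |max (-k x) 0| ≤ M := fun x hx => by
    rw [abs_of_nonneg (le_max_right _ _)]; exact max_le ((neg_le_abs _).trans (hM x hx)) hM0
  set N1 := (wfNu W k T).withDensity fun x => ENNReal.ofReal (max (k x) 0) with hN1
  set N2 := (wfNu W k T).withDensity fun x => ENNReal.ofReal (max (-k x) 0) with hN2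
  have fN1 : IsFiniteMeasure N1 := isFiniteMeasure_withDensity_ofReal
    (wf_intble (wfNu_supp W k T) hkp bp).2
  have fN2 : IsFiniteMeasure N2 := isFiniteMeasure_withDensity_ofReal
    (wf_intble (wfNu_supp W k T) hkn bn).2
  have sN1 : N1.restrict (Icc 0 1) = N1 := by
    rw [hN1, restrict_withDensity measurableSet_Icc, wfNu_supp]
  have sN2 : N2.restrict (Icc 0 1) = N2 := by
    rw [hN2, restrict_withDensity measurableSet_Icc, wfNu_supp]
  have key : ∀ q' : ℝ → ℝ, Measurable q' →
      IntegrableOn (fun y => y * (1 - y) * q' y) (Ioc 0 1) →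
      ∫ x, wfGq s σ q' x ∂(wfLam W k 0 + N1) - ∫ x, wfGq s σ q' x ∂(wfLam W k T + N2)
      = ∫ x, wfGq s σ q' x ∂(wfLam W k 0) - ∫ x, wfGq s σ q' x ∂(wfLam W k T)
        + ∫ x, k x * wfGq s σ q' x ∂(wfNu W k T) := by
    intro q' hm' hi'
    have gm := wfGq_meas s σ hm'
    obtain ⟨C, hC0, hC⟩ := wf_bddOn (wfGq_contOn s σ hs hσ hm' hi')
    rw [integral_add_measure (wf_intble (wfLam_supp W k 0) gm hC) (wf_intble sN1 gm hC),
      integral_add_measure (wf_intble (wfLam_supp W k T) gm hC) (wf_intble sN2 gm hC),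
      hN1, hN2, wf_wd_int hkp (Eventually.of_forall fun x => le_max_right _ _),
      wf_wd_int hkn (Eventually.of_forall fun x => le_max_right _ _)]
    have : ∫ x, k x * wfGq s σ q' x ∂(wfNu W k T)
        = ∫ x, max (k x) 0 * wfGq s σ q' x ∂(wfNu W k T)
          - ∫ x, max (-k x) 0 * wfGq s σ q' x ∂(wfNu W k T) := by
      rw [← integral_sub]
      · congr 1; ext x
        rcases le_total 0 (k x) with h | h
        · rw [max_eq_left h, max_eq_right (by linarith)]; ring
        · rw [max_eq_right h, max_eq_left (by linarith)]; ring
      · exact wf_intble (C := M * C) (wfNu_supp W k T) (hkp.mul gm) fun x hx => by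
          rw [abs_mul]; exact mul_le_mul (bp x hx) (hC x hx) (abs_nonneg _) hM0
      · exact wf_intble (C := M * C) (wfNu_supp W k T) (hkn.mul gm) fun x hx => by
          rw [abs_mul]; exact mul_le_mul (bn x hx) (hC x hx) (abs_nonneg _) hM0
    rw [this]; ring
  have h := wf_ext s σ (ν := wfNu W k T) (κ₁ := wfLam W k 0 + N1) (κ₂ := wfLam W k T + N2) hs hσ
    (wfNu_supp W k T) (by rw [Measure.restrict_add, wfLam_supp, sN1])
    (by rw [Measure.restrict_add, wfLam_supp, sN2]) (fun v hv => by
      rw [key v hv.measurable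
        ((Continuous.integrableOn_Icc (by fun_prop)).mono_set Ioc_subset_Icc_self)]
      exact wf_occ_id W hs hσ hk hM hT v hv) hqm hq
  exact ⟨h.1, by rw [h.2, key q hqm hq]⟩
end occ

lemma wfV_add_const (W : WFKilled s σ r μ₀) {k : ℝ → ℝ} {M : ℝ} (hk : Measurable k)
    (hM : ∀ x ∈ Icc (0:ℝ) 1, |k x| ≤ M) (c : ℝ) {t : ℝ} (ht : 0 ≤ t) (ω : W.Ω) :
    wfV W (fun x => k x + c) t ω = Real.exp (c * t) * wfV W k t ω := by
  have : Integrable (fun u => k (W.X u ω)) (volume.restrict (Ioc 0 t)) :=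
    Integrable.of_bound (hk.comp (W.contX ω).measurable).aestronglyMeasurable M
      (Eventually.of_forall fun u => hM _ (W.range01 u ω))
  rw [wfV, wfV, integral_add this (integrable_const _), ← Real.exp_add]
  congr 1
  simp [ht]; ring

section alpha
variable {α : Measure ℝ} {ρ M : ℝ}

lemma wf_alpha_K (hσ : 0 < σ) (hr : Measurable r) (hM : ∀ x ∈ Icc (0:ℝ) 1, |r x| ≤ M)
    (hneg : ∀ x ∈ Icc (0:ℝ) 1, r x ≤ 0) (hQ : IsQSD s σ r α ρ) (W : WFKilled s σ r α)
    {t : ℝ} (ht : 0 < t) {A : Set ℝ} (hA : MeasurableSet A) :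
    ∫ ω, wfV W (fun x => r x + ρ) t ω * (A ∩ Ioo 0 1).indicator 1 (W.X t ω) ∂W.P
      = (α A).toReal := by
  simp only [wfV_add_const W hr hM ρ ht.le, mul_assoc]
  rw [integral_const_mul, ← wf_kill_real W hr hneg t (hA.inter measurableSet_Ioo)]
  have e : W.P ({ω | W.X t ω ∈ A ∩ Ioo 0 1} ∩ W.aliveSoft t)
      = W.P ({ω | W.X t ω ∈ A} ∩ W.aliveAll t) := by
    apply measure_congr
    filter_upwards [wf_abs_all W hσ] with ω hω
    apply propext
    constructor
    · rintro ⟨⟨h1, h2⟩, h3⟩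
      refine ⟨h1, ⟨h3, ?_⟩, ?_⟩
      · intro u hu h; exact h2.1.ne' ((hω u t hu.1 hu.2).1 h)
      · intro u hu h; exact h2.2.ne ((hω u t hu.1 hu.2).2 h)
    · rintro ⟨h1, ⟨h3, h4⟩, h5⟩
      have hx := W.range01 t ω
      exact ⟨⟨h1, lt_of_le_of_ne hx.1 (Ne.symm (h4 t ⟨ht.le, le_rfl⟩)),
        lt_of_le_of_ne hx.2 (h5 t ⟨ht.le, le_rfl⟩)⟩, h3⟩
  rw [e, hQ.2.2 W t ht A hA, ENNReal.toReal_mul, ENNReal.toReal_ofReal (Real.exp_pos _).le,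
    ← mul_assoc, ← Real.exp_add]
  simp

lemma wf_alpha_id (hs : 0 ≤ s) (hσ : 0 < σ) (hr : Measurable r)
    (hM : ∀ x ∈ Icc (0:ℝ) 1, |r x| ≤ M)
    (hneg : ∀ x ∈ Icc (0:ℝ) 1, r x ≤ 0) (hQ : IsQSD s σ r α ρ) (W : WFKilled s σ r α)
    {q : ℝ → ℝ} (hqm : Measurable q) (hq : IntegrableOn (fun y => y * (1 - y) * q y) (Ioc 0 1)) :
    ∫ x, x * (1 - x) * q x ∂α = ∫ x, (r x + ρ) * wfGq s σ q x ∂α := by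
  have := hQ.1
  have hk : Measurable fun x => r x + ρ := hr.add_const ρ
  have hkM : ∀ x ∈ Icc (0:ℝ) 1, |r x + ρ| ≤ M + |ρ| := fun x hx =>
    (abs_add_le _ _).trans (by gcongr; exact hM x hx)
  have supp : α.restrict (Ioo 0 1) = α :=
    Measure.restrict_eq_self_of_ae_mem (mem_ae_iff.2 hQ.2.1)
  have eNu : wfNu W (fun x => r x + ρ) 1 = α := by
    have fin := wfNu_fin W hk hkM 1
    ext A hA
    rw [← ENNReal.toReal_eq_toReal_iff' (measure_ne_top _ _) (measure_ne_top _ _)]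
    have := wfNu_integral W hk hkM 1 (F := A.indicator 1) (measurable_one.indicator hA) (C := 1)
      (fun x _ => by by_cases h : x ∈ A <;> simp [h])
    rw [integral_indicator_one hA] at this
    change (wfNu W (fun x => r x + ρ) 1).real A = _
    rw [this]
    have e : ∀ t ∈ Ioc (0:ℝ) 1, ∫ ω, wfV W (fun x => r x + ρ) t ω *
        (Ioo 0 1).indicator (A.indicator 1) (W.X t ω) ∂W.P = (α A).toReal := by
      intro t ht
      rw [indicator_indicator, inter_comm, wf_alpha_K hσ hr hM hneg hQ W ht.1 hA]
    rw [setIntegral_congr_fun measurableSet_Ioc e]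
    simp
  have eLam : (wfLam W (fun x => r x + ρ) 1).restrict (Ioo 0 1) = α := by
    have fin := wfLam_fin W hk hkM zero_le_one
    ext A hA
    rw [← ENNReal.toReal_eq_toReal_iff' (measure_ne_top _ _) (measure_ne_top _ _),
      Measure.restrict_apply hA]
    have := wfLam_integral W hk 1 (F := (A ∩ Ioo 0 1).indicator 1)
      (measurable_one.indicator (hA.inter measurableSet_Ioo))
    rw [integral_indicator_one (hA.inter measurableSet_Ioo)] at this
    change (wfLam W (fun x => r x + ρ) 1).real _ = _
    rw [this, wf_alpha_K hσ hr hM hneg hQ W one_pos hA]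
  have eLam0 : wfLam W (fun x => r x + ρ) 0 = α := by
    simp [wfLam, wfV, W.initLaw]
  have h := (wf_occ_ext W hs hσ hk hkM zero_le_one hqm hq).2
  have e1 : ∫ x, wfGq s σ q x ∂(wfLam W (fun x => r x + ρ) 1) = ∫ x, wfGq s σ q x ∂α := by
    conv_rhs => rw [← eLam]
    rw [← integral_indicator measurableSet_Ioo]
    apply integral_congr_ae
    filter_upwards [wf_ae_mem (wfLam_supp W (fun x => r x + ρ) 1)] with x hx
    by_cases h : x ∈ Ioo (0:ℝ) 1
    · rw [indicator_of_mem h]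
    · rw [indicator_of_notMem h]
      rcases hx.1.eq_or_lt with e | h0'
      · rw [← e, wfGq_zero]
      · rcases hx.2.eq_or_lt with e | h1'
        · rw [e, wfGq_one]
        · exact absurd ⟨h0', h1'⟩ h
  rw [e1, eLam0, eNu] at h
  simpa using h
end alpha

section pos
variable (s σ)

/-- local representation of `wfGq` -/
lemma wf_loc (hs : 0 ≤ s) (hσ : 0 < σ) {q : ℝ → ℝ} (hqm : Measurable q)
    (hq : IntegrableOn (fun y => y * (1 - y) * q y) (Ioc 0 1)) {y0 : ℝ} (hy0 : y0 ∈ Ioo (0:ℝ) 1) :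
    ∃ D : ℝ, ∀ y ∈ Ioo (0:ℝ) 1, wfGq s σ q y = wfGq s σ q y0 + (wfS s σ y - wfS s σ y0) * D
      - ∫ z in y0..y, (wfS s σ y - wfS s σ z) * (wfm s σ z * q z) := by
  set S := wfS s σ with hS
  set m := wfm s σ with hm
  have S1 : S 1 ≠ 0 := (wfS_one_pos s σ).ne'
  have cS : Continuous S := wfS_cont s σ
  have cm : Continuous m := wfm_cont s σ
  -- integrability on compact subintervals
  have hloc : ∀ a ∈ Ioo (0:ℝ) 1, ∀ b ∈ Ioo (0:ℝ) 1, IntervalIntegrable (fun z => m z * q z) volume a b := by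
    intro a ha b hb
    have hsub : uIcc a b ⊆ Ioo 0 1 := (convex_Ioo (0:ℝ) 1).ordConnected.uIcc_subset ha hb
    have h1 : IntegrableOn (fun y => y * (1 - y) * q y) (uIcc a b) :=
      hq.mono_set (hsub.trans Ioo_subset_Ioc_self)
    rw [intervalIntegrable_iff]
    refine IntegrableOn.mono_set ?_ uIoc_subset_uIcc
    have h2 : ContinuousOn (fun z : ℝ => m z / (z * (1 - z))) (uIcc a b) := by
      refine cm.continuousOn.div (by fun_prop) fun z hz => ?_
      have := hsub hz
      exact (mul_pos this.1 (by linarith [this.2])).ne'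
    refine (h1.continuousOn_mul h2 isCompact_uIcc).congr_fun (fun z hz => ?_) measurableSet_uIcc
    have := hsub hz
    have h3 : z * (1 - z) ≠ 0 := (mul_pos this.1 (by linarith [this.2])).ne'
    beta_reduce
    rw [div_mul_eq_mul_div, div_eq_iff h3]; ring
  -- integrability of `S m q` near zero and `(S1-S) m q` near one
  have hA : ∀ b ∈ Ioo (0:ℝ) 1, IntervalIntegrable (fun z => S z * (m z * q z)) volume 0 b := by
    intro b hb
    rw [intervalIntegrable_iff, uIoc_of_le hb.1.le]
    have h1 : IntegrableOn (fun z => wfg s σ b z * m z * q z) (Ioc 0 b) := by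
      refine IntegrableOn.mono_set (t := Ioc 0 1) ?_ (Ioc_subset_Ioc_right hb.2.le)
      refine Integrable.mono' (hq.norm.const_mul (Real.exp (wfc s σ) ^ 2 * (2 / σ ^ 2))) ?_ ?_
      · have hc : Continuous fun y => wfg s σ b y := (wfg_cont s σ).comp (Continuous.prodMk_right b)
        exact ((hc.mul cm).measurable.mul hqm).aestronglyMeasurable
      · filter_upwards [ae_restrict_mem measurableSet_Ioc] with y hy
        exact wfGq_bd_aux s σ hs hσ q ⟨hb.1.le, hb.2.le⟩ ⟨hy.1.le, hy.2⟩
    have hne : S 1 - S b ≠ 0 := by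
      have := wfS_strictMono s σ hb.2
      exact (sub_pos.2 this).ne'
    refine IntegrableOn.congr_fun (h1.const_mul (S 1 / (S 1 - S b))) (fun z hz => ?_) measurableSet_Ioc
    simp only [wfg, min_eq_right hz.2, max_eq_left hz.2, ← hS]
    field_simp
  have hB : ∀ b ∈ Ioo (0:ℝ) 1, IntervalIntegrable (fun z => (S 1 - S z) * (m z * q z)) volume b 1 := by
    intro b hb
    rw [intervalIntegrable_iff, uIoc_of_le hb.2.le]
    have h1 : IntegrableOn (fun z => wfg s σ b z * m z * q z) (Ioc b 1) := by
      refine IntegrableOn.mono_set (t := Ioc 0 1) ?_ (Ioc_subset_Ioc_left hb.1.le)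
      refine Integrable.mono' (hq.norm.const_mul (Real.exp (wfc s σ) ^ 2 * (2 / σ ^ 2))) ?_ ?_
      · have hc : Continuous fun y => wfg s σ b y := (wfg_cont s σ).comp (Continuous.prodMk_right b)
        exact ((hc.mul cm).measurable.mul hqm).aestronglyMeasurable
      · filter_upwards [ae_restrict_mem measurableSet_Ioc] with y hy
        exact wfGq_bd_aux s σ hs hσ q ⟨hb.1.le, hb.2.le⟩ ⟨hy.1.le, hy.2⟩
    have hne : S b ≠ 0 := by
      have := wfS_strictMono s σ hb.1
      rw [wfS_zero] at this
      exact this.ne'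
    refine IntegrableOn.congr_fun (h1.const_mul (S 1 / S b)) (fun z hz => ?_) measurableSet_Ioc
    simp only [wfg, min_eq_left hz.1.le, max_eq_right hz.1.le, ← hS]
    field_simp
  have rep : ∀ y ∈ Ioo (0:ℝ) 1, S 1 * wfGq s σ q y = (S 1 - S y) * (∫ z in (0:ℝ)..y, S z * (m z * q z))
      + S y * ∫ z in y..1, (S 1 - S z) * (m z * q z) := by
    intro y hy
    have e1 : ∀ z ∈ Ioc 0 y, wfg s σ y z * m z * q z = (S 1 - S y) / S 1 * (S z * (m z * q z)) := by
      intro z hz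
      simp only [wfg, min_eq_right hz.2, max_eq_left hz.2, ← hS]
      field_simp
    have e2 : ∀ z ∈ Ioc y 1, wfg s σ y z * m z * q z = S y / S 1 * ((S 1 - S z) * (m z * q z)) := by
      intro z hz
      simp only [wfg, min_eq_left hz.1.le, max_eq_right hz.1.le, ← hS]
      field_simp
    have i1 := (intervalIntegrable_iff_integrableOn_Ioc_of_le hy.1.le).1 (hA y hy)
    have i2 := (intervalIntegrable_iff_integrableOn_Ioc_of_le hy.2.le).1 (hB y hy)
    unfold wfGq
    rw [← Ioc_union_Ioc_eq_Ioc hy.1.le hy.2.le, setIntegral_union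
      (Ioc_disjoint_Ioc_of_le le_rfl) measurableSet_Ioc
      (IntegrableOn.congr_fun (i1.const_mul _) (fun z hz => (e1 z hz).symm) measurableSet_Ioc)
      (IntegrableOn.congr_fun (i2.const_mul _) (fun z hz => (e2 z hz).symm) measurableSet_Ioc),
      setIntegral_congr_fun measurableSet_Ioc e1, setIntegral_congr_fun measurableSet_Ioc e2,
      integral_const_mul, integral_const_mul, intervalIntegral.integral_of_le hy.1.le,
      intervalIntegral.integral_of_le hy.2.le]
    field_simp
  refine ⟨((∫ z in y0..1, (S 1 - S z) * (m z * q z)) - ∫ z in (0:ℝ)..y0, S z * (m z * q z)) / S 1, ?_⟩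
  intro y hy
  have j1 : IntervalIntegrable (fun z => S z * (m z * q z)) volume y0 y :=
    (hloc y0 hy0 y hy).continuousOn_mul cS.continuousOn
  have j0 := hloc y0 hy0 y hy
  have a1 : ∫ z in (0:ℝ)..y, S z * (m z * q z) = (∫ z in (0:ℝ)..y0, S z * (m z * q z))
      + ∫ z in y0..y, S z * (m z * q z) :=
    (intervalIntegral.integral_add_adjacent_intervals (hA y0 hy0) j1).symm
  have j2 : IntervalIntegrable (fun z => (S 1 - S z) * (m z * q z)) volume y0 y :=
    (hloc y0 hy0 y hy).continuousOn_mul (continuous_const.sub cS).continuousOn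
  have a2 : (∫ z in y0..1, (S 1 - S z) * (m z * q z)) = (∫ z in y0..y, (S 1 - S z) * (m z * q z))
      + ∫ z in y..1, (S 1 - S z) * (m z * q z) :=
    (intervalIntegral.integral_add_adjacent_intervals j2 (hB y hy)).symm
  have a3 : ∫ z in y0..y, (S 1 - S z) * (m z * q z)
      = S 1 * (∫ z in y0..y, m z * q z) - ∫ z in y0..y, S z * (m z * q z) := by
    rw [← intervalIntegral.integral_const_mul, ← intervalIntegral.integral_sub (j0.const_mul _) j1]
    congr 1; ext z; ring
  have a4 : ∫ z in y0..y, (S y - S z) * (m z * q z)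
      = S y * (∫ z in y0..y, m z * q z) - ∫ z in y0..y, S z * (m z * q z) := by
    rw [← intervalIntegral.integral_const_mul, ← intervalIntegral.integral_sub (j0.const_mul _) j1]
    congr 1; ext z; ring
  have r1 := rep y hy
  have r0 := rep y0 hy0
  rw [a4]
  rw [a1] at r1
  rw [a2, a3] at r0 ⊢
  apply mul_left_cancel₀ S1
  rw [r1]
  clear a1 a2 a3 a4 rep
  generalize (∫ z in (0:ℝ)..y0, S z * (m z * q z)) = I1 at *
  generalize (∫ z in y0..y, S z * (m z * q z)) = I2 at *
  generalize (∫ z in y0..y, m z * q z) = I3 at *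
  generalize (∫ z in y..1, (S 1 - S z) * (m z * q z)) = I4 at *
  field_simp
  linear_combination -r0

lemma wfS_abs (hs : 0 ≤ s) {x y : ℝ} (hx : x ≤ 1) (hy : y ≤ 1) :
    |wfS s σ y - wfS s σ x| ≤ Real.exp (wfc s σ) * |y - x| := by
  have hm := (wfS_strictMono s σ).monotone
  rcases le_total x y with h | h
  · rw [abs_of_nonneg (sub_nonneg.2 (hm h)), abs_of_nonneg (sub_nonneg.2 h)]
    exact wfS_upper s σ hs h hy
  · rw [abs_sub_comm, abs_sub_comm y x, abs_of_nonneg (sub_nonneg.2 (hm h)),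
      abs_of_nonneg (sub_nonneg.2 h)]
    exact wfS_upper s σ hs h hx

lemma wf_zero_open (hs : 0 ≤ s) (hσ : 0 < σ) {q : ℝ → ℝ} (hqm : Measurable q)
    (hq : IntegrableOn (fun y => y * (1 - y) * q y) (Ioc 0 1)) {M : ℝ} (hM0 : 0 ≤ M)
    (hpos : ∀ y ∈ Icc (0:ℝ) 1, 0 ≤ wfGq s σ q y)
    (hb : ∀ y ∈ Ioo (0:ℝ) 1, |q y| * (y * (1 - y)) ≤ M * wfGq s σ q y)
    {y0 : ℝ} (hy0 : y0 ∈ Ioo (0:ℝ) 1) (h0 : wfGq s σ q y0 = 0) :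
    ∃ δ > 0, ∀ y, |y - y0| ≤ δ → y ∈ Ioo (0:ℝ) 1 ∧ wfGq s σ q y = 0 := by
  obtain ⟨D, hD⟩ := wf_loc s σ hs hσ hqm hq hy0
  have hcont := wfGq_contOn s σ hs hσ hqm hq
  set φ := wfGq s σ q with hφ
  set L := Real.exp (wfc s σ) with hL
  have hL0 : 0 < L := Real.exp_pos _
  set c0 := (y0 / 2) * ((1 - y0) / 2) with hc0
  have hy1 : 0 < 1 - y0 := by linarith [hy0.2]
  have hc0p : 0 < c0 := mul_pos (by linarith [hy0.1]) (by linarith)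
  set K := (2 / σ ^ 2) * (M / c0) with hK
  have hK0 : 0 ≤ K := by positivity
  set η := min (y0 / 2) ((1 - y0) / 2) with hη
  have hη0 : 0 < η := lt_min (by linarith [hy0.1]) (by linarith)
  have hin : ∀ y, |y - y0| ≤ η → y0 / 2 ≤ y ∧ (1 - y0) / 2 ≤ 1 - y := by
    intro y hy
    have h1 := abs_le.1 hy
    have h2 : η ≤ y0 / 2 := min_le_left _ _
    have h3 : η ≤ (1 - y0) / 2 := min_le_right _ _
    constructor <;> linarith [h1.1, h1.2]
  have hin' : ∀ y, |y - y0| ≤ η → y ∈ Ioo (0:ℝ) 1 := by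
    intro y hy
    have := hin y hy
    exact ⟨by linarith [hy0.1], by linarith⟩
  have hmq : ∀ z, |z - y0| ≤ η → |wfm s σ z * q z| ≤ K * φ z := by
    intro z hz
    have h1 := hin z hz
    have h2 := hin' z hz
    have h3 : c0 ≤ z * (1 - z) := mul_le_mul h1.1 h1.2 (by linarith) h2.1.le
    have h4 : |q z| ≤ M / c0 * φ z := by
      rw [div_mul_eq_mul_div, le_div_iff₀ hc0p]
      exact (mul_le_mul_of_nonneg_left h3 (abs_nonneg _)).trans (hb z h2)
    rw [abs_mul, abs_of_pos (wfm_pos s σ hσ z), hK, mul_assoc]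
    exact mul_le_mul (wfm_le s σ hs h2.1.le) h4 (abs_nonneg _) (by positivity)
  have hR : ∀ N, 0 ≤ N → ∀ y, |y - y0| ≤ η → (∀ z, |z - y0| ≤ |y - y0| → φ z ≤ N) →
      |∫ z in y0..y, (wfS s σ y - wfS s σ z) * (wfm s σ z * q z)| ≤ L * K * N * |y - y0| ^ 2 := by
    intro N hN y hy hz
    have := intervalIntegral.norm_integral_le_of_norm_le_const (a := y0) (b := y)
      (f := fun z => (wfS s σ y - wfS s σ z) * (wfm s σ z * q z)) (C := L * |y - y0| * (K * N)) (by
        intro z hzm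
        have hz1 : |z - y0| ≤ |y - y0| := abs_sub_left_of_mem_uIcc (uIoc_subset_uIcc hzm)
        have hz2 : |y - z| ≤ |y - y0| := by
          rw [abs_sub_comm y z, abs_sub_comm y y0]
          have := uIoc_subset_uIcc hzm
          rw [uIcc_comm] at this
          exact abs_sub_left_of_mem_uIcc this
        have hzη := hz1.trans hy
        rw [norm_mul, Real.norm_eq_abs, Real.norm_eq_abs]
        refine mul_le_mul ?_ ?_ (abs_nonneg _) (by positivity)
        · refine (wfS_abs s σ hs (hin' z hzη).2.le (hin' y hy).2.le).trans ?_
          exact mul_le_mul_of_nonneg_left hz2 hL0.le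
        · exact (hmq z hzη).trans (mul_le_mul_of_nonneg_left (hz z hz1) hK0))
    rw [Real.norm_eq_abs] at this
    refine this.trans (le_of_eq ?_)
    ring
  obtain ⟨N, hN0, hN⟩ := wf_bddOn hcont
  have hN' : ∀ z, |z - y0| ≤ η → φ z ≤ N := fun z hz =>
    (le_abs_self _).trans (hN z (Ioo_subset_Icc_self (hin' z hz)))
  -- D = 0
  have hlow : ∀ y, |y - y0| ≤ η → - (L * K * N * |y - y0| ^ 2) ≤ (wfS s σ y - wfS s σ y0) * D := by
    intro y hy
    have e := hD y (hin' y hy)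
    have p := hpos y (Ioo_subset_Icc_self (hin' y hy))
    have R := hR N hN0 y hy (fun z hz => hN' z (hz.trans hy))
    rw [h0] at e
    linarith [(abs_le.1 R).1]
  have hC0 : 0 ≤ L * K * N := by positivity
  have hDz : D = 0 := by
    by_contra hne
    set h := min η (|D| / (L * K * N + 1) / 2) with hh
    have hDp : 0 < |D| := abs_pos.2 hne
    have hhp : 0 < h := lt_min hη0 (by positivity)
    have hhη : h ≤ η := min_le_left _ _
    have hhD : L * K * N * h < |D| := by
      have h1 : h ≤ |D| / (L * K * N + 1) / 2 := min_le_right _ _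
      have h2 : h < |D| / (L * K * N + 1) := by
        have : 0 < |D| / (L * K * N + 1) := by positivity
        linarith
      rw [lt_div_iff₀ (by positivity)] at h2
      nlinarith
    rcases lt_or_gt_of_ne hne with hneg | hposD
    · have a := hlow (y0 + h) (by simpa [abs_of_pos hhp] using hhη)
      have b := wfS_lower s σ hs hy0.1.le (show y0 ≤ y0 + h by linarith)
      simp only [add_sub_cancel_left, abs_of_pos hhp] at a b
      rw [abs_of_neg hneg] at hhD
      nlinarith
    · have a := hlow (y0 - h) (by simpa [abs_of_pos hhp] using hhη)
      have hx : y0 - h ∈ Ioo (0:ℝ) 1 := hin' _ (by simpa [abs_of_pos hhp] using hhη)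
      have b := wfS_lower s σ hs hx.1.le (show y0 - h ≤ y0 by linarith)
      have e1 : |y0 - h - y0| = h := by rw [sub_sub_cancel_left, abs_neg, abs_of_pos hhp]
      rw [e1] at a
      rw [abs_of_pos hposD] at hhD
      nlinarith
  -- conclusion
  set δ := min η (1 / (2 * (L * K + 1))) with hδ
  have hδ0 : 0 < δ := lt_min hη0 (by positivity)
  have hδη : δ ≤ η := min_le_left _ _
  set δ' := min δ 1 with hδ'
  have hδ'0 : 0 < δ' := lt_min hδ0 one_pos
  have hδ'δ : δ' ≤ δ := min_le_left _ _
  have hsm : L * K * δ' ^ 2 ≤ 1 / 2 := by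
    have h1 : δ' ≤ 1 := min_le_right _ _
    have h2 : δ' ≤ 1 / (2 * (L * K + 1)) := hδ'δ.trans (min_le_right _ _)
    have hLK : 0 ≤ L * K := by positivity
    rw [le_div_iff₀ (by positivity)] at h2
    have h3 : δ' ^ 2 ≤ δ' := by nlinarith
    nlinarith
  have hsub : Icc (y0 - δ') (y0 + δ') ⊆ Icc 0 1 := by
    intro z hz
    exact Ioo_subset_Icc_self (hin' z ((abs_le.2 ⟨by linarith [hz.1], by linarith [hz.2]⟩).trans
      (hδ'δ.trans hδη)))
  obtain ⟨ym, hym, hmax⟩ := isCompact_Icc.exists_isMaxOn (s := Icc (y0 - δ') (y0 + δ'))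
    ⟨y0, by constructor <;> linarith⟩ (hcont.mono hsub)
  have hymd : |ym - y0| ≤ δ' := abs_le.2 ⟨by linarith [hym.1], by linarith [hym.2]⟩
  have hle : ∀ z, |z - y0| ≤ δ' → φ z ≤ φ ym := fun z hz => by
    have := abs_le.1 hz
    exact hmax ⟨by linarith [this.1], by linarith [this.2]⟩
  have p := hpos ym (hsub hym)
  have R := hR (φ ym) p ym (hymd.trans (hδ'δ.trans hδη)) (fun z hz => hle z (hz.trans hymd))
  have e := hD ym (hin' ym (hymd.trans (hδ'δ.trans hδη)))
  rw [h0, hDz] at e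
  have hsq : |ym - y0| ^ 2 ≤ δ' ^ 2 := pow_le_pow_left₀ (abs_nonneg _) hymd 2
  have hz : φ ym ≤ 0 := by
    have h1 : φ ym ≤ L * K * φ ym * |ym - y0| ^ 2 := by
      have := (abs_le.1 R).1
      linarith
    have h2 : L * K * φ ym * |ym - y0| ^ 2 ≤ L * K * φ ym * δ' ^ 2 :=
      mul_le_mul_of_nonneg_left hsq (by positivity)
    nlinarith
  refine ⟨δ', hδ'0, fun y hy => ⟨hin' y (hy.trans (hδ'δ.trans hδη)), ?_⟩⟩
  exact le_antisymm ((hle y hy).trans hz)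
    (hpos y (Ioo_subset_Icc_self (hin' y (hy.trans (hδ'δ.trans hδη)))))

lemma wf_dich (hs : 0 ≤ s) (hσ : 0 < σ) {q : ℝ → ℝ} (hqm : Measurable q)
    (hq : IntegrableOn (fun y => y * (1 - y) * q y) (Ioc 0 1)) {M : ℝ} (hM0 : 0 ≤ M)
    (hpos : ∀ y ∈ Icc (0:ℝ) 1, 0 ≤ wfGq s σ q y)
    (hb : ∀ y ∈ Ioo (0:ℝ) 1, |q y| * (y * (1 - y)) ≤ M * wfGq s σ q y)
    {y0 : ℝ} (hy0 : y0 ∈ Ioo (0:ℝ) 1) (h0 : wfGq s σ q y0 = 0) :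
    ∀ y ∈ Ioo (0:ℝ) 1, wfGq s σ q y = 0 := by
  have hcont := wfGq_contOn s σ hs hσ hqm hq
  set Z : Set ℝ := {y | y ∈ Ioo (0:ℝ) 1 ∧ wfGq s σ q y = 0} with hZ
  have hop : IsOpen Z := by
    rw [Metric.isOpen_iff]
    rintro y ⟨hy, hy'⟩
    obtain ⟨δ, hδ, h⟩ := wf_zero_open s σ hs hσ hqm hq hM0 hpos hb hy hy'
    exact ⟨δ, hδ, fun z hz => h z (by
      rw [Metric.mem_ball, Real.dist_eq] at hz; exact hz.le)⟩
  have hcl : closure Z ∩ Ioo 0 1 ⊆ Z := by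
    rintro y ⟨hy, hy'⟩
    obtain ⟨x, hx, hlim⟩ := mem_closure_iff_seq_limit.1 hy
    have hc : ContinuousAt (wfGq s σ q) y := hcont.continuousAt (Icc_mem_nhds hy'.1 hy'.2)
    have h1 := hc.tendsto.comp hlim
    have h2 : (wfGq s σ q ∘ x) = fun _ => 0 := funext fun n => (hx n).2
    rw [h2] at h1
    exact ⟨hy', (tendsto_nhds_unique h1 tendsto_const_nhds)⟩
  have := isPreconnected_Ioo.subset_of_closure_inter_subset (s := Ioo (0:ℝ) 1) hop
    ⟨y0, hy0, hy0, h0⟩ hcl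
  exact fun y hy => (this hy).2
end pos

section phi
variable {α : Measure ℝ} {ρ M : ℝ}

def wfPhi (s σ : ℝ) (r : ℝ → ℝ) (α : Measure ℝ) (ρ : ℝ) (y : ℝ) : ℝ :=
  ∫ x, (r x + ρ) * wfg s σ x y ∂α

lemma wfPhi_meas (s σ : ℝ) (hr : Measurable r) [IsFiniteMeasure α] :
    Measurable (wfPhi s σ r α ρ) := by
  unfold wfPhi
  refine (StronglyMeasurable.integral_prod_left (μ := α)
    (f := fun x y => (r x + ρ) * wfg s σ x y) ?_).measurable
  exact (((hr.add_const ρ).comp measurable_fst).mul (wfg_cont s σ).measurable).stronglyMeasurable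

lemma wf_qsd_supp (hQ : IsQSD s σ r α ρ) : ∀ᵐ x ∂α, x ∈ Ioo (0:ℝ) 1 := hQ.2.1

lemma wf_qsd_supp' (hQ : IsQSD s σ r α ρ) : α.restrict (Icc 0 1) = α := by
  apply Measure.restrict_eq_self_of_ae_mem
  filter_upwards [wf_qsd_supp hQ] with x hx using Ioo_subset_Icc_self hx

lemma wfPhi_cont (hs : 0 ≤ s) (hr : Measurable r)
    (hM : ∀ x ∈ Icc (0:ℝ) 1, |r x| ≤ M) (hQ : IsQSD s σ r α ρ) :
    ContinuousOn (wfPhi s σ r α ρ) (Icc 0 1) := by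
  have := hQ.1
  refine continuousOn_of_dominated (bound := fun _ => (M + |ρ|) * Real.exp (wfc s σ) ^ 2) ?_ ?_
    (integrable_const _) ?_
  · intro y _
    have hc : Continuous fun x => wfg s σ x y := (wfg_cont s σ).comp (Continuous.prodMk_left y)
    exact ((hr.add_const ρ).mul hc.measurable).aestronglyMeasurable
  · intro y hy
    filter_upwards [wf_qsd_supp hQ] with x hx
    have hx' := Ioo_subset_Icc_self hx
    rw [Real.norm_eq_abs, abs_mul]
    have h1 : |r x + ρ| ≤ M + |ρ| := (abs_add_le _ _).trans (by gcongr; exact hM x hx')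
    exact mul_le_mul h1 (wf_g_bd s σ hs hx' hy) (abs_nonneg _) ((abs_nonneg _).trans h1)
  · refine Eventually.of_forall fun x => Continuous.continuousOn ?_
    exact continuous_const.mul ((wfg_cont s σ).comp (Continuous.prodMk_right x))

lemma wf_alpha_dual (hs : 0 ≤ s) (hσ : 0 < σ) (hr : Measurable r)
    (hM : ∀ x ∈ Icc (0:ℝ) 1, |r x| ≤ M)
    (hneg : ∀ x ∈ Icc (0:ℝ) 1, r x ≤ 0) (hQ : IsQSD s σ r α ρ) (W : WFKilled s σ r α)
    {q : ℝ → ℝ} (hqm : Measurable q) (hq : IntegrableOn (fun y => y * (1 - y) * q y) (Ioc 0 1)) :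
    IntegrableOn (fun y => wfm s σ y * wfPhi s σ r α ρ y * q y) (Ioc 0 1) ∧
    ∫ x, x * (1 - x) * q x ∂α = ∫ y in Ioc (0:ℝ) 1, wfm s σ y * wfPhi s σ r α ρ y * q y := by
  have := hQ.1
  have hi := wf_fub_int s σ hs hσ (wf_qsd_supp' hQ) hqm hq
  have hi2 : Integrable (fun p : ℝ × ℝ => (r p.2 + ρ) * (wfg s σ p.2 p.1 * wfm s σ p.1 * q p.1))
      ((volume.restrict (Ioc 0 1)).prod α) := by
    refine hi.bdd_mul (c := M + |ρ|) ?_ ?_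
    · exact ((hr.add_const ρ).comp measurable_snd).aestronglyMeasurable
    · have : ∀ᵐ x ∂α, ‖r x + ρ‖ ≤ M + |ρ| := by
        filter_upwards [wf_qsd_supp hQ] with x hx
        exact (abs_add_le _ _).trans (by gcongr; exact hM x (Ioo_subset_Icc_self hx))
      exact Measure.quasiMeasurePreserving_snd.ae this
  have e : ∀ y, ∫ x, (r x + ρ) * (wfg s σ x y * wfm s σ y * q y) ∂α
      = wfm s σ y * wfPhi s σ r α ρ y * q y := by
    intro y
    rw [wfPhi, mul_comm (wfm s σ y), mul_assoc, ← integral_mul_const]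
    congr 1; ext x; ring
  constructor
  · refine hi2.integral_prod_left.congr (Eventually.of_forall fun y => ?_)
    exact e y
  · rw [wf_alpha_id hs hσ hr hM hneg hQ W hqm hq]
    have sw := integral_integral_swap
      (f := fun y x => (r x + ρ) * (wfg s σ x y * wfm s σ y * q y)) hi2
    simp only [e] at sw
    rw [sw]
    congr 1; ext x
    rw [integral_const_mul]; rfl

lemma wf_bdd_intOn {f : ℝ → ℝ} (hf : Measurable f) {C : ℝ} (hC : ∀ x ∈ Icc (0:ℝ) 1, |f x| ≤ C) :
    IntegrableOn f (Ioc 0 1) := by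
  refine Integrable.of_bound hf.aestronglyMeasurable C ?_
  filter_upwards [ae_restrict_mem measurableSet_Ioc] with x hx using hC x ⟨hx.1.le, hx.2⟩

lemma wfPhi_nonneg (hs : 0 ≤ s) (hσ : 0 < σ) (hr : Measurable r)
    (hM : ∀ x ∈ Icc (0:ℝ) 1, |r x| ≤ M)
    (hneg : ∀ x ∈ Icc (0:ℝ) 1, r x ≤ 0) (hQ : IsQSD s σ r α ρ) (W : WFKilled s σ r α) :
    ∀ y ∈ Icc (0:ℝ) 1, 0 ≤ wfPhi s σ r α ρ y := by
  have := hQ.1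
  have hmeas : Measurable (wfPhi s σ r α ρ) := wfPhi_meas s σ hr
  have key : ∀ A : Set ℝ, MeasurableSet A →
      IntegrableOn (fun y => wfm s σ y * wfPhi s σ r α ρ y * A.indicator 1 y) (Ioc 0 1) ∧
      0 ≤ ∫ y in Ioc (0:ℝ) 1, wfm s σ y * wfPhi s σ r α ρ y * A.indicator 1 y := by
    intro A hA
    have hm : Measurable (A.indicator (1 : ℝ → ℝ)) := measurable_one.indicator hA
    have hb : ∀ x, 0 ≤ A.indicator (1 : ℝ → ℝ) x ∧ A.indicator (1 : ℝ → ℝ) x ≤ 1 := by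
      intro x; by_cases h : x ∈ A <;> simp [h]
    have := wf_alpha_dual hs hσ hr hM hneg hQ W hm (wf_bdd_intOn (C := 1) (by fun_prop) (by
      intro x hx
      have h1 : 0 ≤ 1 - x := by linarith [hx.2]
      rw [abs_of_nonneg (mul_nonneg (mul_nonneg hx.1 h1) (hb x).1)]
      have := mul_le_mul (show x * (1 - x) ≤ 1 by nlinarith [hx.1]) (hb x).2 (hb x).1 zero_le_one
      linarith))
    refine ⟨this.1, ?_⟩
    rw [← this.2]
    apply integral_nonneg_of_ae
    filter_upwards [wf_qsd_supp hQ] with x hx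
    have h1 : 0 ≤ 1 - x := by linarith [hx.2]
    exact mul_nonneg (mul_nonneg hx.1.le h1) (hb x).1
  have hi : IntegrableOn (fun y => wfm s σ y * wfPhi s σ r α ρ y) (Ioc 0 1) := by
    simpa using (key univ MeasurableSet.univ).1
  have hae : 0 ≤ᵐ[volume.restrict (Ioc (0:ℝ) 1)] fun y => wfm s σ y * wfPhi s σ r α ρ y := by
    refine ae_nonneg_of_forall_setIntegral_nonneg hi fun A hA _ => ?_
    have := (key A hA).2
    rw [← integral_indicator hA]
    convert this using 2
    ext y
    by_cases h : y ∈ A <;> simp [h]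
  have hc := wfPhi_cont hs hr hM hQ
  have hioo : ∀ y ∈ Ioo (0:ℝ) 1, 0 ≤ wfPhi s σ r α ρ y := by
    intro y hy
    by_contra hlt
    push Not at hlt
    have hev : ∀ᶠ z in 𝓝 y, z ∈ Ioo (0:ℝ) 1 ∧ wfPhi s σ r α ρ z < 0 := by
      have h1 : Ioo (0:ℝ) 1 ∈ 𝓝 y := isOpen_Ioo.mem_nhds hy
      have h2 : ContinuousAt (wfPhi s σ r α ρ) y :=
        hc.continuousAt (Icc_mem_nhds hy.1 hy.2)
      exact (show ∀ᶠ z in 𝓝 y, z ∈ Ioo (0:ℝ) 1 from h1).and (h2.eventually_lt_const hlt)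
    have hz : ∀ᵐ z ∂volume, ¬ (z ∈ Ioo (0:ℝ) 1 ∧ wfPhi s σ r α ρ z < 0) := by
      have := (ae_restrict_iff' measurableSet_Ioc).1 hae
      filter_upwards [this] with z h hn
      have h3 := h ⟨hn.1.1, hn.1.2.le⟩
      have := mul_neg_of_pos_of_neg (wfm_pos s σ hσ z) hn.2
      simp only [Pi.zero_apply] at h3
      linarith
    have hpos := Measure.measure_pos_of_mem_nhds volume hev
    rw [ae_iff] at hz
    simp only [not_not] at hz
    exact hpos.ne' hz
  intro y hy
  have hcl : closure (Ioo (0:ℝ) 1) = Icc 0 1 := closure_Ioo zero_ne_one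
  have := (closure_Ioo (zero_ne_one (α := ℝ))) ▸ hy
  have hmem : Icc (0:ℝ) 1 ⊆ closure (Ioo (0:ℝ) 1) := hcl.ge
  have ht : Tendsto (wfPhi s σ r α ρ) (𝓝[Ioo 0 1] y) (𝓝 (wfPhi s σ r α ρ y)) :=
    (hc y hy).mono_left (nhdsWithin_mono _ Ioo_subset_Icc_self)
  have hne : (𝓝[Ioo (0:ℝ) 1] y).NeBot := mem_closure_iff_nhdsWithin_neBot.1 (hmem hy)
  exact ge_of_tendsto ht (eventually_nhdsWithin_of_forall hioo)

lemma wf_phi (hs : 0 ≤ s) (hσ : 0 < σ) (hr : Measurable r)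
    (hM : ∀ x ∈ Icc (0:ℝ) 1, |r x| ≤ M)
    (hneg : ∀ x ∈ Icc (0:ℝ) 1, r x ≤ 0) (hQ : IsQSD s σ r α ρ) (W : WFKilled s σ r α) :
    ∃ q : ℝ → ℝ, Measurable q ∧ IntegrableOn (fun y => y * (1 - y) * q y) (Ioc 0 1) ∧
      (∀ x ∈ Icc (0:ℝ) 1, 0 ≤ wfGq s σ q x) ∧ (∀ x ∈ Ioo (0:ℝ) 1, 0 < wfGq s σ q x) ∧
      ∀ x ∈ Icc (0:ℝ) 1, x * (1 - x) * q x = (r x + ρ) * wfGq s σ q x := by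
  have := hQ.1
  set φ := wfPhi s σ r α ρ with hφ
  have hmeas : Measurable φ := wfPhi_meas s σ hr
  have hc : ContinuousOn φ (Icc 0 1) := wfPhi_cont hs hr hM hQ
  have hφ0 : ∀ y ∈ Icc (0:ℝ) 1, 0 ≤ φ y := wfPhi_nonneg hs hσ hr hM hneg hQ W
  obtain ⟨C, hC0, hC⟩ := wf_bddOn hc
  have hkM : ∀ x ∈ Icc (0:ℝ) 1, |r x + ρ| ≤ M + |ρ| := fun x hx =>
    (abs_add_le _ _).trans (by gcongr; exact hM x hx)
  have hK0 : 0 ≤ M + |ρ| := (abs_nonneg _).trans (hkM 0 (by simp))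
  set q : ℝ → ℝ := fun x => (r x + ρ) * φ x / (x * (1 - x)) with hq
  have hqm : Measurable q := by simp only [hq]; fun_prop
  have e1 : ∀ y : ℝ, ∀ c : ℝ, |y * (1 - y) * (c / (y * (1 - y)))| ≤ |c| := by
    intro y c
    by_cases h : y * (1 - y) = 0
    · simp [h]
    · rw [mul_div_cancel₀ _ h]
  have hqi : IntegrableOn (fun y => y * (1 - y) * q y) (Ioc 0 1) := by
    refine wf_bdd_intOn (C := (M + |ρ|) * C) (by fun_prop) fun y hy => (e1 y _).trans ?_
    rw [abs_mul]
    exact mul_le_mul (hkM y hy) (hC y hy) (abs_nonneg _) hK0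
  have hG : ∀ y ∈ Icc (0:ℝ) 1, wfGq s σ q y = φ y := by
    intro y hy
    have hg : Measurable fun x => wfg s σ x y :=
      ((wfg_cont s σ).comp (Continuous.prodMk_left y)).measurable
    have d := (wf_alpha_dual hs hσ hr hM hneg hQ W
      (q := fun x => (r x + ρ) * wfg s σ x y / (x * (1 - x))) (by fun_prop)
      (wf_bdd_intOn (C := (M + |ρ|) * Real.exp (wfc s σ) ^ 2) (by fun_prop) fun x hx =>
        (e1 x _).trans (by
          rw [abs_mul]
          exact mul_le_mul (hkM x hx) (wf_g_bd s σ hs hx hy) (abs_nonneg _) hK0))).2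
    have l : ∫ x, x * (1 - x) * ((r x + ρ) * wfg s σ x y / (x * (1 - x))) ∂α = φ y := by
      apply integral_congr_ae
      filter_upwards [wf_qsd_supp hQ] with x hx
      rw [mul_div_cancel₀]
      exact mul_ne_zero hx.1.ne' (by linarith [hx.2])
    rw [← l, d, wfGq]
    congr 1; ext z
    rw [wfg_symm]; simp only [hq]; ring
  have h01 : φ 0 = 0 ∧ φ 1 = 0 := by
    rw [← hG 0 (by simp), ← hG 1 (by simp)]; exact ⟨wfGq_zero s σ q, wfGq_one s σ q⟩
  have hqe : ∀ x ∈ Icc (0:ℝ) 1, x * (1 - x) * q x = (r x + ρ) * φ x := by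
    intro x hx
    by_cases h : x * (1 - x) = 0
    · rcases mul_eq_zero.1 h with h | h
      · subst h; simp [h01.1]
      · have : x = 1 := by linarith
        subst this; simp [h01.2]
    · simp only [hq]; rw [mul_div_cancel₀ _ h]
  refine ⟨q, hqm, hqi, fun x hx => (hG x hx).symm ▸ hφ0 x hx, ?_, fun x hx => by
    rw [hG x hx]; exact hqe x hx⟩
  intro y hy
  have hy' := Ioo_subset_Icc_self hy
  by_contra hle
  have h0 : wfGq s σ q y = 0 := le_antisymm (not_lt.1 hle) ((hG y hy').symm ▸ hφ0 y hy')
  have hz := wf_dich s σ hs hσ hqm hqi hK0 (fun x hx => (hG x hx).symm ▸ hφ0 x hx) (by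
    intro z hz
    have hz' := Ioo_subset_Icc_self hz
    have hw : 0 ≤ z * (1 - z) := mul_nonneg hz.1.le (by linarith [hz.2])
    rw [← abs_of_nonneg hw, ← abs_mul, mul_comm, hqe z hz', hG z hz', abs_mul,
      abs_of_nonneg (hφ0 z hz')]
    exact mul_le_mul_of_nonneg_right (hkM z hz') (hφ0 z hz')) hy h0
  have d := (wf_alpha_dual hs hσ hr hM hneg hQ W (q := fun _ => 1) measurable_const
    (wf_bdd_intOn (C := 1) (by fun_prop) fun x hx => by
      have h1 : 0 ≤ 1 - x := by linarith [hx.2]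
      rw [mul_one, abs_of_nonneg (mul_nonneg hx.1 h1)]; nlinarith [hx.1])).2
  have hr0 : ∫ y in Ioc (0:ℝ) 1, wfm s σ y * wfPhi s σ r α ρ y * 1 = 0 := by
    refine setIntegral_eq_zero_of_forall_eq_zero fun z hz' => ?_
    have : φ z = 0 := by
      rcases hz'.2.eq_or_lt with h | h
      · rw [h]; exact h01.2
      · rw [← hG z ⟨hz'.1.le, hz'.2⟩]; exact hz z ⟨hz'.1, h⟩
    rw [← hφ, this]; simp
  rw [hr0] at d
  have hint : Integrable (fun x => x * (1 - x) * 1) α :=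
    wf_intble (C := 1) (wf_qsd_supp' hQ) (by fun_prop) fun x hx => by
      have h1 : 0 ≤ 1 - x := by linarith [hx.2]
      rw [mul_one, abs_of_nonneg (mul_nonneg hx.1 h1)]; nlinarith [hx.1]
  have h := (integral_eq_zero_iff_of_nonneg_ae (by
    filter_upwards [wf_qsd_supp hQ] with x hx
    have h1 : 0 ≤ 1 - x := by linarith [hx.2]
    simpa using mul_nonneg hx.1.le h1) hint).1 d
  have : ∀ᵐ x ∂α, False := by
    filter_upwards [h, wf_qsd_supp hQ] with x h1 hx
    have h2 : 0 < 1 - x := by linarith [hx.2]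
    have := mul_pos hx.1 h2
    simp at h1
    rcases h1 with h1 | h1 <;> linarith [hx.1]
  rw [eventually_false_iff_eq_bot, ae_eq_bot] at this
  exact (IsProbabilityMeasure.ne_zero α) this
end phi

section nub
variable {α : Measure ℝ} {ρ M : ℝ}

lemma wf_comp {f φ : ℝ → ℝ} (hf : ContinuousOn f (Icc 0 1)) (hφ : ContinuousOn φ (Icc 0 1))
    (hp : ∀ x ∈ Icc (0:ℝ) 1, 0 ≤ φ x) (hpp : ∀ x ∈ Ioo (0:ℝ) 1, 0 < φ x)
    (f0 : f 0 = 0) (f1 : f 1 = 0) :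
    ∃ A, 0 ≤ A ∧ ∀ x ∈ Icc (0:ℝ) 1, f x ≤ 1 / 2 + A * φ x := by
  obtain ⟨C, hC0, hC⟩ := wf_bddOn hf
  set K : Set ℝ := Icc (0:ℝ) 1 ∩ f ⁻¹' (Ici (1/2)) with hK
  have hKc : IsCompact K := isCompact_Icc.of_isClosed_subset
    (hf.preimage_isClosed_of_isClosed isClosed_Icc isClosed_Ici) inter_subset_left
  rcases K.eq_empty_or_nonempty with he | hne
  · refine ⟨0, le_rfl, fun x hx => ?_⟩
    by_contra h
    have : x ∈ K := ⟨hx, by simp only [mem_preimage, mem_Ici]; linarith⟩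
    simp [he] at this
  · obtain ⟨z, hz, hmin⟩ := hKc.exists_isMinOn hne (hφ.mono inter_subset_left)
    have hz' : z ∈ Ioo (0:ℝ) 1 := by
      have h2 : (1:ℝ) / 2 ≤ f z := hz.2
      refine ⟨lt_of_le_of_ne hz.1.1 ?_, lt_of_le_of_ne hz.1.2 ?_⟩
      · rintro rfl; linarith
      · rintro rfl; linarith
    have hc := hpp z hz'
    refine ⟨C / φ z, by positivity, fun x hx => ?_⟩
    by_cases h : x ∈ K
    · have h1 : φ z ≤ φ x := hmin h
      have h2 : C ≤ C / φ z * φ x := by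
        calc C = C / φ z * φ z := by field_simp
          _ ≤ _ := by gcongr
      have := (abs_le.1 (hC x hx)).2
      linarith
    · have : f x < 1 / 2 := by
        by_contra h'
        exact h ⟨hx, not_lt.1 h'⟩
      have : 0 ≤ C / φ z * φ x := mul_nonneg (by positivity) (hp x hx)
      linarith

lemma wfV_zero (W : WFKilled s σ r μ₀) (k : ℝ → ℝ) (ω : W.Ω) : wfV W k 0 ω = 1 := by
  simp [wfV]

lemma wfLam_zero_le (W : WFKilled s σ r μ₀) {k : ℝ → ℝ} (hk : Measurable k) {F : ℝ → ℝ}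
    (hF : Measurable F) {C : ℝ} (hC : ∀ x ∈ Icc (0:ℝ) 1, |F x| ≤ C) :
    ∫ x, F x ∂(wfLam W k 0) ≤ C := by
  rw [wfLam_integral W hk 0 hF]
  simp only [wfV_zero, one_mul]
  have hi : Integrable (fun ω => F (W.X 0 ω)) W.P :=
    Integrable.of_bound (hF.comp (W.measX 0)).aestronglyMeasurable C
      (Eventually.of_forall fun ω => hC _ (W.range01 0 ω))
  have := integral_mono hi (integrable_const C) fun ω => (abs_le.1 (hC _ (W.range01 0 ω))).2
  simpa using this

lemma wf_one_q : IntegrableOn (fun y : ℝ => y * (1 - y) * (1 / (y * (1 - y)))) (Ioc 0 1) := by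
  refine wf_bdd_intOn (C := 1) (by fun_prop) fun y _ => ?_
  by_cases h : y * (1 - y) = 0
  · simp [h]
  · rw [mul_one_div_cancel h]; simp

lemma wf_one_G (hσ : 0 < σ) : ∀ x ∈ Icc (0:ℝ) 1, 0 ≤ wfGq s σ (fun y => 1 / (y * (1 - y))) x := by
  intro x hx
  refine setIntegral_nonneg measurableSet_Ioc fun y hy => ?_
  have hy' : y ∈ Icc (0:ℝ) 1 := ⟨hy.1.le, hy.2⟩
  have h1 : 0 ≤ 1 - y := by linarith [hy.2]
  have := wfg_nonneg s σ hx hy'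
  have := wfm_pos s σ hσ y
  have := hy.1
  positivity

lemma wfNu_mem (W : WFKilled s σ r μ₀) (k : ℝ → ℝ) (T : ℝ) :
    ∀ᵐ x ∂(wfNu W k T), x ∈ Ioo (0:ℝ) 1 := ae_restrict_mem measurableSet_Ioo

lemma wf_one_nu (W : WFKilled s σ r μ₀) (hs : 0 ≤ s) (hσ : 0 < σ) {k : ℝ → ℝ} (hk : Measurable k)
    (hM : ∀ x ∈ Icc (0:ℝ) 1, |k x| ≤ M) {T : ℝ} (hT : 0 ≤ T) {C : ℝ}
    (hC : ∀ x ∈ Icc (0:ℝ) 1, |wfGq s σ (fun y => 1 / (y * (1 - y))) x| ≤ C) :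
    (wfNu W k T).real univ ≤ C
      + ∫ x, k x * wfGq s σ (fun y => 1 / (y * (1 - y))) x ∂(wfNu W k T) := by
  have hqm : Measurable fun y : ℝ => 1 / (y * (1 - y)) := by fun_prop
  have e := (wf_occ_ext W hs hσ hk hM hT hqm wf_one_q).2
  have l : ∫ x, x * (1 - x) * (1 / (x * (1 - x))) ∂(wfNu W k T) = (wfNu W k T).real univ := by
    have : ∫ x, x * (1 - x) * (1 / (x * (1 - x))) ∂(wfNu W k T) = ∫ x, (1:ℝ) ∂(wfNu W k T) := by
      apply integral_congr_ae
      filter_upwards [wfNu_mem W k T] with x hx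
      rw [mul_one_div_cancel]
      exact mul_ne_zero hx.1.ne' (by linarith [hx.2])
    rw [this]; simp
  rw [l] at e
  have h0 := wfLam_zero_le W hk (wfGq_meas s σ hqm) hC
  have hT' : 0 ≤ ∫ x, wfGq s σ (fun y => 1 / (y * (1 - y))) x ∂(wfLam W k T) := by
    apply integral_nonneg_of_ae
    filter_upwards [wf_ae_mem (wfLam_supp W k T)] with x hx using wf_one_G hσ x hx
  linarith

lemma wf_nu_bound (hs : 0 ≤ s) (hσ : 0 < σ) (hr : Measurable r)
    (hM : ∀ x ∈ Icc (0:ℝ) 1, |r x| ≤ M)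
    (hneg : ∀ x ∈ Icc (0:ℝ) 1, r x ≤ 0) (hQ : IsQSD s σ r α ρ) (W₀ : WFKilled s σ r α)
    (hρ : -r 0 < ρ) :
    ∃ C, 0 ≤ C ∧ ∀ μ : Measure ℝ, ∀ W : WFKilled s σ r μ, ∀ T, 0 ≤ T →
      (wfNu W (fun x => r x + -r 0) T).real univ ≤ C := by
  obtain ⟨q, hqm, hqi, hp, hpp, hqe⟩ := wf_phi hs hσ hr hM hneg hQ W₀
  set φ := wfGq s σ q with hφ
  have hφc : ContinuousOn φ (Icc 0 1) := wfGq_contOn s σ hs hσ hqm hqi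
  have hφm : Measurable φ := wfGq_meas s σ hqm
  set q1 : ℝ → ℝ := fun y => 1 / (y * (1 - y)) with hq1
  have hq1m : Measurable q1 := by simp only [hq1]; fun_prop
  set g := wfGq s σ q1 with hg
  have hgc : ContinuousOn g (Icc 0 1) := wfGq_contOn s σ hs hσ hq1m wf_one_q
  have hgm : Measurable g := wfGq_meas s σ hq1m
  have hg0 : ∀ x ∈ Icc (0:ℝ) 1, 0 ≤ g x := wf_one_G hσ
  obtain ⟨Cφ, hCφ0, hCφ⟩ := wf_bddOn hφc
  obtain ⟨Cg, hCg0, hCg⟩ := wf_bddOn hgc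
  obtain ⟨A, hA0, hA⟩ := wf_comp (f := fun x => (-r 0) * g x) (continuousOn_const.mul hgc) hφc hp hpp
    (by simp [hg, wfGq_zero]) (by simp [hg, wfGq_one])
  have hr0 : 0 ≤ -r 0 := by linarith [hneg 0 (by simp)]
  refine ⟨2 * (Cg + A * (Cφ / (ρ - -r 0))), ?_, ?_⟩
  · have : 0 < ρ - -r 0 := by linarith
    positivity
  intro μ W T hT
  set k : ℝ → ℝ := fun x => r x + -r 0 with hk'
  have hk : Measurable k := hr.add_const _
  have hkM : ∀ x ∈ Icc (0:ℝ) 1, |k x| ≤ M + |-r 0| := fun x hx =>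
    (abs_add_le _ _).trans (by gcongr; exact hM x hx)
  have fin := wfNu_fin W hk hkM T
  have supp := wfNu_supp W k T
  set ν := wfNu W k T with hν
  have hφi : Integrable φ ν := wf_intble supp hφm hCφ
  have hkK : 0 ≤ M + |-r 0| := (abs_nonneg _).trans (hkM 0 (by simp))
  have hkφi : Integrable (fun x => k x * φ x) ν :=
    wf_intble (C := (M + |-r 0|) * Cφ) supp (hk.mul hφm) fun x hx => by
      rw [abs_mul]; exact mul_le_mul (hkM x hx) (hCφ x hx) (abs_nonneg _) hkK
  have hkgi : Integrable (fun x => k x * g x) ν :=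
    wf_intble (C := (M + |-r 0|) * Cg) supp (hk.mul hgm) fun x hx => by
      rw [abs_mul]; exact mul_le_mul (hkM x hx) (hCg x hx) (abs_nonneg _) hkK
  have e := (wf_occ_ext W hs hσ hk hkM hT hqm hqi).2
  have el : ∫ x, x * (1 - x) * q x ∂ν = ∫ x, k x * φ x ∂ν + (ρ - -r 0) * ∫ x, φ x ∂ν := by
    rw [← integral_const_mul, ← integral_add hkφi (hφi.const_mul _)]
    apply integral_congr_ae
    filter_upwards [wf_ae_mem supp] with x hx
    rw [hqe x hx]; simp only [hk']; ring
  rw [← hν, el] at e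
  have h0 := wfLam_zero_le W hk hφm hCφ
  have hT' : 0 ≤ ∫ x, φ x ∂(wfLam W k T) := by
    apply integral_nonneg_of_ae
    filter_upwards [wf_ae_mem (wfLam_supp W k T)] with x hx using hp x hx
  have hρ' : 0 < ρ - -r 0 := by linarith
  have hφν : ∫ x, φ x ∂ν ≤ Cφ / (ρ - -r 0) := by
    rw [le_div_iff₀ hρ']; linarith
  have h1 := wf_one_nu W hs hσ hk hkM hT hCg
  have h2 : ∫ x, k x * g x ∂ν ≤ ∫ x, (1 / 2 + A * φ x) ∂ν := by
    apply integral_mono_ae hkgi ((integrable_const _).add (hφi.const_mul A))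
    filter_upwards [wf_ae_mem supp] with x hx
    have := hA x hx
    have h3 : r x * g x ≤ 0 := mul_nonpos_of_nonpos_of_nonneg (hneg x hx) (hg0 x hx)
    have h5 : k x * g x = r x * g x + -r 0 * g x := by simp only [hk']; ring
    change k x * g x ≤ 1 / 2 + A * φ x
    linarith
  rw [integral_add (integrable_const _) (hφi.const_mul A), integral_const_mul, integral_const,
    smul_eq_mul] at h2
  have h4 := mul_le_mul_of_nonneg_left hφν hA0
  rw [← hν] at h1
  linarith
end nub

section upper
variable {α : Measure ℝ} {ρ M : ℝ}

lemma wfV_anti (W : WFKilled s σ r μ₀) (hr : Measurable r)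
    (hM : ∀ x ∈ Icc (0:ℝ) 1, |r x| ≤ M) (hneg : ∀ x ∈ Icc (0:ℝ) 1, r x ≤ 0) {t T : ℝ}
    (htT : t ≤ T) (ω : W.Ω) : wfV W r T ω ≤ wfV W r t ω := by
  refine Real.exp_le_exp.2 ?_
  have hi : ∀ T : ℝ, IntegrableOn (fun u => -r (W.X u ω)) (Ioc 0 T) := fun T =>
    Integrable.of_bound (hr.comp (W.contX ω).measurable).neg.aestronglyMeasurable M
      (Eventually.of_forall fun u => by rw [norm_neg]; exact hM _ (W.range01 u ω))
  have := setIntegral_mono_set (s := Ioc 0 t) (hi T) (Eventually.of_forall fun u => by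
    have := hneg _ (W.range01 u ω); simp only [Pi.zero_apply]; linarith)
    (Eventually.of_forall (show Ioc 0 t ⊆ Ioc 0 T from fun u hu => ⟨hu.1, hu.2.trans htT⟩))
  rw [integral_neg, integral_neg] at this
  linarith

lemma wf_abs_ind (W : WFKilled s σ r μ₀) (hσ : 0 < σ) :
    ∀ᵐ ω ∂W.P, ∀ u t : ℝ, 0 ≤ u → u ≤ t →
      (Ioo (0:ℝ) 1).indicator (1 : ℝ → ℝ) (W.X t ω) ≤ (Ioo (0:ℝ) 1).indicator 1 (W.X u ω) := by
  filter_upwards [wf_abs_all W hσ] with ω h u t hu hut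
  by_cases hx : W.X t ω ∈ Ioo (0:ℝ) 1
  · have : W.X u ω ∈ Ioo (0:ℝ) 1 := by
      have hm := W.range01 u ω
      refine ⟨lt_of_le_of_ne hm.1 fun h' => ?_, lt_of_le_of_ne hm.2 fun h' => ?_⟩
      · exact hx.1.ne' ((h u t hu hut).1 h'.symm)
      · exact hx.2.ne ((h u t hu hut).2 h')
    simp [hx, this]
  · rw [indicator_of_notMem hx]
    exact indicator_nonneg (fun _ _ => zero_le_one) _

lemma wf_ind_bd (A : Set ℝ) (x : ℝ) :
    0 ≤ A.indicator (1 : ℝ → ℝ) x ∧ A.indicator (1 : ℝ → ℝ) x ≤ 1 := by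
  by_cases h : x ∈ A <;> simp [h]

lemma wfV_ind_le (W : WFKilled s σ r μ₀) {k : ℝ → ℝ} (hk : Measurable k)
    (hM : ∀ x ∈ Icc (0:ℝ) 1, |k x| ≤ M) {t T : ℝ} (ht : 0 ≤ t) (htT : t ≤ T) (ω : W.Ω) (A : Set ℝ)
    (x : ℝ) : |wfV W k t ω * A.indicator 1 x| ≤ Real.exp (M * T) := by
  rw [abs_mul, abs_of_nonneg (wf_ind_bd A x).1]
  have := mul_le_mul (wfV_le' W hk hM ht htT ω) (wf_ind_bd A x).2 (wf_ind_bd A x).1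
    (Real.exp_pos _).le
  linarith

lemma wfV_ind_int (W : WFKilled s σ r μ₀) {k : ℝ → ℝ} (hk : Measurable k)
    (hM : ∀ x ∈ Icc (0:ℝ) 1, |k x| ≤ M) {t : ℝ} (ht : 0 ≤ t) {A : Set ℝ} (hA : MeasurableSet A)
    (u : ℝ) : Integrable (fun ω => wfV W k t ω * A.indicator 1 (W.X u ω)) W.P :=
  wf_int_bdd W _ _ ((wfV_meas W hk t).mul ((measurable_one.indicator hA).comp (W.measX u)))
    fun ω => wfV_ind_le W hk hM ht le_rfl ω A _

lemma wfNu_univ (W : WFKilled s σ r μ₀) {k : ℝ → ℝ} (hk : Measurable k)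
    (hM : ∀ x ∈ Icc (0:ℝ) 1, |k x| ≤ M) (T : ℝ) :
    IntegrableOn (fun t => ∫ ω, wfV W k t ω * (Ioo 0 1).indicator 1 (W.X t ω) ∂W.P) (Ioc 0 T) ∧
    (wfNu W k T).real univ
      = ∫ t in Ioc 0 T, ∫ ω, wfV W k t ω * (Ioo 0 1).indicator 1 (W.X t ω) ∂W.P := by
  constructor
  · refine (wf_int_prod W T (Real.exp (M * T))
      (fun p => wfV W k p.1 p.2 * (Ioo 0 1).indicator 1 (W.X p.1 p.2)) ?_ ?_).integral_prod_left
    · exact (wfV_unc W hk hM).mul ((measurable_one.indicator measurableSet_Ioo).comp (wfX_unc W))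
    · exact fun t ω h0 hT => wfV_ind_le W hk hM h0.le hT ω _ _
  · rw [← wfNu_integral W hk hM T (F := 1) measurable_one (C := 1) (by simp)]
    simp

lemma wf_upper_in (W : WFKilled s σ r μ₀) (hσ : 0 < σ) (hr : Measurable r)
    (hM : ∀ x ∈ Icc (0:ℝ) 1, |r x| ≤ M) (hneg : ∀ x ∈ Icc (0:ℝ) 1, r x ≤ 0) {C : ℝ} (hC0 : 0 ≤ C)
    (hC : ∀ T, 0 ≤ T → (wfNu W (fun x => r x + -r 0) T).real univ ≤ C) {T : ℝ} (hT : 0 ≤ T) :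
    ∫ ω, wfV W (fun x => r x + -r 0) T ω * (Ioo 0 1).indicator 1 (W.X T ω) ∂W.P
      ≤ Real.exp (-r 0) * (1 + C) := by
  set k : ℝ → ℝ := fun x => r x + -r 0 with hk'
  have hk : Measurable k := hr.add_const _
  have hkM : ∀ x ∈ Icc (0:ℝ) 1, |k x| ≤ M + |-r 0| := fun x hx =>
    (abs_add_le _ _).trans (by gcongr; exact hM x hx)
  have hr0 : 0 ≤ -r 0 := by linarith [hneg 0 (by simp)]
  have hV : ∀ t, 0 ≤ t → ∀ ω, wfV W k t ω = Real.exp (-r 0 * t) * wfV W r t ω := fun t ht ω =>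
    wfV_add_const W hr hM _ ht ω
  rcases lt_or_ge T 1 with h1 | h1
  · have : ∀ ω, wfV W k T ω * (Ioo 0 1).indicator 1 (W.X T ω) ≤ Real.exp (-r 0) := by
      intro ω
      have h2 : wfV W r T ω ≤ 1 := by
        have := wfV_anti W hr hM hneg hT ω
        rwa [wfV_zero] at this
      have h3 : wfV W k T ω ≤ Real.exp (-r 0) := by
        rw [hV T hT]
        have : Real.exp (-r 0 * T) ≤ Real.exp (-r 0) := Real.exp_le_exp.2 (by nlinarith)
        have := mul_le_mul this h2 (wfV_pos W r T ω).le (Real.exp_pos _).le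
        linarith
      have := mul_le_mul h3 (wf_ind_bd (Ioo 0 1) (W.X T ω)).2 (wf_ind_bd _ _).1 (Real.exp_pos _).le
      linarith
    have := integral_mono (wfV_ind_int W hk hkM hT measurableSet_Ioo T) (integrable_const _) this
    simp only [integral_const, probReal_univ, one_smul] at this
    nlinarith [Real.exp_pos (-r 0), mul_nonneg (Real.exp_pos (-r 0)).le hC0]
  · obtain ⟨hint, hu⟩ := wfNu_univ W hk hkM T
    set m : ℝ → ℝ := fun t => ∫ ω, wfV W k t ω * (Ioo 0 1).indicator 1 (W.X t ω) ∂W.P with hm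
    have hm0 : ∀ t, 0 ≤ m t := fun t =>
      integral_nonneg fun ω => mul_nonneg (wfV_pos W k t ω).le (wf_ind_bd _ _).1
    have hmono : ∀ t ∈ Ioc (T - 1) T, m T ≤ Real.exp (-r 0) * m t := by
      intro t ht
      have ht0 : 0 ≤ t := by linarith [ht.1]
      simp only [hm]
      rw [← integral_const_mul]
      apply integral_mono_ae (wfV_ind_int W hk hkM hT measurableSet_Ioo T)
        ((wfV_ind_int W hk hkM ht0 measurableSet_Ioo t).const_mul _)
      filter_upwards [wf_abs_ind W hσ] with ω hω
      have a := hω t T ht0 ht.2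
      have b : wfV W k T ω ≤ Real.exp (-r 0) * wfV W k t ω := by
        rw [hV T hT, hV t ht0, ← mul_assoc, ← Real.exp_add]
        refine mul_le_mul (Real.exp_le_exp.2 ?_) (wfV_anti W hr hM hneg ht.2 ω)
          (wfV_pos W r T ω).le (Real.exp_pos _).le
        nlinarith [ht.1]
      have := mul_le_mul b a (wf_ind_bd _ _).1
        (mul_nonneg (Real.exp_pos _).le (wfV_pos W k t ω).le)
      linarith
    have hsub : Ioc (T - 1) T ⊆ Ioc 0 T := Ioc_subset_Ioc_left (by linarith)
    have h2 : ∫ t in Ioc (T - 1) T, m T ≤ ∫ t in Ioc (T - 1) T, Real.exp (-r 0) * m t :=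
      setIntegral_mono_on (integrable_const _) ((hint.mono_set hsub).const_mul _) measurableSet_Ioc
        hmono
    have h3 : ∫ t in Ioc (T - 1) T, m t ≤ ∫ t in Ioc 0 T, m t :=
      setIntegral_mono_set (s := Ioc (T - 1) T) hint (Eventually.of_forall hm0) (Eventually.of_forall hsub)
    rw [integral_const_mul] at h2
    simp at h2
    have h4 := hC T hT
    rw [hu] at h4
    have := mul_le_mul_of_nonneg_left (h3.trans h4) (Real.exp_pos (-r 0)).le
    have := (Real.exp_pos (-r 0))
    linarith

lemma wf_upper (hs : 0 ≤ s) (hσ : 0 < σ) (hr : Measurable r)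
    (hM : ∀ x ∈ Icc (0:ℝ) 1, |r x| ≤ M)
    (hneg : ∀ x ∈ Icc (0:ℝ) 1, r x ≤ 0) (hQ : IsQSD s σ r α ρ) (W₀ : WFKilled s σ r α)
    (hρ : -r 0 < ρ) :
    ∃ C, 0 ≤ C ∧ ∀ μ : Measure ℝ, ∀ W : WFKilled s σ r μ, ∀ T, 0 ≤ T →
      ∫ ω, wfV W r T ω * ({1}ᶜ : Set ℝ).indicator 1 (W.X T ω) ∂W.P ≤ C * Real.exp (r 0 * T) := by
  obtain ⟨C, hC0, hC⟩ := wf_nu_bound hs hσ hr hM hneg hQ W₀ hρ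
  have hM0 : 0 ≤ M := (abs_nonneg _).trans (hM 0 (by simp))
  refine ⟨Real.exp (-r 0) * (1 + C) + (1 + (M + |-r 0|) * C), by positivity, ?_⟩
  intro μ W T hT
  have hin := wf_upper_in W hσ hr hM hneg hC0 (hC μ W) hT
  set k : ℝ → ℝ := fun x => r x + -r 0 with hk'
  have hk : Measurable k := hr.add_const _
  have hkM : ∀ x ∈ Icc (0:ℝ) 1, |k x| ≤ M + |-r 0| := fun x hx =>
    (abs_add_le _ _).trans (by gcongr; exact hM x hx)
  have hkK : 0 ≤ M + |-r 0| := by positivity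
  set f : ℝ → ℝ := fun x => 1 - wfh s σ x with hf
  have hfc : ContDiff ℝ 2 f := contDiff_const.sub (wfh_spec s σ hσ).1
  have hfm : Measurable f := hfc.continuous.measurable
  have hf01 : ∀ x ∈ Icc (0:ℝ) 1, 0 ≤ f x ∧ f x ≤ 1 := fun x hx => by
    have := wfh_mem s σ hx; simp only [hf]; constructor <;> linarith [this.1, this.2]
  have hfa : ∀ x ∈ Icc (0:ℝ) 1, |f x| ≤ 1 := fun x hx => by
    rw [abs_of_nonneg (hf01 x hx).1]; exact (hf01 x hx).2
  have hL : ∀ x, LWF s σ f x = 0 := by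
    intro x
    have e := (wfh_spec s σ hσ).2 x
    have d1 : deriv f = fun x => -deriv (wfh s σ) x := by
      ext z; simp only [hf]; rw [deriv_const_sub]
    have d2 : deriv (deriv f) x = -deriv (deriv (wfh s σ)) x := by
      rw [d1, deriv.fun_neg]
    unfold LWF at e ⊢
    rw [d2, d1]
    linarith
  have e := wf_ito W hk hkM hfc hT
  simp only [hL, zero_add] at e
  have hkf : ∀ x ∈ Icc (0:ℝ) 1, |k x * f x| ≤ M + |-r 0| := fun x hx => by
    rw [abs_mul]
    have := mul_le_mul (hkM x hx) (hfa x hx) (abs_nonneg _) hkK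
    linarith
  rw [← wfNu_integral' W hk hkM T (F := fun x => k x * f x) (hk.mul hfm) hkf (by simp [hk'])
    (by simp [hf, wfh_one])] at e
  have fin := wfNu_fin W hk hkM T
  have h1 : ∫ x, k x * f x ∂(wfNu W k T) ≤ (M + |-r 0|) * C := by
    have : ∫ x, k x * f x ∂(wfNu W k T) ≤ ∫ x, (M + |-r 0|) ∂(wfNu W k T) := by
      apply integral_mono_ae (wf_intble (wfNu_supp W k T) (hk.mul hfm) hkf) (integrable_const _)
      filter_upwards [wf_ae_mem (wfNu_supp W k T)] with x hx using (abs_le.1 (hkf x hx)).2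
    rw [integral_const, smul_eq_mul] at this
    have h2 := mul_le_mul_of_nonneg_left (hC μ W T hT) hkK
    linarith
  have h0 : ∫ ω, f (W.X 0 ω) ∂W.P ≤ 1 := by
    have := integral_mono (wf_int_bdd W 1 (fun ω => f (W.X 0 ω)) (hfm.comp (W.measX 0))
      fun ω => hfa _ (W.range01 0 ω)) (integrable_const 1) fun ω => (hf01 _ (W.range01 0 ω)).2
    simpa using this
  have hVf : Integrable (fun ω => wfV W k T ω * f (W.X T ω)) W.P :=
    wf_int_bdd W (Real.exp ((M + |-r 0|) * T)) _
      ((wfV_meas W hk T).mul (hfm.comp (W.measX T))) fun ω => by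
      rw [abs_mul]
      have := mul_le_mul (wfV_le W hk hkM hT ω) (hfa _ (W.range01 T ω)) (abs_nonneg _)
        (Real.exp_pos _).le
      linarith
  have hsum : ∫ ω, wfV W k T ω * ({1}ᶜ : Set ℝ).indicator 1 (W.X T ω) ∂W.P
      ≤ ∫ ω, (wfV W k T ω * (Ioo 0 1).indicator 1 (W.X T ω) + wfV W k T ω * f (W.X T ω)) ∂W.P := by
    apply integral_mono (wfV_ind_int W hk hkM hT (measurableSet_singleton _).compl T)
      ((wfV_ind_int W hk hkM hT measurableSet_Ioo T).add hVf)
    intro ω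
    change wfV W k T ω * ({1}ᶜ : Set ℝ).indicator 1 (W.X T ω)
      ≤ wfV W k T ω * (Ioo 0 1).indicator 1 (W.X T ω) + wfV W k T ω * f (W.X T ω)
    rw [← mul_add]
    refine mul_le_mul_of_nonneg_left ?_ (wfV_pos W k T ω).le
    have hx := W.range01 T ω
    have hf0 := hf01 _ hx
    have hi := wf_ind_bd (Ioo 0 1) (W.X T ω)
    have hi2 := wf_ind_bd {1}ᶜ (W.X T ω)
    rcases hx.1.eq_or_lt with h | h
    · have : f (W.X T ω) = 1 := by rw [← h]; simp [hf, wfh_zero]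
      linarith
    · rcases hx.2.eq_or_lt with h' | h'
      · have : ({1}ᶜ : Set ℝ).indicator (1 : ℝ → ℝ) (W.X T ω) = 0 := by rw [h']; simp
        linarith
      · have : (Ioo (0:ℝ) 1).indicator (1 : ℝ → ℝ) (W.X T ω) = 1 := by
          exact indicator_of_mem (show W.X T ω ∈ Ioo (0:ℝ) 1 from ⟨h, h'⟩) _
        linarith
  rw [integral_add (wfV_ind_int W hk hkM hT measurableSet_Ioo T) hVf] at hsum
  have hfin : ∫ ω, wfV W k T ω * ({1}ᶜ : Set ℝ).indicator 1 (W.X T ω) ∂W.P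
      = Real.exp (-r 0 * T) * ∫ ω, wfV W r T ω * ({1}ᶜ : Set ℝ).indicator 1 (W.X T ω) ∂W.P := by
    rw [← integral_const_mul]
    congr 1; ext ω
    rw [wfV_add_const W hr hM _ hT ω]; ring
  rw [hfin] at hsum
  have hE : Real.exp (r 0 * T) * Real.exp (-r 0 * T) = 1 := by
    rw [← Real.exp_add]; simp
  set Z := ∫ ω, wfV W r T ω * ({1}ᶜ : Set ℝ).indicator 1 (W.X T ω) ∂W.P
  have h5 : Real.exp (-r 0 * T) * Z
      ≤ Real.exp (-r 0) * (1 + C) + (1 + (M + |-r 0|) * C) := by linarith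
  have h6 := mul_le_mul_of_nonneg_left h5 (Real.exp_pos (r 0 * T)).le
  rw [← mul_assoc, hE, one_mul] at h6
  linarith
end upper

section lower
variable {M : ℝ}

lemma wf_lower (hs : 0 ≤ s) (hσ : 0 < σ) (hr : Measurable r)
    (hM : ∀ x ∈ Icc (0:ℝ) 1, |r x| ≤ M) (hneg : ∀ x ∈ Icc (0:ℝ) 1, r x ≤ 0)
    (n : ℕ) (hn : 1 ≤ n) {ξ : ℝ} (hξ : 0 < ξ) :
    ∃ c, 0 < c ∧ ∀ μ : Measure ℝ, IsProbabilityMeasure μ →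
      ENNReal.ofReal ξ ≤ μ (Icc (1/(n:ℝ)) 1) → ∀ W : WFKilled s σ r μ, ∀ T, 0 ≤ T →
      c * Real.exp (r 1 * T) ≤ ∫ ω, wfV W r T ω ∂W.P := by
  have hn0 : (0:ℝ) < n := by exact_mod_cast hn
  have hn1 : (0:ℝ) < 1 / n := by positivity
  have hM0 : 0 ≤ M := (abs_nonneg _).trans (hM 0 (by simp))
  have hhp : 0 < wfh s σ (1 / n) := by
    have := wfh_strictMono s σ hn1; rwa [wfh_zero] at this
  have hhc : Continuous (wfh s σ) := (wfh_spec s σ hσ).1.continuous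
  set q1 : ℝ → ℝ := fun y => 1 / (y * (1 - y)) with hq1
  have hq1m : Measurable q1 := by simp only [hq1]; fun_prop
  obtain ⟨C, hC0, hC⟩ := wf_bddOn (wfGq_contOn s σ hs hσ hq1m wf_one_q)
  set p := wfh s σ (1 / n) * ξ with hp
  have hp0 : 0 < p := mul_pos hhp hξ
  set T₀ := 2 * (C + 1) / p with hT₀
  have hT0 : 0 < T₀ := by positivity
  refine ⟨Real.exp (-(M * T₀)) * (p / 2), by positivity, ?_⟩
  intro μ hμ hμξ W T hT
  -- starting mass
  have hi0 : ∀ t, Integrable (fun ω => wfh s σ (W.X t ω)) W.P := fun t => (wfh_mart W hσ).integrable t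
  have hstart : p ≤ ∫ ω, wfh s σ (W.X 0 ω) ∂W.P := by
    have hmass : ξ ≤ ∫ ω, (Icc (1/(n:ℝ)) 1).indicator 1 (W.X 0 ω) ∂W.P := by
      have e : ∫ ω, (Icc (1/(n:ℝ)) 1).indicator (1 : ℝ → ℝ) (W.X 0 ω) ∂W.P
          = (μ (Icc (1/(n:ℝ)) 1)).toReal := by
        rw [← integral_map (f := (Icc (1/(n:ℝ)) 1).indicator (1 : ℝ → ℝ)) (W.measX 0).aemeasurable
          (measurable_one.indicator measurableSet_Icc).aestronglyMeasurable, W.initLaw,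
          integral_indicator_one measurableSet_Icc]; rfl
      rw [e]
      exact (ENNReal.ofReal_le_iff_le_toReal (measure_ne_top _ _)).1 hμξ
    have hle : ∫ ω, wfh s σ (1 / n) * (Icc (1/(n:ℝ)) 1).indicator 1 (W.X 0 ω) ∂W.P
        ≤ ∫ ω, wfh s σ (W.X 0 ω) ∂W.P := by
      refine integral_mono (Integrable.const_mul (wf_int_bdd W 1 _
        ((measurable_one.indicator measurableSet_Icc).comp (W.measX 0)) fun ω => ?_) _) (hi0 0) ?_
      · have := wf_ind_bd (Icc (1/(n:ℝ)) 1) (W.X 0 ω)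
        simp only [Function.comp]
        rw [abs_of_nonneg this.1]; exact this.2
      · intro ω
        change wfh s σ (1 / n) * (Icc (1/(n:ℝ)) 1).indicator 1 (W.X 0 ω) ≤ wfh s σ (W.X 0 ω)
        by_cases h : W.X 0 ω ∈ Icc (1/(n:ℝ)) 1
        · rw [indicator_of_mem h]
          simpa using (wfh_strictMono s σ).monotone h.1
        · rw [indicator_of_notMem h, mul_zero]
          exact (wfh_mem s σ (W.range01 0 ω)).1
    rw [integral_const_mul] at hle
    have := mul_le_mul_of_nonneg_left hmass hhp.le
    linarith
  have hmart : ∫ ω, wfh s σ (W.X T₀ ω) ∂W.P = ∫ ω, wfh s σ (W.X 0 ω) ∂W.P := by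
    have := (wfh_mart W hσ).setIntegral_eq hT0.le (s := univ) MeasurableSet.univ
    simpa using this.symm
  -- occupation of the interior
  have hin : ∫ ω, (Ioo (0:ℝ) 1).indicator 1 (W.X T₀ ω) ∂W.P ≤ p / 2 := by
    have hk : Measurable fun _ : ℝ => (0:ℝ) := measurable_const
    have hkM : ∀ x ∈ Icc (0:ℝ) 1, |(fun _ : ℝ => (0:ℝ)) x| ≤ 0 := by simp
    have h1 := wf_one_nu W hs hσ hk hkM hT0.le hC
    obtain ⟨hint, hu⟩ := wfNu_univ W hk hkM T₀
    have hV : ∀ t ω, wfV W (fun _ => 0) t ω = 1 := by intro t ω; simp [wfV]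
    simp only [hV, one_mul] at hu hint
    simp only [zero_mul, integral_zero, add_zero] at h1
    rw [hu] at h1
    have hind : ∀ t, Integrable (fun ω => (Ioo (0:ℝ) 1).indicator (1 : ℝ → ℝ) (W.X t ω)) W.P := by
      intro t
      refine wf_int_bdd W 1 _ ((measurable_one.indicator measurableSet_Ioo).comp (W.measX t))
        fun ω => ?_
      have := wf_ind_bd (Ioo (0:ℝ) 1) (W.X t ω)
      rw [abs_of_nonneg this.1]; exact this.2
    have h2 : ∫ t in Ioc 0 T₀, ∫ ω, (Ioo (0:ℝ) 1).indicator (1 : ℝ → ℝ) (W.X T₀ ω) ∂W.P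
        ≤ ∫ t in Ioc 0 T₀, ∫ ω, (Ioo (0:ℝ) 1).indicator (1 : ℝ → ℝ) (W.X t ω) ∂W.P := by
      refine setIntegral_mono_on (integrable_const _) hint measurableSet_Ioc fun t ht => ?_
      apply integral_mono_ae (hind T₀) (hind t)
      filter_upwards [wf_abs_ind W hσ] with ω hω using hω t T₀ ht.1.le ht.2
    rw [integral_const] at h2
    simp [hT0.le] at h2
    have h3 : T₀ * (p / 2) = C + 1 := by rw [hT₀]; field_simp
    by_contra hlt
    push Not at hlt
    have := mul_lt_mul_of_pos_left hlt hT0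
    linarith
  have hone : p / 2 ≤ ∫ ω, ({1} : Set ℝ).indicator 1 (W.X T₀ ω) ∂W.P := by
    have hind : ∀ A : Set ℝ, MeasurableSet A →
        Integrable (fun ω => A.indicator (1 : ℝ → ℝ) (W.X T₀ ω)) W.P := by
      intro A hA
      refine wf_int_bdd W 1 _ ((measurable_one.indicator hA).comp (W.measX T₀)) fun ω => ?_
      have := wf_ind_bd A (W.X T₀ ω)
      rw [abs_of_nonneg this.1]; exact this.2
    have := integral_mono (hi0 T₀) ((hind _ (measurableSet_singleton (1:ℝ))).add
      (hind (Ioo 0 1) measurableSet_Ioo)) (by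
      intro ω
      change wfh s σ (W.X T₀ ω) ≤ ({1} : Set ℝ).indicator (1 : ℝ → ℝ) (W.X T₀ ω)
        + (Ioo (0:ℝ) 1).indicator (1 : ℝ → ℝ) (W.X T₀ ω)
      have hx := W.range01 T₀ ω
      have h1 := wf_ind_bd {1} (W.X T₀ ω)
      have h2 := wf_ind_bd (Ioo 0 1) (W.X T₀ ω)
      have h3 := wfh_mem s σ hx
      rcases hx.1.eq_or_lt with h | h
      · have : wfh s σ (W.X T₀ ω) = 0 := by rw [← h, wfh_zero]
        linarith [h1.1, h2.1]
      · rcases hx.2.eq_or_lt with h' | h'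
        · have : ({1} : Set ℝ).indicator (1 : ℝ → ℝ) (W.X T₀ ω) = 1 := by rw [h']; simp
          linarith [h3.2, h2.1]
        · have : (Ioo (0:ℝ) 1).indicator (1 : ℝ → ℝ) (W.X T₀ ω) = 1 := by
            exact indicator_of_mem (show W.X T₀ ω ∈ Ioo (0:ℝ) 1 from ⟨h, h'⟩) _
          linarith [h3.2, h1.1])
    change _ ≤ ∫ ω, (({1} : Set ℝ).indicator (1 : ℝ → ℝ) (W.X T₀ ω)
        + (Ioo (0:ℝ) 1).indicator (1 : ℝ → ℝ) (W.X T₀ ω)) ∂W.P at this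
    rw [integral_add (hind _ (measurableSet_singleton (1:ℝ))) (hind (Ioo 0 1) measurableSet_Ioo)]
      at this
    linarith
  have hr1 : r 1 ≤ 0 := hneg 1 (by simp)
  have hK : ∀ᵐ ω ∂W.P, Real.exp (-(M * T₀)) * Real.exp (r 1 * T)
      * ({1} : Set ℝ).indicator 1 (W.X T₀ ω) ≤ wfV W r T ω := by
    filter_upwards [wf_abs_all W hσ] with ω hω
    by_cases h : W.X T₀ ω = 1
    · rw [h]
      simp only [mem_singleton_iff, indicator_of_mem, Pi.one_apply, mul_one]
      rw [← Real.exp_add]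
      refine Real.exp_le_exp.2 ?_
      rcases le_total T T₀ with hTT | hTT
      · have := (abs_le.1 (wfV_bound W hr hM hT ω)).1
        nlinarith [mul_nonneg hM0 (sub_nonneg.2 hTT), mul_nonneg (neg_nonneg.2 hr1) hT]
      · have hi : ∀ a b : ℝ, IntegrableOn (fun u => r (W.X u ω)) (Ioc a b) := fun a b =>
          Integrable.of_bound (hr.comp (W.contX ω).measurable).aestronglyMeasurable M
            (Eventually.of_forall fun u => hM _ (W.range01 u ω))
        have h1 := (abs_le.1 (wfV_bound W hr hM hT0.le ω)).1
        rw [← Ioc_union_Ioc_eq_Ioc hT0.le hTT, setIntegral_union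
          (Ioc_disjoint_Ioc_of_le le_rfl) measurableSet_Ioc (hi _ _) (hi _ _)]
        have h2 : ∫ u in Ioc T₀ T, r (W.X u ω) = ∫ u in Ioc T₀ T, r 1 := by
          refine setIntegral_congr_fun measurableSet_Ioc fun u hu => ?_
          beta_reduce
          rw [(hω T₀ u hT0.le hu.1.le).2 h]
        rw [h2, setIntegral_const, smul_eq_mul]
        simp only [Real.volume_real_Ioc_of_le hTT]
        nlinarith [mul_nonneg (neg_nonneg.2 hr1) hT0.le]
    · have : W.X T₀ ω ∉ ({1} : Set ℝ) := h
      rw [indicator_of_notMem this, mul_zero]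
      exact (wfV_pos W r T ω).le
  have hfin := integral_mono_ae (Integrable.const_mul (wf_int_bdd W 1 _
    ((measurable_one.indicator (measurableSet_singleton (1:ℝ))).comp (W.measX T₀)) fun ω => by
      have := wf_ind_bd {1} (W.X T₀ ω)
      simp only [Function.comp]
      rw [abs_of_nonneg this.1]; exact this.2) (Real.exp (-(M * T₀)) * Real.exp (r 1 * T)))
    (wf_int_bdd W _ _ (wfV_meas W hr T) (wfV_le W hr hM hT)) hK
  rw [integral_const_mul] at hfin
  have := mul_le_mul_of_nonneg_left hone
    (show 0 ≤ Real.exp (-(M * T₀)) * Real.exp (r 1 * T) by positivity)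
  simp only [Function.comp] at hfin
  refine le_trans (le_of_eq (by ring)) (this.trans hfin)
end lower

lemma wf_tv (W : WFKilled s σ r μ₀) {t δ : ℝ} (h0 : W.P (W.aliveSoft t) ≠ 0)
    (hδ : (W.P ({ω | W.X t ω ∈ ({1}ᶜ : Set ℝ)} ∩ W.aliveSoft t)).toReal
      / (W.P (W.aliveSoft t)).toReal ≤ δ) :
    tvDist (W.condLaw (W.aliveSoft t) t) (Measure.dirac (1:ℝ)) ≤ δ := by
  set m := W.condLaw (W.aliveSoft t) t with hm
  have hfin : W.P (W.aliveSoft t) ≠ ∞ := measure_ne_top _ _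
  have hprob : IsProbabilityMeasure m := by
    constructor
    rw [hm, WFKilled.condLaw, Measure.smul_apply, Measure.map_apply (W.measX t) MeasurableSet.univ]
    simp only [preimage_univ, Measure.restrict_apply_univ, smul_eq_mul]
    exact ENNReal.inv_mul_cancel h0 hfin
  have hc : m.real {1}ᶜ ≤ δ := by
    refine le_trans (le_of_eq ?_) hδ
    rw [measureReal_def, hm, WFKilled.condLaw, Measure.smul_apply,
      Measure.map_apply (W.measX t) (measurableSet_singleton _).compl,
      Measure.restrict_apply (W.measX t (measurableSet_singleton _).compl), smul_eq_mul,
      ENNReal.toReal_mul, ENNReal.toReal_inv, div_eq_inv_mul]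
    rfl
  refine ciSup_le fun A => ?_
  change |m.real A - (Measure.dirac (1:ℝ) A).toReal| ≤ δ
  rw [Measure.dirac_apply]
  by_cases h : (1:ℝ) ∈ A
  · rw [indicator_of_mem h]
    simp only [Pi.one_apply, ENNReal.toReal_one]
    have h1 : m.real A ≤ 1 := measureReal_le_one
    have h2 : m.real {1} ≤ m.real A := measureReal_mono (singleton_subset_iff.2 h)
    have h3 : m.real {1}ᶜ = 1 - m.real {1} := probReal_compl_eq_one_sub (measurableSet_singleton _)
    rw [abs_le]; constructor <;> linarith
  · rw [indicator_of_notMem h]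
    have h2 : m.real A ≤ m.real {1}ᶜ := measureReal_mono (subset_compl_singleton_iff.2 h)
    have h1 : 0 ≤ m.real A := measureReal_nonneg
    simp only [ENNReal.toReal_zero, sub_zero]
    rw [abs_of_nonneg h1]; linarith

/-- Assume `ρ_1 < ρ_0 < ρ_α`, where `ρ_0 = -r(0)`, `ρ_1 = -r(1)` and
`ρ_α` is the extinction rate of the unique QSD `α` on `(0,1)` for `τ_{0,1,∂}`. Then
`δ_1` is the only stable quasi-stationary distribution for the soft killing time
`τ_∂`, with convergence rate `ρ_0 - ρ_1`: for all `n ≥ 1` and `ξ > 0` there is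
`C_{n,ξ} > 0` such that for every initial law `μ` with `μ[1/n, 1] ≥ ξ`,
`‖μA_t - δ_1‖_TV ≤ C_{n,ξ} e^{-(ρ_0-ρ_1)t}`. -/
theorem wf_fixation_at_one_stable
    (s σ : ℝ) (hs : 0 ≤ s) (hσ : 0 < σ)
    (r : ℝ → ℝ) (hrMeas : Measurable r) (hrBdd : ∃ M, ∀ x ∈ Icc (0:ℝ) 1, |r x| ≤ M)
    (hrNonpos : ∀ x ∈ Icc (0:ℝ) 1, r x ≤ 0)
    (hex : WFExists s σ r)
    (α : Measure ℝ) (ρα : ℝ)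
    (hQSD : IsQSD s σ r α ρα)
    (hQSDuniq : ∀ (α' : Measure ℝ) (ρ' : ℝ), IsQSD s σ r α' ρ' → α' = α ∧ ρ' = ρα)
    (hrate1 : -r 1 < -r 0) (hrate0 : -r 0 < ρα) :
    ∀ n : ℕ, 1 ≤ n → ∀ ξ : ℝ, 0 < ξ → ∃ C : ℝ, 0 < C ∧
      ∀ μ : Measure ℝ, IsProbabilityMeasure μ → μ (Icc (0:ℝ) 1)ᶜ = 0 →
        ENNReal.ofReal ξ ≤ μ (Icc (1/(n:ℝ)) 1) →
        ∀ W : WFKilled s σ r μ, ∀ t : ℝ, 0 ≤ t →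
          tvDist (W.condLaw (W.aliveSoft t) t) (Measure.dirac (1:ℝ))
            ≤ C * Real.exp (-((-r 0) - (-r 1)) * t) := by


  obtain ⟨M, hM⟩ := hrBdd
  have hαp := hQSD.1
  have hα01 : α (Icc (0:ℝ) 1)ᶜ = 0 :=
    measure_mono_null (compl_subset_compl.2 Ioo_subset_Icc_self) hQSD.2.1
  obtain ⟨W₀⟩ := hex α hαp hα01
  obtain ⟨C, hC0, hC⟩ := wf_upper hs hσ hrMeas hM hrNonpos hQSD W₀ hrate0
  intro n hn ξ hξ
  obtain ⟨c, hc0, hc⟩ := wf_lower hs hσ hrMeas hM hrNonpos n hn hξ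
  refine ⟨(C + 1) / c, by positivity, ?_⟩
  intro μ hμ hμ01 hμξ W t ht
  have hal : (W.P (W.aliveSoft t)).toReal = ∫ ω, wfV W r t ω ∂W.P := by
    have := wf_kill_real W hrMeas hrNonpos t (A := univ) MeasurableSet.univ
    simpa using this
  have hlow := hc μ hμ hμξ W t ht
  have hup := hC μ W t ht
  rw [← hal] at hlow
  rw [← wf_kill_real W hrMeas hrNonpos t (measurableSet_singleton (1:ℝ)).compl] at hup
  have hlpos : 0 < c * Real.exp (r 1 * t) := by positivity
  have hpos : 0 < (W.P (W.aliveSoft t)).toReal := hlpos.trans_le hlow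
  apply wf_tv W
  · intro h; rw [h] at hpos; simp at hpos
  · have h1 : C * Real.exp (r 0 * t) ≤ (C + 1) * Real.exp (r 0 * t) := by
      have := Real.exp_pos (r 0 * t); nlinarith
    refine (div_le_div₀ (by positivity) (hup.trans h1) hlpos hlow).trans (le_of_eq ?_)
    have e : Real.exp (-((-r 0) - (-r 1)) * t) = Real.exp (r 0 * t) / Real.exp (r 1 * t) := by
      rw [← Real.exp_sub]; congr 1; ring
    rw [e]
    field_simp

end
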